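/- A finite connected simple bipartite graph G does not have the {1,2}-property if and only if G is a simple odd multi-cactus. -/

import Mathlib

open scoped Classical

/-- The weighted degree of vertex `v` under edge-weighting `w`:
the sum of the weights of the edges incident with `v`. -/
noncomputable def wdeg {V : Type} [Fintype V] (G : SimpleGraph V) (w : Sym2 V → ℕ) (v : V) : ℕ :=
  ∑ u ∈ Finset.univ.filter (fun u => G.Adj v u), w s(v, u)

/-- `w` is a `{0,1}`-weighting of `G`: every edge gets weight `0` or `1`. -/
def Is01Weighting {V : Type} (G : SimpleGraph V) (w : Sym2 V → ℕ) : Prop :=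
  ∀ e ∈ G.edgeSet, w e = 0 ∨ w e = 1

/-- `G` has the `{0,1}`-property: it admits a proper (neighbour sum-distinguishing)
`{0,1}`-edge-weighting. A graph without this property is called *bad*. -/
def HasZeroOneProperty {V : Type} [Fintype V] (G : SimpleGraph V) : Prop :=
  ∃ w : Sym2 V → ℕ, Is01Weighting G w ∧
    ∀ ⦃u v : V⦄, G.Adj u v → wdeg G w u ≠ wdeg G w v
/-- Integer-valued weighted degree. -/
noncomputable def wdegZ {V : Type} [Fintype V] (G : SimpleGraph V) (w : Sym2 V → ℤ) (v : V) : ℤ :=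
  ∑ u ∈ Finset.univ.filter (fun u => G.Adj v u), w s(v, u)

/-- `G` has the `{a,b}`-property: there is an edge-weighting with values in `{a,b}` under
which adjacent vertices get distinct weighted degrees. -/
def HasABProperty {V : Type} [Fintype V] (G : SimpleGraph V) (a b : ℤ) : Prop :=
  ∃ w : Sym2 V → ℤ, (∀ e ∈ G.edgeSet, w e = a ∨ w e = b) ∧
    ∀ ⦃u v : V⦄, G.Adj u v → wdegZ G w u ≠ wdegZ G w v
/-- The `i`-th vertex of a path from `u` to `v` with `n` fresh internal vertices. -/
def pathVert {V : Type} (u v : V) (n : ℕ) (i : Fin (n + 2)) : V ⊕ Fin n :=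
  if h0 : i.1 = 0 then Sum.inl u
  else if hn : i.1 ≤ n then Sum.inr ⟨i.1 - 1, by omega⟩
  else Sum.inl v

/-- The edges of a path of length `n + 1` from `u` to `v` with `n` fresh internal vertices. -/
def pathEdges {V : Type} (u v : V) (n : ℕ) : Set (Sym2 (V ⊕ Fin n)) :=
  {e | ∃ i : Fin (n + 1), e = s(pathVert u v n i.castSucc, pathVert u v n i.succ)}

/-- The green edges of such a path, coloured alternately red, green, …, green, red
(so the `i`-th edge is green exactly when `i` is odd). -/
def greenPathEdges {V : Type} (u v : V) (n : ℕ) : Set (Sym2 (V ⊕ Fin n)) :=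
  {e | ∃ i : Fin (n + 1), Odd i.1 ∧ e = s(pathVert u v n i.castSucc, pathVert u v n i.succ)}

/-- The graph obtained from `G` by adding a path of length `n + 1` from `u` to `v`,
internally disjoint from `G` (its `n` internal vertices are fresh). -/
def addPathGraph {V : Type} (G : SimpleGraph V) (u v : V) (n : ℕ) :
    SimpleGraph (V ⊕ Fin n) :=
  SimpleGraph.fromEdgeSet ((Sym2.map Sum.inl '' G.edgeSet) ∪ pathEdges u v n)

/-- The recursion building simple odd multi-cacti together with their red-green
edge-colouring (given by the set of green edges): `K₂` with its unique edge green is a simple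
odd multi-cactus, and one may repeatedly add, along a green edge `uv`, a new internally
disjoint path of length `l ≡ 1 [MOD 4]`, `l ≥ 5` (here `l = 4 * k + 5`), whose edges are
coloured alternately red, green, …, green, red. -/
inductive OMC : ∀ (V : Type), SimpleGraph V → Set (Sym2 V) → Prop
  | k2 : OMC (Fin 2) ⊤ ((⊤ : SimpleGraph (Fin 2)).edgeSet)
  | addPath {V : Type} {G : SimpleGraph V} {green : Set (Sym2 V)} (h : OMC V G green)
      (u v : V) (hadj : G.Adj u v) (hgreen : s(u, v) ∈ green) (k : ℕ) :
      OMC (V ⊕ Fin (4 * k + 4)) (addPathGraph G u v (4 * k + 4))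
        (Sym2.map Sum.inl '' green ∪ greenPathEdges u v (4 * k + 4))

/-- `G` is a simple odd multi-cactus: it is isomorphic to a graph produced by the
recursion `OMC`. -/
def IsSimpleOddMultiCactus {V : Type} (G : SimpleGraph V) : Prop :=
  ∃ (W : Type) (H : SimpleGraph W) (green : Set (Sym2 W)),
    OMC W H green ∧ Nonempty (G ≃g H)

namespace OddCactus

/-- `w` assigns to every edge `e` a weight between `m e` and `2 * m e`, i.e. `w` is the sum of a
`{1,2}`-weighting over `m e` parallel copies of `e`. -/
def Admissible {V : Type} (G : SimpleGraph V) (m w : Sym2 V → ℕ) : Prop :=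
  ∀ e ∈ G.edgeSet, m e ≤ w e ∧ w e ≤ 2 * m e

/-- The multigraph with underlying graph `G` and multiplicities `m` has the `{1,2}`-property. -/
def Good {V : Type} [Fintype V] (G : SimpleGraph V) (m : Sym2 V → ℕ) : Prop :=
  ∃ w, Admissible G m w ∧ ∀ ⦃u v : V⦄, G.Adj u v → wdeg G w u ≠ wdeg G w v

section Degrees

variable {V : Type} [Fintype V] {G : SimpleGraph V}

theorem wdeg_eq_sum_ite (G : SimpleGraph V) (w : Sym2 V → ℕ) (v : V) :
    wdeg G w v = ∑ u, if G.Adj v u then w s(v, u) else 0 :=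
  Finset.sum_filter _ _

theorem wdeg_congr {w w' : Sym2 V → ℕ} {v : V}
    (h : ∀ u, G.Adj v u → w s(v, u) = w' s(v, u)) : wdeg G w v = wdeg G w' v :=
  Finset.sum_congr rfl fun u hu => h u (Finset.mem_filter.1 hu).2

theorem wdeg_mono {w w' : Sym2 V → ℕ} {v : V}
    (h : ∀ u, G.Adj v u → w s(v, u) ≤ w' s(v, u)) : wdeg G w v ≤ wdeg G w' v :=
  Finset.sum_le_sum fun u hu => h u (Finset.mem_filter.1 hu).2

theorem le_wdeg {w : Sym2 V → ℕ} {v u : V} (h : G.Adj v u) : w s(v, u) ≤ wdeg G w v :=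
  Finset.single_le_sum (f := fun u => w s(v, u)) (fun _ _ => Nat.zero_le _)
    (Finset.mem_filter.2 ⟨Finset.mem_univ u, h⟩)

theorem add_le_wdeg {w : Sym2 V → ℕ} {v a b : V} (ha : G.Adj v a) (hb : G.Adj v b) (hab : a ≠ b) :
    w s(v, a) + w s(v, b) ≤ wdeg G w v := by
  rw [← Finset.sum_pair (f := fun u => w s(v, u)) hab]
  refine Finset.sum_le_sum_of_subset fun x hx => ?_
  simp only [Finset.mem_insert, Finset.mem_singleton] at hx
  rcases hx with rfl | rfl <;> simp [ha, hb]

theorem add_add_le_wdeg {w : Sym2 V → ℕ} {v a b c : V} (ha : G.Adj v a) (hb : G.Adj v b)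
    (hc : G.Adj v c) (hab : a ≠ b) (hac : a ≠ c) (hbc : b ≠ c) :
    w s(v, a) + w s(v, b) + w s(v, c) ≤ wdeg G w v := by
  have : ∑ u ∈ ({a, b, c} : Finset V), w s(v, u) = w s(v, a) + w s(v, b) + w s(v, c) := by
    rw [Finset.sum_insert (by simp [hab, hac]), Finset.sum_pair hbc, add_assoc]
  rw [← this]
  refine Finset.sum_le_sum_of_subset fun x hx => ?_
  simp only [Finset.mem_insert, Finset.mem_singleton] at hx
  rcases hx with rfl | rfl | rfl <;> simp [ha, hb, hc]

theorem wdeg_pair {w : Sym2 V → ℕ} {v a b : V} (hab : a ≠ b)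
    (h : ∀ y, G.Adj v y ↔ y = a ∨ y = b) : wdeg G w v = w s(v, a) + w s(v, b) := by
  rw [wdeg, ← Finset.sum_pair (f := fun u => w s(v, u)) hab]
  congr 1
  ext x
  simp [h]

theorem wdeg_singleton {w : Sym2 V → ℕ} {v a : V}
    (h : ∀ y, G.Adj v y ↔ y = a) : wdeg G w v = w s(v, a) := by
  rw [wdeg, ← Finset.sum_singleton (fun u => w s(v, u)) a]
  congr 1
  ext x
  simp [h]

theorem Admissible.le_wdeg {m w : Sym2 V → ℕ} (h : Admissible G m w) (v : V) :
    wdeg G m v ≤ wdeg G w v :=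
  wdeg_mono fun u hu => (h s(v, u) hu).1

theorem wdeg_update_of_ne {w : Sym2 V → ℕ} {x q v : V} (hx : v ≠ x) (hq : v ≠ q) (t : ℕ) :
    wdeg G (Function.update w s(x, q) t) v = wdeg G w v := by
  refine wdeg_congr fun u _ => Function.update_of_ne ?_ _ _
  intro h
  rcases Sym2.eq_iff.1 h with ⟨h, -⟩ | ⟨h, -⟩
  · exact hx h
  · exact hq h

end Degrees

theorem sum_sum_eq_zero_of_symm {V : Type} (D : Finset V) (f : V → V → ZMod 2)
    (hs : ∀ a b, f a b = f b a) (hd : ∀ a, f a a = 0) : ∑ a ∈ D, ∑ b ∈ D, f a b = 0 := by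
  rw [← Finset.sum_product']
  refine Finset.sum_involution (fun p _ => (p.2, p.1)) ?_ ?_ ?_ ?_
  · rintro ⟨a, b⟩ -
    rw [hs b a]
    exact CharTwo.add_self_eq_zero _
  · rintro ⟨a, b⟩ - h h'
    simp only [Prod.mk.injEq] at h'
    obtain ⟨rfl, -⟩ := h'
    exact h (hd _)
  · rintro ⟨a, b⟩ h
    simpa [and_comm] using h
  · rintro ⟨a, b⟩ -
    rfl

section Parity

variable {V : Type} [Fintype V]

/-- Modulo two, the degrees of a vertex set sum to the weight of its boundary. -/
theorem sum_wdeg_eq_boundary (G : SimpleGraph V) (w : Sym2 V → ℕ) (D : Finset V) :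
    ∑ v ∈ D, (wdeg G w v : ZMod 2) =
      ∑ v ∈ D, ∑ u ∈ Dᶜ, if G.Adj v u then (w s(v, u) : ZMod 2) else 0 := by
  have h0 : ∑ v ∈ D, ∑ u ∈ D, (if G.Adj v u then (w s(v, u) : ZMod 2) else 0) = 0 :=
    sum_sum_eq_zero_of_symm D _ (fun a b => by simp [G.adj_comm a b, Sym2.eq_swap])
      fun a => by simp
  have h1 : ∀ v, (wdeg G w v : ZMod 2) =
      ∑ u ∈ D, (if G.Adj v u then (w s(v, u) : ZMod 2) else 0) +
      ∑ u ∈ Dᶜ, (if G.Adj v u then (w s(v, u) : ZMod 2) else 0) := by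
    intro v
    rw [Finset.sum_add_sum_compl, wdeg_eq_sum_ite]
    push_cast
    rfl
  simp_rw [h1]
  rw [Finset.sum_add_distrib, h0, zero_add]

theorem sum_wdeg_eq_zero (G : SimpleGraph V) (w : Sym2 V → ℕ) :
    ∑ v, (wdeg G w v : ZMod 2) = 0 := by
  simpa using sum_wdeg_eq_boundary G w Finset.univ

theorem exists_join_of_reachable (H : SimpleGraph V) {u v : V} (h : H.Reachable u v) :
    ∃ f : Sym2 V → ZMod 2, (∀ e, e ∉ H.edgeSet → f e = 0) ∧
      ∀ x, ∑ y, f s(x, y) = (if x = u then 1 else 0) + (if x = v then 1 else 0) := by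
  obtain ⟨p⟩ := h
  induction p with
  | nil =>
    refine ⟨0, fun _ _ => rfl, fun x => ?_⟩
    simp [CharTwo.add_self_eq_zero]
  | @cons a b c hab p ih =>
    obtain ⟨f, hf, hf'⟩ := ih
    refine ⟨fun e => f e + if e = s(a, b) then 1 else 0, fun e he => ?_, fun x => ?_⟩
    · have : e ≠ s(a, b) := by
        rintro rfl
        exact he hab
      simp [hf e he, this]
    · have h1 : ∑ y, (if s(x, y) = s(a, b) then (1 : ZMod 2) else 0) =
          (if x = a then 1 else 0) + (if x = b then 1 else 0) := by
        by_cases hxa : x = a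
        · subst hxa
          simp [hab.ne]
        · by_cases hxb : x = b
          · subst hxb
            simp [hxa]
          · simp [hxa, hxb]
      rw [Finset.sum_add_distrib, hf', h1]
      have : (if x = b then (1 : ZMod 2) else 0) + (if x = b then 1 else 0) = 0 :=
        CharTwo.add_self_eq_zero _
      linear_combination this

/-- Existence of `T`-joins: it suffices to control the parity on all components but one, and
globally. -/
theorem exists_join (H : SimpleGraph V) (τ : V → ZMod 2) (x₀ : V) (hτ : ∑ v, τ v = 0)
    (hcomp : ∀ v, ¬ H.Reachable x₀ v → ∑ y with H.Reachable v y, τ y = 0) :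
    ∃ f : Sym2 V → ZMod 2, (∀ e, e ∉ H.edgeSet → f e = 0) ∧ ∀ x, ∑ y, f s(x, y) = τ x := by
  let r : V → V := fun v => (H.connectedComponentMk v).out
  have hr : ∀ v, H.Reachable v (r v) := fun v =>
    SimpleGraph.ConnectedComponent.exact (Quot.out_eq (H.connectedComponentMk v)).symm
  have hr' : ∀ v u, H.Reachable v u → r v = r u := fun v u h => by
    simp only [r]
    rw [SimpleGraph.ConnectedComponent.sound h]
  choose f hf hf' using fun v => exists_join_of_reachable H (hr v)
  let F : Sym2 V → ZMod 2 := fun e => ∑ v, τ v * f v e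
  have hF0 : ∀ e, e ∉ H.edgeSet → F e = 0 := fun e he => by simp [F, hf _ e he]
  have hF : ∀ x, ∑ y, F s(x, y) = τ x + ∑ v with r v = x, τ v := by
    intro x
    simp only [F]
    rw [Finset.sum_comm]
    simp_rw [← Finset.mul_sum, hf', mul_add, Finset.sum_add_distrib]
    simp [Finset.sum_filter, eq_comm]
  have hF1 : ∀ x, x ≠ r x₀ → ∑ y, F s(x, y) = τ x := by
    intro x hx
    rw [hF, add_eq_left]
    by_cases hx' : r x = x
    · rw [← hcomp x]
      · refine Finset.sum_congr ?_ fun _ _ => rfl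
        ext v
        simp only [Finset.mem_filter, Finset.mem_univ, true_and]
        refine ⟨fun h => ?_, fun h => ?_⟩
        · have := hr v
          rw [h] at this
          exact this.symm
        · rw [← hr' x v h, hx']
      · intro h
        exact hx (by rw [hr' _ _ h, hx'])
    · refine Finset.sum_eq_zero fun v hv => ?_
      exfalso
      simp only [Finset.mem_filter, Finset.mem_univ, true_and] at hv
      refine hx' ?_
      have := hr v
      rw [hv] at this
      rw [← hr' _ _ this, hv]
  refine ⟨F, hF0, fun x => ?_⟩
  by_cases hx : x = r x₀
  · have h1 : ∑ x, ∑ y, F s(x, y) = 0 :=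
      sum_sum_eq_zero_of_symm Finset.univ (fun x y => F s(x, y))
        (fun a b => by rw [Sym2.eq_swap]) fun a => hF0 _ (by simp)
    rw [← Finset.add_sum_erase _ _ (Finset.mem_univ x)] at h1 hτ
    rw [Finset.sum_congr rfl fun z hz => hF1 z (by
      rw [← hx]; exact (Finset.mem_erase.1 hz).1)] at h1
    linear_combination h1 - hτ
  · exact hF1 x hx

/-- Adjusting weights by at most one along the edges of `H` to get prescribed degree parities. -/
theorem exists_admissible_of_parity {G H : SimpleGraph V} {m w₀ : Sym2 V → ℕ}
    (hm : ∀ e, 1 ≤ m e) (hHG : H ≤ G) (hw₀ : Admissible G m w₀) (ψ : V → ZMod 2) (x₀ : V)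
    (hψ : ∑ v, ψ v = 0)
    (hcomp : ∀ v, ¬ H.Reachable x₀ v →
      ∑ y with H.Reachable v y, (ψ y - wdeg G w₀ y) = 0) :
    ∃ w, Admissible G m w ∧ (∀ e, e ∉ H.edgeSet → w e = w₀ e) ∧
      (∀ e, w e ≤ w₀ e + 1 ∧ w₀ e ≤ w e + 1) ∧ ∀ v, (wdeg G w v : ZMod 2) = ψ v := by
  obtain ⟨f, hf, hf'⟩ := exists_join H (fun v => ψ v - wdeg G w₀ v) x₀
    (by rw [Finset.sum_sub_distrib, hψ, sum_wdeg_eq_zero, sub_zero]) hcomp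
  let w : Sym2 V → ℕ := fun e =>
    if f e = 0 then w₀ e else if w₀ e < 2 * m e then w₀ e + 1 else w₀ e - 1
  refine ⟨w, fun e he => ?_, fun e he => ?_, fun e => ?_, fun v => ?_⟩
  · have := hw₀ e he
    have := hm e
    simp only [w]
    split_ifs <;> omega
  · simp [w, hf e he]
  · simp only [w]
    split_ifs <;> omega
  · have key : ∀ e ∈ G.edgeSet, (w e : ZMod 2) = w₀ e + f e := by
      intro e he
      have h1 := hw₀ e he
      have h2 := hm e
      simp only [w]
      by_cases h0 : f e = 0
      · simp [h0]
      · have h1' : f e = 1 := by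
          generalize f e = z at *
          revert z; decide
        rw [if_neg h0, h1']
        split_ifs
        · push_cast; rfl
        · rw [Nat.cast_sub (by omega), Nat.cast_one, CharTwo.sub_eq_add]
    have h1 : (wdeg G w v : ZMod 2) = wdeg G w₀ v + ∑ y, f s(v, y) := by
      rw [wdeg_eq_sum_ite, wdeg_eq_sum_ite]
      push_cast
      rw [← Finset.sum_add_distrib]
      refine Finset.sum_congr rfl fun u _ => ?_
      by_cases h : G.Adj v u
      · simp [h, key _ (G.mem_edgeSet.2 h)]
      · have : s(v, u) ∉ H.edgeSet := fun h' => h (hHG h')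
        simp [h, hf _ this]
    rw [h1, hf']
    ring

end Parity

section Thin

variable {V : Type} {G : SimpleGraph V} {m : Sym2 V → ℕ}

/-- Besides `q`, the vertex `p` has exactly one neighbour, joined to `p` by a single edge. -/
def HalfThin (G : SimpleGraph V) (m : Sym2 V → ℕ) (p q : V) : Prop :=
  G.Adj p q ∧ ∃ x, x ≠ q ∧ G.Adj p x ∧ m s(p, x) = 1 ∧ ∀ y, G.Adj p y → y = q ∨ y = x

/-- `pq` is an edge both of whose ends have exactly one further neighbour, through a
single edge. -/
def Thin (G : SimpleGraph V) (m : Sym2 V → ℕ) (p q : V) : Prop :=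
  HalfThin G m p q ∧ HalfThin G m q p

/-- A conflict on the edge `xy` can be removed by reweighting a thin multiple edge at `x`. -/
def Cleanable (G : SimpleGraph V) (m : Sym2 V → ℕ) (x y : V) : Prop :=
  ∃ q, q ≠ y ∧ Thin G m x q ∧ 2 ≤ m s(x, q)

theorem Thin.symm {p q : V} (h : Thin G m p q) : Thin G m q p := ⟨h.2, h.1⟩

theorem Thin.adj {p q : V} (h : Thin G m p q) : G.Adj p q := h.1.1

/-- Conflicts that are all cleanable can be removed. -/
theorem good_of_cleanable [Fintype V] {w : Sym2 V → ℕ}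
    (hw : Admissible G m w)
    (hc : ∀ x y, G.Adj x y → wdeg G w x = wdeg G w y → Cleanable G m x y ∨ Cleanable G m y x) :
    Good G m := by
  induction hn : (Finset.univ.filter fun p : V × V => G.Adj p.1 p.2 ∧
    wdeg G w p.1 = wdeg G w p.2).card using Nat.strong_induction_on generalizing w with
  | _ n ih =>
  by_cases h : ∃ x y, G.Adj x y ∧ wdeg G w x = wdeg G w y
  swap
  · push Not at h
    exact ⟨w, hw, fun u v huv => h u v huv⟩
  have h' : ∃ x y, G.Adj x y ∧ wdeg G w x = wdeg G w y ∧ Cleanable G m x y := by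
    obtain ⟨x, y, hxy, he⟩ := h
    rcases hc x y hxy he with hcl | hcl
    · exact ⟨x, y, hxy, he, hcl⟩
    · exact ⟨y, x, hxy.symm, he.symm, hcl⟩
  obtain ⟨x, y, hxy, he, q, hqy, ⟨⟨hxq, x', hx'q, hxx', -, hxall⟩, -, q', hq'x, hqq', -, hqall⟩,
      hm2⟩ := h'
  have hyx' : y = x' := (hxall y hxy).resolve_left hqy.symm
  subst hyx'
  have hq'q : q' ≠ q := hqq'.ne'
  have hyx : y ≠ x := hxy.ne'
  have hxw : ∀ w : Sym2 V → ℕ, wdeg G w x = w s(x, q) + w s(x, y) := fun w =>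
    wdeg_pair hqy fun z => ⟨hxall z, by rintro (rfl | rfl) <;> assumption⟩
  have hqw : ∀ w : Sym2 V → ℕ, wdeg G w q = w s(q, x) + w s(q, q') := fun w =>
    wdeg_pair hq'x.symm fun z => ⟨hqall z, by rintro (rfl | rfl); exacts [hxq.symm, hqq']⟩
  obtain ⟨t, ht1, ht2, ht3, ht4⟩ : ∃ t, m s(x, q) ≤ t ∧ t ≤ m s(x, q) + 2 ∧
      t + w s(x, y) ≠ wdeg G w y ∧ t + w s(q, q') ≠ wdeg G w q' := by
    by_contra hcon
    push Not at hcon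
    have h0 := hcon (m s(x, q)) le_rfl (by omega)
    have h1 := hcon (m s(x, q) + 1) (by omega) (by omega)
    have h2 := hcon (m s(x, q) + 2) (by omega) (by omega)
    omega
  set w' := Function.update w s(x, q) t with hw'
  have e1 : w' s(x, y) = w s(x, y) := Function.update_of_ne (by
    rw [Ne, Sym2.congr_right]; exact hqy.symm) _ _
  have e2 : w' s(q, q') = w s(q, q') := Function.update_of_ne (by
    rw [Sym2.eq_swap (a := x), Ne, Sym2.congr_right]; exact hq'x) _ _
  have e3 : w' s(x, q) = t := Function.update_self _ _ _
  have e4 : w' s(q, x) = t := by rw [Sym2.eq_swap]; exact e3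
  have hoff : ∀ v, v ≠ x → v ≠ q → wdeg G w' v = wdeg G w v := fun v h1 h2 =>
    wdeg_update_of_ne h1 h2 t
  have hx1 : wdeg G w' x ≠ wdeg G w' y := by
    rw [hxw, hoff y hyx hqy.symm, e1, e3]; exact ht3
  have hq1 : wdeg G w' q ≠ wdeg G w' q' := by
    rw [hqw, hoff q' hq'x hq'q, e2, e4]; exact ht4
  have hwxq : w s(q, x) = w s(x, q) := by rw [Sym2.eq_swap]
  have hconf : ∀ a b, G.Adj a b → wdeg G w' a = wdeg G w' b → wdeg G w a = wdeg G w b := by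
    have main : ∀ a b, G.Adj a b → (a = x ∨ a = q) → wdeg G w' a = wdeg G w' b →
        wdeg G w a = wdeg G w b := by
      rintro a b hab (rfl | rfl) heq
      · rcases hxall b hab with rfl | rfl
        · rw [hxw, hqw] at heq ⊢
          omega
        · exact absurd heq hx1
      · rcases hqall b hab with rfl | rfl
        · rw [hxw, hqw] at heq ⊢
          omega
        · exact absurd heq hq1
    intro a b hab heq
    by_cases ha : a = x ∨ a = q
    · exact main a b hab ha heq
    by_cases hb : b = x ∨ b = q
    · exact (main b a hab.symm hb heq.symm).symm
    push Not at ha hb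
    rw [hoff a ha.1 ha.2, hoff b hb.1 hb.2] at heq
    exact heq
  refine ih _ ?_ (w := w') ?_ ?_ rfl
  · rw [← hn]
    refine Finset.card_lt_card (Finset.ssubset_iff_of_subset ?_ |>.2 ⟨(x, y), ?_, ?_⟩)
    · intro p hp
      simp only [Finset.mem_filter, Finset.mem_univ, true_and] at hp ⊢
      exact ⟨hp.1, hconf _ _ hp.1 hp.2⟩
    · simp [hxy, he]
    · simp [hx1]
  · intro e hE
    by_cases h : e = s(x, q)
    · subst h; rw [e3]; omega
    · rw [hw', Function.update_of_ne h]; exact hw e hE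
  · intro a b hab heq
    exact hc a b hab (hconf a b hab heq)

end Thin

end OddCactus

namespace OddCactus

section PathGraph

variable {V : Type}

/-- The vertices of the path from `u` to `v` with `n` fresh internal vertices, indexed by `ℕ`. -/
def earVert (u v : V) (n i : ℕ) : V ⊕ Fin n :=
  if i = 0 then Sum.inl u else if h : i - 1 < n then Sum.inr ⟨i - 1, h⟩ else Sum.inl v

theorem pathVert_eq (u v : V) (n : ℕ) (i : Fin (n + 2)) :
    pathVert u v n i = earVert u v n i.1 := by
  have := i.2
  unfold pathVert earVert
  split_ifs <;> first | rfl | omega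

theorem mem_pathEdges {u v : V} {n : ℕ} {e : Sym2 (V ⊕ Fin n)} :
    e ∈ pathEdges u v n ↔ ∃ i ≤ n, e = s(earVert u v n i, earVert u v n (i + 1)) := by
  simp only [pathEdges, Set.mem_ofPred_eq, pathVert_eq]
  constructor
  · rintro ⟨i, rfl⟩
    exact ⟨i.1, by omega, rfl⟩
  · rintro ⟨i, hi, rfl⟩
    exact ⟨⟨i, by omega⟩, rfl⟩

theorem mem_greenPathEdges {u v : V} {n : ℕ} {e : Sym2 (V ⊕ Fin n)} :
    e ∈ greenPathEdges u v n ↔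
      ∃ i ≤ n, Odd i ∧ e = s(earVert u v n i, earVert u v n (i + 1)) := by
  simp only [greenPathEdges, Set.mem_ofPred_eq, pathVert_eq]
  constructor
  · rintro ⟨i, ho, rfl⟩
    exact ⟨i.1, by omega, ho, rfl⟩
  · rintro ⟨i, hi, ho, rfl⟩
    exact ⟨⟨i, by omega⟩, ho, rfl⟩

theorem earVert_zero (u v : V) (n : ℕ) : earVert u v n 0 = Sum.inl u := by simp [earVert]

theorem earVert_last (u v : V) (n : ℕ) : earVert u v n (n + 1) = Sum.inl v := by simp [earVert]

theorem earVert_succ (u v : V) {n i : ℕ} (h : i < n) :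
    earVert u v n (i + 1) = Sum.inr ⟨i, h⟩ := by simp [earVert, h]

theorem earVert_inr (u v : V) {n : ℕ} (i : Fin n) :
    Sum.inr i = earVert u v n (i.1 + 1) := (earVert_succ u v i.2).symm

theorem earVert_eq_inr {u v : V} {n i : ℕ} {j : Fin n} :
    earVert u v n i = Sum.inr j ↔ i = j.1 + 1 := by
  have := j.2
  unfold earVert
  split_ifs with h1 h2
  · simp; omega
  · simp only [Sum.inr.injEq, Fin.ext_iff]; omega
  · simp; omega

theorem earVert_eq_inl {u v : V} {n i : ℕ} {a : V} (hi : i ≤ n + 1) :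
    earVert u v n i = Sum.inl a ↔ i = 0 ∧ u = a ∨ i = n + 1 ∧ v = a := by
  unfold earVert
  split_ifs with h1 h2
  · simp [h1]
  · simp; omega
  · have : i = n + 1 := by omega
    simp [this]

theorem earVert_inj {u v : V} {n i j : ℕ} (hi : 1 ≤ i) (hin : i ≤ n)
    (h : earVert u v n i = earVert u v n j) : i = j := by
  obtain ⟨i, rfl⟩ := Nat.exists_eq_add_of_le' hi
  rw [earVert_succ u v (by omega), eq_comm, earVert_eq_inr] at h
  exact h.symm

theorem addPathGraph_adj_inl {G : SimpleGraph V} {u v : V} {n : ℕ} (hn : 1 ≤ n) {a b : V} :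
    (addPathGraph G u v n).Adj (Sum.inl a) (Sum.inl b) ↔ G.Adj a b := by
  rw [addPathGraph, SimpleGraph.fromEdgeSet_adj]
  constructor
  · rintro ⟨⟨e, he, h⟩ | h, -⟩
    · induction e with
      | _ x y =>
      simp only [Sym2.map_mk, Sym2.eq_iff, Sum.inl.injEq] at h
      rcases h with ⟨rfl, rfl⟩ | ⟨rfl, rfl⟩
      · exact he
      · exact (G.mem_edgeSet.1 he).symm
    · obtain ⟨i, hi, h⟩ := mem_pathEdges.1 h
      exfalso
      rcases Sym2.eq_iff.1 h with ⟨h1, h2⟩ | ⟨h1, h2⟩ <;>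
      · have h1 := h1.symm
        have h2 := h2.symm
        rw [earVert_eq_inl (by omega)] at h1 h2
        omega
  · intro h
    exact ⟨Or.inl ⟨s(a, b), h, rfl⟩, by simpa using h.ne⟩

theorem addPathGraph_adj_earVert {G : SimpleGraph V} {u v : V} {n : ℕ} {j : ℕ} (hj : 1 ≤ j)
    (hjn : j ≤ n) {y : V ⊕ Fin n} :
    (addPathGraph G u v n).Adj (earVert u v n j) y ↔
      y = earVert u v n (j - 1) ∨ y = earVert u v n (j + 1) := by
  obtain ⟨j, rfl⟩ := Nat.exists_eq_add_of_le' hj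
  rw [addPathGraph, SimpleGraph.fromEdgeSet_adj, earVert_succ u v (by omega)]
  simp only [Nat.add_sub_cancel]
  constructor
  · rintro ⟨⟨e, he, h⟩ | h, -⟩
    · induction e with
      | _ x z => simp [Sym2.map_mk] at h
    · obtain ⟨i, hi, h⟩ := mem_pathEdges.1 h
      rcases Sym2.eq_iff.1 h with ⟨h1, h2⟩ | ⟨h1, h2⟩
      · have := earVert_eq_inr.1 h1.symm
        simp only at this
        subst this
        exact Or.inr h2
      · have := earVert_eq_inr.1 h1.symm
        simp only at this
        obtain rfl : i = j := by omega
        exact Or.inl h2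
  · rintro (rfl | rfl)
    · refine ⟨Or.inr (mem_pathEdges.2 ⟨j, by omega, ?_⟩), ?_⟩
      · rw [Sym2.eq_swap, earVert_succ u v (by omega)]
      · intro h
        have := earVert_eq_inr.1 h.symm
        simp at this
    · refine ⟨Or.inr (mem_pathEdges.2 ⟨j + 1, by omega, ?_⟩), ?_⟩
      · rw [earVert_succ u v (show j < n by omega)]
      · intro h
        have := earVert_eq_inr.1 h.symm
        simp at this

theorem addPathGraph_adj_inl_inr {G : SimpleGraph V} {u v : V} {n : ℕ} {a : V} {j : Fin n} :
    (addPathGraph G u v n).Adj (Sum.inl a) (Sum.inr j) ↔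
      a = u ∧ j.1 = 0 ∨ a = v ∧ j.1 + 1 = n := by
  have := j.2
  rw [SimpleGraph.adj_comm, earVert_inr u v j, addPathGraph_adj_earVert (by omega) (by omega),
    eq_comm, earVert_eq_inl (by omega), eq_comm (a := Sum.inl a), earVert_eq_inl (by omega)]
  constructor
  · rintro ((⟨h, rfl⟩ | ⟨h, rfl⟩) | (⟨h, rfl⟩ | ⟨h, rfl⟩))
    · left; exact ⟨rfl, by omega⟩
    · omega
    · omega
    · right; exact ⟨rfl, by omega⟩
  · rintro (⟨rfl, h⟩ | ⟨rfl, h⟩)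
    · left; left; exact ⟨by omega, rfl⟩
    · right; right; exact ⟨by omega, rfl⟩

end PathGraph

theorem wdegZ_pair {V : Type} [Fintype V] {G : SimpleGraph V} {w : Sym2 V → ℤ} {v a b : V}
    (hab : a ≠ b) (h : ∀ y, G.Adj v y ↔ y = a ∨ y = b) :
    wdegZ G w v = w s(v, a) + w s(v, b) := by
  rw [wdegZ, ← Finset.sum_pair (f := fun u => w s(v, u)) hab]
  congr 1
  ext x
  simp [h]

theorem eq_of_alternating {W : ℕ → ℤ} {k : ℕ} (h12 : ∀ i ≤ 4 * k + 4, W i = 1 ∨ W i = 2)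
    (halt : ∀ i, i ≤ 4 * k + 4 → Odd i → W (i - 1) ≠ W (i + 1)) : W (4 * k + 4) = W 0 := by
  have : ∀ j, j ≤ k + 1 → W (4 * j) = W 0 := by
    intro j
    induction j with
    | zero => intro; rfl
    | succ j ih =>
      intro hj
      have h0 := ih (by omega)
      have h1 := halt (4 * j + 1) (by omega) ⟨2 * j, by ring⟩
      have h2 := halt (4 * j + 3) (by omega) ⟨2 * j + 1, by ring⟩
      have a0 := h12 (4 * j) (by omega)
      have a2 := h12 (4 * j + 2) (by omega)
      have a4 := h12 (4 * (j + 1)) (by omega)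
      simp only [show 4 * j + 1 - 1 = 4 * j by omega, show 4 * j + 1 + 1 = 4 * j + 2 by omega,
        show 4 * j + 3 - 1 = 4 * j + 2 by omega, show 4 * j + 3 + 1 = 4 * (j + 1) by omega]
        at h1 h2
      omega
  exact this (k + 1) le_rfl

/-- In a simple odd multi-cactus the green edges form a matching, and every `{1,2}`-weighting,
even with vertex offsets that are constant along green edges, has a conflict on a green edge. -/
theorem _root_.OMC.exists_conflict {V : Type} {G : SimpleGraph V} {green : Set (Sym2 V)}
    (h : OMC V G green) :
    green ⊆ G.edgeSet ∧ (∀ a b c, s(a, b) ∈ green → s(a, c) ∈ green → b = c) ∧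
    ∀ [Fintype V] (w : Sym2 V → ℤ) (x : V → ℤ), (∀ e ∈ G.edgeSet, w e = 1 ∨ w e = 2) →
      (∀ a b, s(a, b) ∈ green → x a = x b) →
      ∃ a b, s(a, b) ∈ green ∧ wdegZ G w a + x a = wdegZ G w b + x b := by
  induction h with
  | k2 =>
    refine ⟨subset_rfl, ?_, ?_⟩
    · intro a b c hb hc
      simp only [SimpleGraph.mem_edgeSet, SimpleGraph.top_adj] at hb hc
      omega
    · intro inst w x hw hx
      have h01 : s((0 : Fin 2), 1) ∈ (⊤ : SimpleGraph (Fin 2)).edgeSet := by simp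
      refine ⟨0, 1, h01, ?_⟩
      rw [hx 0 1 h01]
      have hs : ∀ a b : Fin 2, a ≠ b → wdegZ ⊤ w a = w s(a, b) := by
        intro a b hab
        rw [wdegZ, ← Finset.sum_singleton (fun u => w s(a, u)) b]
        congr 1
        ext z
        simp only [SimpleGraph.top_adj, Finset.mem_filter, Finset.mem_univ, true_and,
          Finset.mem_singleton]
        omega
      rw [hs 0 1 (by decide), hs 1 0 (by decide), Sym2.eq_swap]
  | @addPath V G green h u v hadj hgreen k ih =>
    obtain ⟨hsub, hmat, ih⟩ := ih
    set n := 4 * k + 4 with hn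
    have hE : ∀ i ≤ n, s(earVert u v n i, earVert u v n (i + 1)) ∈
        (addPathGraph G u v n).edgeSet := by
      intro i hi
      rw [SimpleGraph.mem_edgeSet]
      rcases Nat.eq_zero_or_pos i with rfl | h0
      · rw [SimpleGraph.adj_comm, addPathGraph_adj_earVert (by omega) (by omega)]
        left; rfl
      · rw [addPathGraph_adj_earVert (by omega) (by omega)]
        right; rfl
    refine ⟨?_, ?_, ?_⟩
    · rintro e (⟨e, he, rfl⟩ | he)
      · have := hsub he
        induction e with
        | _ a b => exact (addPathGraph_adj_inl (by omega)).2 this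
      · obtain ⟨i, hi, -, rfl⟩ := mem_greenPathEdges.1 he
        exact hE i hi
    · have key : ∀ (a b : V ⊕ Fin n), s(a, b) ∈ Sym2.map Sum.inl '' green ∪ greenPathEdges u v n →
          (∃ a' b', a = Sum.inl a' ∧ b = Sum.inl b' ∧ s(a', b') ∈ green) ∨
          (∃ j : Fin n,
              a = Sum.inr j ∧ b = earVert u v n (if Odd (j.1 + 1) then j.1 + 2 else j.1)) := by
        rintro a b (⟨e, he, h⟩ | h)
        · left
          induction e with
          | _ x y =>
          simp only [Sym2.map_mk, Sym2.eq_iff] at h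
          rcases h with ⟨rfl, rfl⟩ | ⟨rfl, rfl⟩
          · exact ⟨x, y, rfl, rfl, he⟩
          · exact ⟨y, x, rfl, rfl, by rwa [Sym2.eq_swap]⟩
        · right
          obtain ⟨i, hi, ho, h⟩ := mem_greenPathEdges.1 h
          have hi' : i + 1 ≤ n := by
            rcases ho with ⟨r, hr⟩; omega
          have hi0 : 1 ≤ i := by rcases ho with ⟨r, hr⟩; omega
          obtain ⟨i, rfl⟩ := Nat.exists_eq_add_of_le' hi0
          rcases Sym2.eq_iff.1 h with ⟨h1, h2⟩ | ⟨h1, h2⟩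
          · refine ⟨⟨i, by omega⟩, ?_, ?_⟩
            · rw [h1, earVert_succ]
            · rw [h2, if_pos ho]
          · refine ⟨⟨i + 1, by omega⟩, ?_, ?_⟩
            · rw [h1, earVert_succ]
            · rw [h2, if_neg]
              simpa [Nat.odd_add_one] using ho
      intro a b c hb hc
      rcases key a b hb with ⟨a', b', rfl, rfl, hb'⟩ | ⟨j, rfl, rfl⟩
      · rcases key _ c hc with ⟨a'', c', h1, rfl, hc'⟩ | ⟨j, h, -⟩
        · rw [Sum.inl.injEq] at h1
          subst h1
          rw [hmat _ _ _ hb' hc']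
        · simp at h
      · rcases key _ c hc with ⟨a'', c', h1, rfl, hc⟩ | ⟨j', h, rfl⟩
        · simp at h1
        · rw [Sum.inr.injEq] at h
          rw [h]
    · intro inst w x hw hx
      have : Finite V := Finite.of_injective (Sum.inl : V → V ⊕ Fin n) Sum.inl_injective
      have : Fintype V := Fintype.ofFinite V
      obtain rfl : inst = instFintypeSum V (Fin n) := Subsingleton.elim _ _
      let W : ℕ → ℤ := fun i => w s(earVert u v n i, earVert u v n (i + 1))
      have hW : ∀ i ≤ n, W i = 1 ∨ W i = 2 := fun i hi => hw _ (hE i hi)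
      have hgr : ∀ i ≤ n, Odd i → s(earVert u v n i, earVert u v n (i + 1)) ∈
          Sym2.map Sum.inl '' green ∪ greenPathEdges u v n := fun i hi ho =>
        Or.inr (mem_greenPathEdges.2 ⟨i, hi, ho, rfl⟩)
      have hdeg : ∀ i, i < n → wdegZ (addPathGraph G u v n) w (earVert u v n (i + 1)) =
          W i + W (i + 1) := by
        intro i hi
        rw [wdegZ_pair (a := earVert u v n i) (b := earVert u v n (i + 2))]
        · simp only [W]
          rw [Sym2.eq_swap]
        · intro h
          rcases Nat.eq_zero_or_pos i with rfl | h0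
          · have := earVert_inj (by omega) (by omega) h.symm
            omega
          · have := earVert_inj (by omega) (by omega) h
            omega
        · intro y
          exact addPathGraph_adj_earVert (by omega) (by omega)
      by_cases hc : ∃ i, i ≤ n ∧ Odd i ∧ W (i - 1) = W (i + 1)
      · obtain ⟨i, hi, ho, he⟩ := hc
        refine ⟨_, _, hgr i hi ho, ?_⟩
        rw [hx _ _ (hgr i hi ho)]
        have hi1 : i + 1 ≤ n := by rcases ho with ⟨r, hr⟩; omega
        have hi0 : 1 ≤ i := by rcases ho with ⟨r, hr⟩; omega
        obtain ⟨i, rfl⟩ := Nat.exists_eq_add_of_le' hi0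
        rw [hdeg i (by omega), hdeg (i + 1) (by omega)]
        simp only [Nat.add_sub_cancel] at he
        rw [he]; ring
      · push Not at hc
        have hlast : W n = W 0 := eq_of_alternating hW hc
        have hdeg' : ∀ a, wdegZ (addPathGraph G u v n) w (Sum.inl a) =
            wdegZ G (fun e => w (Sym2.map Sum.inl e)) a +
              (if a = u ∨ a = v then W 0 else 0) := by
          intro a
          rw [wdegZ, wdegZ, Finset.sum_filter, Finset.sum_filter, Fintype.sum_sum_type]
          congr 1
          · refine Finset.sum_congr rfl fun b _ => ?_
            simp [addPathGraph_adj_inl (show 1 ≤ n by omega)]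
          · have huv : u ≠ v := hadj.ne
            by_cases hau : a = u
            · subst hau
              rw [if_pos (Or.inl rfl), Finset.sum_eq_single (⟨0, by omega⟩ : Fin n)]
              · rw [if_pos (addPathGraph_adj_inl_inr.2 (Or.inl ⟨rfl, rfl⟩))]
                simp only [W]
                rw [earVert_zero, earVert_succ]
              · intro j _ hj
                rw [if_neg]
                rw [addPathGraph_adj_inl_inr]
                rintro (⟨-, h⟩ | ⟨h, -⟩)
                · exact hj (Fin.ext h)
                · exact huv h
              · simp
            · by_cases hav : a = v
              · subst hav
                rw [if_pos (Or.inr rfl), Finset.sum_eq_single (⟨4 * k + 3, by omega⟩ : Fin n)]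
                · rw [if_pos (addPathGraph_adj_inl_inr.2 (Or.inr ⟨rfl, rfl⟩)), ← hlast]
                  simp only [W]
                  have hl : earVert u a n n = Sum.inr ⟨4 * k + 3, by omega⟩ :=
                    earVert_eq_inr.2 rfl
                  rw [earVert_last, Sym2.eq_swap, hl]
                · intro j _ hj
                  rw [if_neg]
                  rw [addPathGraph_adj_inl_inr]
                  rintro (⟨h, -⟩ | ⟨-, h⟩)
                  · exact huv h.symm
                  · exact hj (Fin.ext (by simp only; omega))
                · simp
              · rw [if_neg (by tauto)]
                refine Finset.sum_eq_zero fun j _ => ?_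
                rw [if_neg]
                rw [addPathGraph_adj_inl_inr]
                tauto
        have hw' : ∀ e ∈ G.edgeSet, w (Sym2.map Sum.inl e) = 1 ∨ w (Sym2.map Sum.inl e) = 2 := by
          intro e he
          refine hw _ ?_
          induction e with
          | _ a b => exact (addPathGraph_adj_inl (by omega)).2 he
        obtain ⟨a, b, hab, he⟩ := ih (fun e => w (Sym2.map Sum.inl e))
          (fun a => x (Sum.inl a) + if a = u ∨ a = v then W 0 else 0) hw' (by
            intro a b hab
            rw [hx (Sum.inl a) (Sum.inl b) (Or.inl ⟨_, hab, rfl⟩)]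
            have : (a = u ∨ a = v) ↔ (b = u ∨ b = v) := by
              have hba : s(b, a) ∈ green := by rwa [Sym2.eq_swap]
              have hvu : s(v, u) ∈ green := by rwa [Sym2.eq_swap]
              constructor
              · rintro (rfl | rfl)
                · exact Or.inr (hmat _ _ _ hab hgreen)
                · exact Or.inl (hmat _ _ _ hab hvu)
              · rintro (rfl | rfl)
                · exact Or.inr (hmat _ _ _ hba hgreen)
                · exact Or.inl (hmat _ _ _ hba hvu)
            simp only [this])
        refine ⟨Sum.inl a, Sum.inl b, Or.inl ⟨_, hab, rfl⟩, ?_⟩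
        rw [hdeg', hdeg']
        linarith

theorem wdegZ_iso {V W : Type} [Fintype V] [Fintype W] {G : SimpleGraph V} {H : SimpleGraph W}
    (φ : G ≃g H) (w : Sym2 V → ℤ) (v : V) :
    wdegZ H (fun e => w (Sym2.map φ.symm e)) (φ v) = wdegZ G w v := by
  rw [wdegZ, wdegZ, Finset.sum_filter, Finset.sum_filter]
  refine (Fintype.sum_equiv φ.toEquiv _ _ fun u => ?_).symm
  have : H.Adj (φ v) (φ u) ↔ G.Adj v u := φ.map_adj_iff
  simp [this]

/-- Simple odd multi-cacti do not have the `{1,2}`-property. -/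
theorem not_hasABProperty_of_cactus {V : Type} [Fintype V] {G : SimpleGraph V}
    (h : IsSimpleOddMultiCactus G) : ¬ HasABProperty G 1 2 := by
  obtain ⟨W, H, green, hO, ⟨φ⟩⟩ := h
  rintro ⟨w, hw, hne⟩
  have : Fintype W := Fintype.ofEquiv V φ.toEquiv
  obtain ⟨hsub, -, hcon⟩ := hO.exists_conflict
  obtain ⟨a, b, hab, he⟩ := hcon (fun e => w (Sym2.map φ.symm e)) (fun _ => 0) (by
    intro e he
    refine hw _ ?_
    induction e with
    | _ a b => exact φ.symm.map_adj_iff.2 he) (fun _ _ _ => rfl)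
  have h1 := wdegZ_iso φ w (φ.symm a)
  have h2 := wdegZ_iso φ w (φ.symm b)
  simp only [RelIso.apply_symm_apply] at h1 h2
  refine hne (φ.symm.map_adj_iff.2 (hsub hab)) ?_
  rw [← h1, ← h2]
  linarith

end OddCactus

namespace OddCactus

/-- The subgraph of the edges of `G` with both ends in `K`. -/
def onSet {V : Type} (G : SimpleGraph V) (K : Set V) : SimpleGraph V where
  Adj a b := G.Adj a b ∧ a ∈ K ∧ b ∈ K
  symm := ⟨fun _ _ h => ⟨h.1.symm, h.2.2, h.2.1⟩⟩
  loopless := ⟨fun _ h => h.1.ne rfl⟩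

/-- `p 1, …, p n` are vertices of `P` of degree two forming a path whose two ends are attached
to the vertices `p 0` and `p (n + 1)` outside `P`. -/
structure PathIn {V : Type} (G : SimpleGraph V) (P : Set V) (n : ℕ) (p : ℕ → V) : Prop where
  one_le : 1 ≤ n
  inj : ∀ i j, 1 ≤ i → i ≤ n → 1 ≤ j → j ≤ n → p i = p j → i = j
  mem : ∀ i, 1 ≤ i → i ≤ n → p i ∈ P
  adj : ∀ i, i ≤ n → G.Adj (p i) (p (i + 1))
  zero : p 0 ∉ P
  last : p (n + 1) ∉ P
  nbr : ∀ i, i < n → ∀ y, G.Adj (p (i + 1)) y → y = p i ∨ y = p (i + 2)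
  ne : ∀ i, i < n → p i ≠ p (i + 2)

namespace PathIn

variable {V : Type} {G : SimpleGraph V} {P : Set V} {n : ℕ} {p : ℕ → V}

theorem nbr_iff (h : PathIn G P n p) {i : ℕ} (hi : i < n) (y : V) :
    G.Adj (p (i + 1)) y ↔ y = p i ∨ y = p (i + 2) :=
  ⟨h.nbr i hi y, by
    rintro (rfl | rfl)
    · exact (h.adj i (by omega)).symm
    · exact h.adj (i + 1) (by omega)⟩

theorem wdeg_eq [Fintype V] (h : PathIn G P n p) (w : Sym2 V → ℕ) {i : ℕ} (hi : i < n) :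
    wdeg G w (p (i + 1)) = w s(p i, p (i + 1)) + w s(p (i + 1), p (i + 2)) := by
  rw [wdeg_pair (h.ne i hi) (h.nbr_iff hi), Sym2.eq_swap]

theorem ne_of_notMem (h : PathIn G P n p) {v : V} (hv : v ∉ P) {i : ℕ} (h1 : 1 ≤ i) (h2 : i ≤ n) :
    p i ≠ v := fun he => hv (he ▸ h.mem i h1 h2)

theorem edge_inj (h : PathIn G P n p) {i j : ℕ} (hi : i ≤ n) (hj : j ≤ n)
    (he : s(p i, p (i + 1)) = s(p j, p (j + 1))) : i = j := by
  have key : ∀ a b, a ≤ n + 1 → b ≤ n + 1 → p a = p b →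
      a = b ∨ (a = 0 ∧ b = n + 1) ∨ (a = n + 1 ∧ b = 0) := by
    intro a b ha hb hab
    by_cases ha1 : 1 ≤ a ∧ a ≤ n
    · by_cases hb1 : 1 ≤ b ∧ b ≤ n
      · exact Or.inl (h.inj a b ha1.1 ha1.2 hb1.1 hb1.2 hab)
      · exfalso
        rcases (show b = 0 ∨ b = n + 1 by omega) with rfl | rfl
        · exact h.ne_of_notMem h.zero ha1.1 ha1.2 hab
        · exact h.ne_of_notMem h.last ha1.1 ha1.2 hab
    · by_cases hb1 : 1 ≤ b ∧ b ≤ n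
      · exfalso
        rcases (show a = 0 ∨ a = n + 1 by omega) with rfl | rfl
        · exact h.ne_of_notMem h.zero hb1.1 hb1.2 hab.symm
        · exact h.ne_of_notMem h.last hb1.1 hb1.2 hab.symm
      · omega
  have hn := h.one_le
  rcases Sym2.eq_iff.1 he with ⟨h1, h2⟩ | ⟨h1, h2⟩
  · have := key i j (by omega) (by omega) h1
    have := key (i + 1) (j + 1) (by omega) (by omega) h2
    omega
  · have := key i (j + 1) (by omega) (by omega) h1
    have := key (i + 1) j (by omega) (by omega) h2
    rcases (show i = j ∨ (n = 1) by omega) with h3 | h3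
    · exact h3
    · subst h3
      exfalso
      have hne := h.ne 0 (by omega)
      rcases (show (i = 0 ∧ j = 1) ∨ (i = 1 ∧ j = 0) by omega) with ⟨rfl, rfl⟩ | ⟨rfl, rfl⟩
      · exact hne h1
      · exact hne h2.symm

/-- Reversal of a path. -/
theorem reverse (h : PathIn G P n p) : PathIn G P n (fun i => p (n + 1 - i)) where
  one_le := h.one_le
  inj i j hi hin hj hjn he := by
    have := h.inj _ _ (by omega) (by omega) (by omega) (by omega) he
    omega
  mem i hi hin := h.mem _ (by omega) (by omega)
  adj i hi := by
    have := h.adj (n - i) (by omega)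
    rw [show n - i + 1 = n + 1 - i by omega] at this
    rw [show n + 1 - (i + 1) = n - i by omega]
    exact this.symm
  zero := h.last
  last := by simpa using h.zero
  nbr i hi y hy := by
    rw [show n + 1 - (i + 1) = n - i - 1 + 1 by omega] at hy
    have := h.nbr _ (by omega) y hy
    rw [show n - i - 1 + 2 = n + 1 - i by omega] at this
    rw [show n + 1 - (i + 2) = n - i - 1 by omega]
    exact this.symm
  ne i hi := by
    have := h.ne (n - i - 1) (by omega)
    rw [show n - i - 1 + 2 = n + 1 - i by omega] at this
    rw [show n + 1 - (i + 2) = n - i - 1 by omega]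
    exact this.symm

theorem reachable_iff (h : PathIn G P n p) {i : ℕ} (hi : 1 ≤ i) (hin : i ≤ n) (y : V) :
    (onSet G P).Reachable (p i) y ↔ ∃ j, 1 ≤ j ∧ j ≤ n ∧ p j = y := by
  constructor
  · rintro ⟨W⟩
    have : ∀ x z (W : (onSet G P).Walk x z), (∃ j, 1 ≤ j ∧ j ≤ n ∧ p j = x) →
        ∃ j, 1 ≤ j ∧ j ≤ n ∧ p j = z := by
      intro x z W
      induction W with
      | nil => exact id
      | cons hab W ih =>
        rintro ⟨j, h1, h2, rfl⟩
        refine ih ?_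
        obtain ⟨j, rfl⟩ := Nat.exists_eq_add_of_le' h1
        rcases h.nbr j (by omega) _ hab.1 with rfl | rfl
        · refine ⟨j, ?_, by omega, rfl⟩
          by_contra h0
          obtain rfl : j = 0 := by omega
          exact h.zero hab.2.2
        · refine ⟨j + 2, by omega, ?_, rfl⟩
          by_contra h0
          obtain rfl : j + 1 = n := by omega
          exact h.last hab.2.2
    exact this _ _ W ⟨i, hi, hin, rfl⟩
  · have base : ∀ j, 1 ≤ j → j ≤ n → (onSet G P).Reachable (p 1) (p j) := by
      intro j
      induction j with
      | zero => intro h0; omega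
      | succ j ih =>
        intro _ hj
        rcases Nat.eq_zero_or_pos j with rfl | h0
        · exact SimpleGraph.Reachable.rfl
        · refine (ih h0 (by omega)).trans (SimpleGraph.Adj.reachable ?_)
          exact ⟨h.adj j (by omega), h.mem _ h0 (by omega), h.mem _ (by omega) hj⟩
    rintro ⟨j, h1, h2, rfl⟩
    exact (base i hi hin).symm.trans (base j h1 h2)

theorem sum_reachable [Fintype V] (h : PathIn G P n p) {M : Type} [AddCommMonoid M] (f : V → M)
    {i : ℕ} (hi : 1 ≤ i) (hin : i ≤ n) :
    ∑ y with (onSet G P).Reachable (p i) y, f y = ∑ j ∈ Finset.range n, f (p (j + 1)) := by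
  symm
  refine Finset.sum_bij (fun j _ => p (j + 1)) ?_ ?_ ?_ ?_
  · intro j hj
    rw [Finset.mem_range] at hj
    simp only [Finset.mem_filter, Finset.mem_univ, true_and]
    exact (h.reachable_iff hi hin _).2 ⟨j + 1, by omega, by omega, rfl⟩
  · intro a ha b hb hab
    rw [Finset.mem_range] at ha hb
    have := h.inj _ _ (by omega) (by omega) (by omega) (by omega) hab
    omega
  · intro y hy
    simp only [Finset.mem_filter, Finset.mem_univ, true_and] at hy
    obtain ⟨j, h1, h2, rfl⟩ := (h.reachable_iff hi hin _).1 hy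
    obtain ⟨j, rfl⟩ := Nat.exists_eq_add_of_le' h1
    exact ⟨j, by simp; omega, rfl⟩
  · intro j _; rfl

theorem sum_wdeg [Fintype V] (h : PathIn G P n p) (w : Sym2 V → ℕ) :
    ∑ j ∈ Finset.range n, (wdeg G w (p (j + 1)) : ZMod 2) =
      w s(p 0, p 1) + w s(p n, p (n + 1)) := by
  have : ∀ k ≤ n, ∑ j ∈ Finset.range k, (wdeg G w (p (j + 1)) : ZMod 2) =
      w s(p 0, p 1) + w s(p k, p (k + 1)) := by
    intro k
    induction k with
    | zero => intro; simp [CharTwo.add_self_eq_zero]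
    | succ k ih =>
      intro hk
      rw [Finset.sum_range_succ, ih (by omega), h.wdeg_eq w (by omega)]
      push_cast
      have := CharTwo.add_self_eq_zero (w s(p k, p (k + 1)) : ZMod 2)
      linear_combination this
  exact this n le_rfl

theorem color_eq (h : PathIn G P n p) {c : V → ZMod 2} (hc : ∀ u v, G.Adj u v → c v = c u + 1)
    {i : ℕ} (hi : i ≤ n + 1) : c (p i) = c (p 0) + i := by
  induction i with
  | zero => simp
  | succ i ih =>
    rw [hc _ _ (h.adj i (by omega)), ih (by omega)]
    push_cast; ring

end PathIn

/-- Every vertex of a set `P` of degree-two vertices lies on a path through `P`. -/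
theorem exists_pathIn {V : Type} [Finite V] {G : SimpleGraph V} (hG : G.Connected) {P : Set V}
    (hP : ∀ x ∈ P, ∃ a b, a ≠ b ∧ ∀ y, G.Adj x y ↔ y = a ∨ y = b) {z : V} (hz : z ∉ P) {v : V}
    (hv : v ∈ P) : ∃ n p, PathIn G P n p ∧ ∃ j, 1 ≤ j ∧ j ≤ n ∧ p j = v := by
  obtain ⟨x, hxP, a, haP, hxa, hvx⟩ : ∃ x ∈ P, ∃ a ∉ P, G.Adj x a ∧ (onSet G P).Reachable v x := by
    obtain ⟨W⟩ := hG v z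
    clear hP
    induction W with
    | nil => exact absurd hv hz
    | @cons u t _ hab W ih =>
      by_cases ht : t ∈ P
      · obtain ⟨x, h1, a, h2, h3, h4⟩ := ih hz ht
        refine ⟨x, h1, a, h2, h3, (SimpleGraph.Adj.reachable ?_).trans h4⟩
        exact ⟨hab, hv, ht⟩
      · exact ⟨u, hv, t, ht, hab, SimpleGraph.Reachable.rfl⟩
  have hoth : ∀ x y, ∃ t, x ∈ P → G.Adj x y → t ≠ y ∧ G.Adj x t ∧ ∀ r,
      G.Adj x r → r = y ∨ r = t := by
    intro x y
    by_cases hx : x ∈ P ∧ G.Adj x y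
    · obtain ⟨a, b, hab, h⟩ := hP x hx.1
      rcases (h y).1 hx.2 with rfl | rfl
      · exact ⟨b, fun _ _ => ⟨hab.symm, (h b).2 (Or.inr rfl), fun r hr => (h r).1 hr⟩⟩
      · exact ⟨a, fun _ _ => ⟨hab, (h a).2 (Or.inl rfl), fun r hr => ((h r).1 hr).symm⟩⟩
    · exact ⟨x, fun h1 h2 => absurd ⟨h1, h2⟩ hx⟩
  choose oth hoth using hoth
  let q : ℕ → V × V := fun i => Nat.rec (a, x) (fun _ r => (r.2, oth r.2 r.1)) i
  let p : ℕ → V := fun i => (q i).1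
  have hp0 : p 0 = a := rfl
  have hp1 : p 1 = x := rfl
  have hp2 : ∀ i, p (i + 2) = oth (p (i + 1)) (p i) := fun i => rfl
  have hadj : ∀ N, (∀ i, 1 ≤ i → i ≤ N → p i ∈ P) → ∀ i ≤ N, G.Adj (p i) (p (i + 1)) := by
    intro N hN i
    induction i with
    | zero => intro; exact hxa.symm
    | succ i ih =>
      intro hi
      have := hoth (p (i + 1)) (p i) (hN _ (by omega) hi) (ih (by omega)).symm
      rw [← hp2] at this
      exact this.2.1
  have hnbr : ∀ N, (∀ i, 1 ≤ i → i ≤ N → p i ∈ P) → ∀ i < N,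
      p (i + 2) ≠ p i ∧ ∀ r, G.Adj (p (i + 1)) r → r = p i ∨ r = p (i + 2) := by
    intro N hN i hi
    have := hoth (p (i + 1)) (p i) (hN _ (by omega) hi) (hadj N hN i (by omega)).symm
    rw [← hp2] at this
    exact ⟨this.1, this.2.2⟩
  have hinj : ∀ j, (∀ i, 1 ≤ i → i ≤ j → p i ∈ P) → ∀ i, 1 ≤ i → i < j → p i ≠ p j := by
    intro j
    induction j using Nat.strong_induction_on with
    | _ j ih =>
    intro hN i hi hij he
    obtain ⟨i, rfl⟩ := Nat.exists_eq_add_of_le' hi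
    obtain ⟨j, rfl⟩ : ∃ j', j = j' + 1 := ⟨j - 1, by omega⟩
    have had : G.Adj (p (i + 1)) (p j) := by
      rw [he]; exact (hadj _ hN j (by omega)).symm
    have hsub : ∀ i', 1 ≤ i' → i' ≤ j → p i' ∈ P := fun i' h1 h2 => hN i' h1 (by omega)
    obtain ⟨h1, h2⟩ := hnbr _ hN i (by omega)
    rcases h2 _ had with h3 | h3
    · rcases Nat.eq_zero_or_pos i with rfl | h0
      · exact haP (by rw [← hp0, ← h3]; exact hsub j (by omega) le_rfl)
      · exact ih j (by omega) hsub i h0 (by omega) h3.symm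
    · rcases (show j = i + 1 ∨ j = i + 2 ∨ i + 2 < j by omega) with rfl | rfl | h4
      · exact had.ne rfl
      · have := (hnbr _ hN (i + 1) (by omega)).1
        exact this he.symm
      · exact ih j (by omega) hsub (i + 2) (by omega) h4 h3.symm
  have hex : ∃ N, 1 ≤ N ∧ p N ∉ P := by
    by_contra hcon
    push Not at hcon
    refine not_injective_infinite_finite (fun i : ℕ => p (i + 1)) fun i j hij => ?_
    by_contra hne
    rcases Nat.lt_or_gt_of_ne hne with h | h
    · exact hinj (j + 1) (fun i h1 _ => hcon i h1) (i + 1) (by omega) (by omega) hij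
    · exact hinj (i + 1) (fun i h1 _ => hcon i h1) (j + 1) (by omega) (by omega) hij.symm
  have hN := Nat.find_spec hex
  have hmin : ∀ i, 1 ≤ i → i < Nat.find hex → p i ∈ P := by
    intro i h1 h2
    by_contra h3
    exact Nat.find_min hex h2 ⟨h1, h3⟩
  generalize Nat.find hex = N at hN hmin
  have hN2 : 2 ≤ N := by
    by_contra h
    obtain rfl : N = 1 := by omega
    exact hN.2 hxP
  obtain ⟨n, rfl⟩ : ∃ n, N = n + 1 := ⟨N - 1, by omega⟩
  have hmin' : ∀ i, 1 ≤ i → i ≤ n → p i ∈ P := fun i h1 h2 => hmin i h1 (by omega)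
  have hpath : PathIn G P n p :=
    { one_le := by omega
      inj := fun i j hi hin hj hjn he => by
        by_contra hne
        rcases Nat.lt_or_gt_of_ne hne with h | h
        · exact hinj j (fun i h1 h2 => hmin' i h1 (by omega)) i hi h he
        · exact hinj i (fun i h1 h2 => hmin' i h1 (by omega)) j hj h he.symm
      mem := hmin'
      adj := fun i hi => hadj n hmin' i hi
      zero := haP
      last := hN.2
      nbr := fun i hi => (hnbr n hmin' i hi).2
      ne := fun i hi => (hnbr n hmin' i hi).1.symm }
  refine ⟨n, p, hpath, ?_⟩
  exact (hpath.reachable_iff (i := 1) le_rfl (by omega) v).1 hvx.symm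

end OddCactus

namespace OddCactus

/-- `G` is isomorphic to a simple odd multi-cactus in which all multiple edges are green. -/
def IsMultiCactus {V : Type} (G : SimpleGraph V) (m : Sym2 V → ℕ) : Prop :=
  ∃ (W : Type) (H : SimpleGraph W) (green : Set (Sym2 W)), OMC W H green ∧
    ∃ φ : G ≃g H, ∀ a b, G.Adj a b → 2 ≤ m s(a, b) → s(φ a, φ b) ∈ green

/-- A proper two-colouring. -/
def IsTwoColoring {V : Type} (G : SimpleGraph V) (c : V → ZMod 2) : Prop :=
  ∀ u v, G.Adj u v → c v = c u + 1

section Ear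

variable {V : Type} {G : SimpleGraph V} {m : Sym2 V → ℕ} {P : Set V} {p : ℕ → V}

/-- The weighting equal to `F i` on the `i`-th edge of a path and to `w` elsewhere. -/
noncomputable def pathWeight (p : ℕ → V) (n : ℕ) (F : ℕ → ℕ) (w : Sym2 V → ℕ) (e : Sym2 V) : ℕ :=
  if h : ∃ i, i ≤ n ∧ e = s(p i, p (i + 1)) then F h.choose else w e

theorem pathWeight_edge {n : ℕ} (h : PathIn G P n p) (F : ℕ → ℕ) (w : Sym2 V → ℕ) {i : ℕ}
    (hi : i ≤ n) : pathWeight p n F w s(p i, p (i + 1)) = F i := by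
  have hex : ∃ j, j ≤ n ∧ s(p i, p (i + 1)) = s(p j, p (j + 1)) := ⟨i, hi, rfl⟩
  rw [pathWeight, dif_pos hex]
  rw [← h.edge_inj hi hex.choose_spec.1 hex.choose_spec.2]

theorem pathWeight_of_forall_ne {n : ℕ} (F : ℕ → ℕ) (w : Sym2 V → ℕ) {e : Sym2 V}
    (he : ∀ i ≤ n, e ≠ s(p i, p (i + 1))) : pathWeight p n F w e = w e := by
  rw [pathWeight, dif_neg]
  rintro ⟨i, hi, h⟩
  exact he i hi h

/-- The interior of a path. -/
def interior (p : ℕ → V) (n : ℕ) : Set V := {x | ∃ i, 1 ≤ i ∧ i ≤ n ∧ p i = x}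

theorem PathIn.thin {n : ℕ} (h : PathIn G P n p) {i : ℕ} (hi : i + 1 < n)
    (h1 : m s(p i, p (i + 1)) = 1) (h2 : m s(p (i + 2), p (i + 3)) = 1) :
    Thin G m (p (i + 1)) (p (i + 2)) := by
  refine ⟨⟨h.adj _ (by omega), p i, h.ne i (by omega), (h.adj i (by omega)).symm, ?_, ?_⟩,
    ⟨(h.adj _ (by omega)).symm, p (i + 3), (h.ne (i + 1) (by omega)).symm,
      h.adj _ (by omega), h2, ?_⟩⟩
  · rwa [Sym2.eq_swap]
  · intro y hy
    exact (h.nbr i (by omega) y hy).symm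
  · intro y hy
    exact h.nbr (i + 1) (by omega) y hy

/-- The multiplicities induced on `D`, with one more parallel edge between `s` and `u`. -/
noncomputable def addParallel (m : Sym2 V → ℕ) (D : Set V) (s u : V) (e : Sym2 {x // x ∈ D}) : ℕ :=
  if e.map Subtype.val = s(s, u) then m s(s, u) + 1 else m (e.map Subtype.val)

theorem addParallel_self {D : Set V} {s u : V} (hs : s ∈ D) (hu : u ∈ D) :
    addParallel m D s u s(⟨s, hs⟩, ⟨u, hu⟩) = m s(s, u) + 1 := if_pos rfl

theorem addParallel_of_ne {D : Set V} {s u a b : V} (ha : a ∈ D) (hb : b ∈ D)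
    (h : s(a, b) ≠ s(s, u)) : addParallel m D s u s(⟨a, ha⟩, ⟨b, hb⟩) = m s(a, b) := if_neg h

theorem le_addParallel {D : Set V} {s u : V} (e : Sym2 {x // x ∈ D}) :
    m (e.map Subtype.val) ≤ addParallel m D s u e := by
  unfold addParallel
  split_ifs with h
  · rw [h]; omega
  · exact le_rfl

/-- If a graph contains an ear of the right length along an edge, with unit red edges, then
properness of the graph with the ear contracted to a parallel edge lifts to the whole graph. -/
theorem good_of_good_induce [Fintype V] {k : ℕ} (hm : ∀ e, 1 ≤ m e)
    (hp : PathIn G P (4 * k + 4) p) (hend : G.Adj (p 0) (p (4 * k + 5)))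
    (hunit : ∀ i ≤ 4 * k + 4, Even i → m s(p i, p (i + 1)) = 1)
    (hg : Good (G.induce (interior p (4 * k + 4))ᶜ)
      (addParallel m (interior p (4 * k + 4))ᶜ (p 0) (p (4 * k + 5)))) : Good G m := by
  set n := 4 * k + 4 with hn
  set D := interior p n with hD
  obtain ⟨w₀, hw₀, hne₀⟩ := hg
  have h0D : p 0 ∉ D := fun ⟨i, h1, h2, h3⟩ => hp.ne_of_notMem hp.zero h1 h2 h3
  have hLD : p (n + 1) ∉ D := fun ⟨i, h1, h2, h3⟩ => hp.ne_of_notMem hp.last h1 h2 h3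
  have hiD : ∀ i, i < n → p (i + 1) ∈ D := fun i hi => ⟨i + 1, by omega, by omega, rfl⟩
  let S : {x // x ∈ Dᶜ} := ⟨p 0, h0D⟩
  let U : {x // x ∈ Dᶜ} := ⟨p (n + 1), hLD⟩
  have hSU : (G.induce Dᶜ).Adj S U := hend
  -- the weight of the contracted edge splits
  obtain ⟨y, t, hyt, hy1, hy2, ht⟩ : ∃ y t, y + t = w₀ s(S, U) ∧ m s(p 0, p (n + 1)) ≤ y ∧
      y ≤ 2 * m s(p 0, p (n + 1)) ∧ (t = 1 ∨ t = 2) := by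
    have := hw₀ s(S, U) hSU
    rw [show addParallel m Dᶜ (p 0) (p (4 * k + 5)) s(S, U) = m s(p 0, p (n + 1)) + 1 from
      addParallel_self h0D hLD] at this
    have := hm s(p 0, p (n + 1))
    by_cases h : w₀ s(S, U) ≤ 2 * m s(p 0, p (n + 1)) + 1
    · exact ⟨w₀ s(S, U) - 1, 1, by omega, by omega, by omega, Or.inl rfl⟩
    · exact ⟨w₀ s(S, U) - 2, 2, by omega, by omega, by omega, Or.inr rfl⟩
  obtain ⟨g, hg, hg1, hg2⟩ : ∃ g, (g = 1 ∨ g = 2) ∧ g + t ≠ wdeg (G.induce Dᶜ) w₀ S ∧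
      (3 - g) + t ≠ wdeg (G.induce Dᶜ) w₀ U := by
    have := hne₀ hSU
    by_contra hcon
    push Not at hcon
    have a1 := hcon 1 (Or.inl rfl)
    have a2 := hcon 2 (Or.inr rfl)
    omega
  let F : ℕ → ℕ := fun i =>
    if Even i then (if i % 4 = 0 then t else 3 - t)
    else if m s(p i, p (i + 1)) = 1 then (if i % 4 = 1 then g else 3 - g)
    else m s(p i, p (i + 1))
  let r : V → {x // x ∈ Dᶜ} := fun x => if h : x ∈ Dᶜ then ⟨x, h⟩ else S
  have hr : ∀ x : {x // x ∈ Dᶜ}, r x.1 = x := fun x => dif_pos x.2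
  let w₁ : Sym2 V → ℕ := fun e => if e = s(p 0, p (n + 1)) then y else w₀ (e.map r)
  let w := pathWeight p n F w₁
  have hwE : ∀ i ≤ n, w s(p i, p (i + 1)) = F i := fun i hi => pathWeight_edge hp F w₁ hi
  have hwoff : ∀ a b, a ∉ D → b ∉ D → w s(a, b) = w₁ s(a, b) := by
    intro a b ha hb
    refine pathWeight_of_forall_ne F w₁ fun i hi he => ?_
    rcases Sym2.eq_iff.1 he with ⟨h1, h2⟩ | ⟨h1, h2⟩
    · rcases (show (i < n) ∨ (0 < i) by omega) with h | h
      · exact hb (h2 ▸ hiD i h)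
      · exact ha (h1 ▸ ⟨i, h, hi, rfl⟩)
    · rcases (show (i < n) ∨ (0 < i) by omega) with h | h
      · exact ha (h1 ▸ hiD i h)
      · exact hb (h2 ▸ ⟨i, h, hi, rfl⟩)
  have hadm : Admissible G m w := by
    intro e he
    by_cases hex : ∃ i, i ≤ n ∧ e = s(p i, p (i + 1))
    · obtain ⟨i, hi, rfl⟩ := hex
      rw [hwE i hi]
      simp only [F]
      split_ifs with h1 h2 h3 h4
      · rw [hunit i hi h1]; omega
      · rw [hunit i hi h1]; omega
      · omega
      · omega
      · omega
    · push Not at hex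
      rw [show w e = w₁ e from pathWeight_of_forall_ne F w₁ hex]
      simp only [w₁]
      split_ifs with h1
      · subst h1; exact ⟨hy1, hy2⟩
      · induction e with
        | _ a b =>
        have haD : a ∉ D := by
          rintro ⟨i, h3, h4, rfl⟩
          obtain ⟨i, rfl⟩ := Nat.exists_eq_add_of_le' h3
          rcases hp.nbr i (by omega) b he with rfl | rfl
          · exact hex i (by omega) Sym2.eq_swap
          · exact hex (i + 1) (by omega) rfl
        have hbD : b ∉ D := by
          rintro ⟨i, h3, h4, rfl⟩
          obtain ⟨i, rfl⟩ := Nat.exists_eq_add_of_le' h3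
          rcases hp.nbr i (by omega) a he.symm with rfl | rfl
          · exact hex i (by omega) rfl
          · exact hex (i + 1) (by omega) Sym2.eq_swap
        have := hw₀ s(⟨a, haD⟩, ⟨b, hbD⟩) he
        rw [addParallel_of_ne haD hbD h1] at this
        simp only [Sym2.map_mk]
        rw [hr ⟨a, haD⟩, hr ⟨b, hbD⟩]
        exact this
  have hF0 : F 0 = t := by simp [F]
  have hFn : F n = t := by
    have h1 : Even n := ⟨2 * k + 2, by omega⟩
    have h2 : n % 4 = 0 := by omega
    simp [F, h1, h2]
  have hp0L : p 0 ≠ p (n + 1) := hend.ne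
  have hnbrD : ∀ a, a ∉ D → ∑ x with x ∈ D, (if G.Adj a x then w s(a, x) else 0) =
      if a = p 0 ∨ a = p (n + 1) then t else 0 := by
    intro a ha
    have hz : ∀ i,
        i < n → G.Adj a (p (i + 1)) → (i = 0 ∧ a = p 0) ∨ (i + 1 = n ∧ a = p (n + 1)) := by
      intro i hi hadj
      rcases hp.nbr i hi a hadj.symm with rfl | rfl
      · left
        refine ⟨?_, ?_⟩
        · by_contra h0
          exact ha ⟨i, by omega, by omega, rfl⟩
        · by_contra h0
          exact ha ⟨i, by by_contra h1; exact h0 (by rw [show i = 0 by omega]), by omega, rfl⟩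
      · right
        have : i + 1 = n := by
          by_contra h0
          exact ha ⟨i + 2, by omega, by omega, rfl⟩
        exact ⟨this, by rw [← this]⟩
    by_cases ha0 : a = p 0
    · subst ha0
      rw [if_pos (Or.inl rfl), Finset.sum_eq_single (p 1)]
      · rw [if_pos (hp.adj 0 (by omega)), hwE 0 (by omega), hF0]
      · intro x hx hx1
        rw [if_neg]
        intro hadj
        obtain ⟨i, h1, h2, rfl⟩ := (Finset.mem_filter.1 hx).2
        obtain ⟨i, rfl⟩ := Nat.exists_eq_add_of_le' h1
        rcases hz i (by omega) hadj with ⟨rfl, -⟩ | ⟨-, h⟩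
        · exact hx1 rfl
        · exact hp0L h
      · intro h
        exact absurd (hiD 0 (by omega)) (by simpa using h)
    · by_cases haL : a = p (n + 1)
      · subst haL
        rw [if_pos (Or.inr rfl), Finset.sum_eq_single (p n)]
        · rw [if_pos (hp.adj n le_rfl).symm, Sym2.eq_swap, hwE n le_rfl, hFn]
        · intro x hx hx1
          rw [if_neg]
          intro hadj
          obtain ⟨i, h1, h2, rfl⟩ := (Finset.mem_filter.1 hx).2
          obtain ⟨i, rfl⟩ := Nat.exists_eq_add_of_le' h1
          rcases hz i (by omega) hadj with ⟨-, h⟩ | ⟨h, -⟩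
          · exact hp0L h.symm
          · exact hx1 (by rw [h])
        · intro h
          have := hiD (n - 1) (by omega)
          rw [show n - 1 + 1 = n by omega] at this
          exact absurd this (by simpa using h)
      · rw [if_neg (by tauto)]
        refine Finset.sum_eq_zero fun x hx => ?_
        rw [if_neg]
        intro hadj
        obtain ⟨i, h1, h2, rfl⟩ := (Finset.mem_filter.1 hx).2
        obtain ⟨i, rfl⟩ := Nat.exists_eq_add_of_le' h1
        rcases hz i (by omega) hadj with ⟨-, h⟩ | ⟨-, h⟩
        · exact ha0 h
        · exact haL h
  have hdeg : ∀ a : {x // x ∈ Dᶜ}, wdeg G w a.1 = wdeg (G.induce Dᶜ) w₀ a := by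
    intro a
    rw [wdeg_eq_sum_ite, wdeg_eq_sum_ite, ← Finset.sum_filter_add_sum_filter_not _ (· ∈ D),
      hnbrD a.1 a.2, ← Finset.sum_subtype_eq_sum_filter, Finset.subtype_univ]
    have h1 : ∀ x : {x // x ∉ D}, (if G.Adj a.1 x.1 then w s(a.1, x.1) else 0) +
        (if x.1 = p (n + 1) ∧ a.1 = p 0 ∨ x.1 = p 0 ∧ a.1 = p (n + 1) then t else 0) =
        if (G.induce Dᶜ).Adj a x then w₀ s(a, x) else 0 := by
      intro x
      rw [hwoff a.1 x.1 a.2 x.2]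
      simp only [SimpleGraph.comap_adj, Function.Embedding.subtype_apply, w₁]
      by_cases h : s(a.1, x.1) = s(p 0, p (n + 1))
      · have hA : G.Adj a.1 x.1 := by
          rw [← SimpleGraph.mem_edgeSet, h]; exact hend
        have hsx : s(a, x) = s(S, U) := by
          apply Sym2.map.injective Subtype.val_injective
          exact h
        rw [if_pos hA, if_pos h, if_pos hA, hsx, ← hyt, if_pos]
        rcases Sym2.eq_iff.1 h with h | h
        · exact Or.inl ⟨h.2, h.1⟩
        · exact Or.inr ⟨h.2, h.1⟩
      · have hneg : ¬ (x.1 = p (n + 1) ∧ a.1 = p 0 ∨ x.1 = p 0 ∧ a.1 = p (n + 1)) := by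
          rintro (⟨h1, h2⟩ | ⟨h1, h2⟩)
          · exact h (by rw [h1, h2])
          · exact h (by rw [h1, h2, Sym2.eq_swap])
        rw [if_neg h, if_neg hneg, add_zero]
        simp only [Sym2.map_mk]
        rw [hr a, hr x]
    refine Eq.trans ?_ (Fintype.sum_equiv (Equiv.refl _) _ _ h1)
    rw [Finset.sum_add_distrib, add_comm]
    congr 1
    by_cases ha0 : a.1 = p 0
    · rw [if_pos (Or.inl ha0), Finset.sum_eq_single U]
      · rw [if_pos (Or.inl ⟨rfl, ha0⟩)]
      · intro x _ hx
        rw [if_neg]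
        rintro (⟨h1, h2⟩ | ⟨h1, h2⟩)
        · exact hx (Subtype.ext h1)
        · exact hp0L (ha0.symm.trans h2)
      · simp
    · by_cases haL : a.1 = p (n + 1)
      · rw [if_pos (Or.inr haL), Finset.sum_eq_single S]
        · rw [if_pos (Or.inr ⟨rfl, haL⟩)]
        · intro x _ hx
          rw [if_neg]
          rintro (⟨h1, h2⟩ | ⟨h1, h2⟩)
          · exact ha0 h2
          · exact hx (Subtype.ext h1)
        · simp
      · rw [if_neg (by tauto)]
        symm
        refine Finset.sum_eq_zero fun x _ => ?_
        rw [if_neg]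
        tauto
  refine good_of_cleanable hadm ?_
  have hpd : ∀ i, i < n → wdeg G w (p (i + 1)) = F i + F (i + 1) := by
    intro i hi
    rw [hp.wdeg_eq w hi, hwE i (by omega), hwE (i + 1) (by omega)]
  -- conflicts along the path
  have hpath : ∀ i, i ≤ n → wdeg G w (p i) = wdeg G w (p (i + 1)) →
      Cleanable G m (p i) (p (i + 1)) ∨ Cleanable G m (p (i + 1)) (p i) := by
    intro i hi he
    have clean_left : ∀ i, i ≤ n → Even i → i < n → m s(p (i + 1), p (i + 2)) ≠ 1 →
        1 ≤ m s(p (i + 1), p (i + 2)) → Cleanable G m (p (i + 1)) (p i) := by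
      intro i hi hev hin h1 h2
      refine ⟨p (i + 2), (hp.ne i hin).symm, hp.thin ?_ (hunit i hi hev) (hunit (i + 2) ?_ ?_),
        by omega⟩
      · rcases hev with ⟨j, hj⟩; omega
      · rcases hev with ⟨j, hj⟩; omega
      · rcases hev with ⟨j, hj⟩; exact ⟨j + 1, by omega⟩
    have clean_right : ∀ i, i + 2 ≤ n → Even i → m s(p (i + 1), p (i + 2)) ≠ 1 →
        1 ≤ m s(p (i + 1), p (i + 2)) → Cleanable G m (p (i + 2)) (p (i + 3)) := by
      intro i hi hev h1 h2
      refine ⟨p (i + 1), hp.ne (i + 1) (by omega), (hp.thin (by omega) (hunit i (by omega) hev)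
        (hunit (i + 2) hi ?_)).symm, ?_⟩
      · rcases hev with ⟨j, hj⟩; exact ⟨j + 1, by omega⟩
      · rw [Sym2.eq_swap]; omega
    have hm1 : ∀ i ≤ n, 1 ≤ m s(p i, p (i + 1)) := fun i _ => hm _
    rcases Nat.even_or_odd i with hev | hodd
    · rcases Nat.eq_zero_or_pos i with rfl | h0
      · -- first edge
        by_cases h1 : m s(p 1, p 2) = 1
        · exfalso
          rw [hpd 0 (by omega), hF0, hdeg S] at he
          have : F (0 + 1) = g := by simp [F, h1]
          omega
        · exact Or.inr (clean_left 0 (by omega) hev (by omega) h1 (hm1 1 (by omega)))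
      · rcases eq_or_lt_of_le hi with rfl | hin
        · by_cases h1 : m s(p (n - 1), p (n - 1 + 1)) = 1
          · exfalso
            have e1 := hpd (n - 1) (by omega)
            rw [show n - 1 + 1 = n by omega] at e1
            rw [e1, hFn, hdeg U] at he
            have h3 : ¬ Even (n - 1) := by rw [Nat.not_even_iff_odd]; exact ⟨2 * k + 1, by omega⟩
            have h4 : ¬ ((n - 1) % 4 = 1) := by omega
            have : F (n - 1) = 3 - g := by simp only [F, if_neg h3, if_pos h1, if_neg h4]
            omega
          · left
            have := clean_right (n - 2) (by omega) ⟨2 * k + 1, by omega⟩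
            rw [show n - 2 + 1 = n - 1 by omega, show n - 2 + 2 = n by omega,
              show n - 2 + 3 = n + 1 by omega] at this
            have h5 := hm1 (n - 1) (by omega)
            rw [show n - 1 + 1 = n by omega] at h1 h5
            exact this h1 h5
        · obtain ⟨i, rfl⟩ : ∃ i', i = i' + 2 := ⟨i - 2, by rcases hev with ⟨j, hj⟩; omega⟩
          have hev' : Even i := by rcases hev with ⟨j, hj⟩; exact ⟨j - 1, by omega⟩
          by_cases h1 : m s(p (i + 1), p (i + 2)) = 1
          · by_cases h2 : m s(p (i + 3), p (i + 4)) = 1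
            · exfalso
              rw [hpd (i + 1) (by omega), hpd (i + 2) (by omega)] at he
              have e1 : ¬ Even (i + 1) := by rw [Nat.not_even_iff_odd]; exact hev'.add_one
              have e3 : ¬ Even (i + 3) := by rw [Nat.not_even_iff_odd]; exact hev.add_one
              have f1 : F (i + 1) = if (i + 1) % 4 = 1 then g else 3 - g := by
                simp only [F, if_neg e1, if_pos h1]
              have f3 : F (i + 3) = if (i + 3) % 4 = 1 then g else 3 - g := by
                simp only [F, if_neg e3, if_pos h2]
              rcases hev' with ⟨j, hj⟩
              rw [show i + 1 + 1 = i + 2 by omega, show i + 2 + 1 = i + 3 by omega, f1, f3] at he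
              split_ifs at he <;> omega
            · exact Or.inr (clean_left (i + 2) hi hev (by omega) h2 (hm1 (i + 3) (by omega)))
          · exact Or.inl (clean_right i hi hev' h1 (hm1 (i + 1) (by omega)))
    · exfalso
      have hin : i + 1 ≤ n := by rcases hodd with ⟨j, hj⟩; omega
      obtain ⟨i, rfl⟩ : ∃ i', i = i' + 1 := ⟨i - 1, by rcases hodd with ⟨j, hj⟩; omega⟩
      rw [hpd i (by omega), hpd (i + 1) (by omega)] at he
      have e0 : Even i := by rcases hodd with ⟨j, hj⟩; exact ⟨j, by omega⟩
      have e2 : Even (i + 2) := by rcases hodd with ⟨j, hj⟩; exact ⟨j + 1, by omega⟩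
      have f0 : F i = if i % 4 = 0 then t else 3 - t := by simp only [F, if_pos e0]
      have f2 : F (i + 2) = if (i + 2) % 4 = 0 then t else 3 - t := by simp only [F, if_pos e2]
      rcases e0 with ⟨j, hj⟩
      rw [show i + 1 + 1 = i + 2 by omega, f0, f2] at he
      split_ifs at he <;> omega
  intro x z hxz he
  by_cases hx : x ∈ D
  · obtain ⟨i, h1, h2, rfl⟩ := hx
    obtain ⟨i, rfl⟩ := Nat.exists_eq_add_of_le' h1
    rcases hp.nbr i (by omega) z hxz with rfl | rfl
    · exact (hpath i (by omega) he.symm).symm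
    · exact hpath (i + 1) (by omega) he
  by_cases hz : z ∈ D
  · obtain ⟨i, h1, h2, rfl⟩ := hz
    obtain ⟨i, rfl⟩ := Nat.exists_eq_add_of_le' h1
    rcases hp.nbr i (by omega) x hxz.symm with rfl | rfl
    · exact hpath i (by omega) he
    · exact (hpath (i + 1) (by omega) he.symm).symm
  · exfalso
    have e1 := hdeg ⟨x, hx⟩
    have e2 := hdeg ⟨z, hz⟩
    simp only at e1 e2
    rw [e1, e2] at he
    exact hne₀ (u := ⟨x, hx⟩) (v := ⟨z, hz⟩) hxz he

end Ear

end OddCactus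

namespace OddCactus

section Ear

variable {V : Type} {G : SimpleGraph V} {m : Sym2 V → ℕ} {P : Set V} {p : ℕ → V}

/-- Removing the interior of an ear along an edge keeps the graph connected. -/
theorem PathIn.connected_induce {n : ℕ} (hp : PathIn G P n p) (hG : G.Connected)
    (hend : G.Adj (p 0) (p (n + 1))) : (G.induce (interior p n)ᶜ).Connected := by
  have h0D : p 0 ∉ interior p n := fun ⟨i, h1, h2, h3⟩ => hp.ne_of_notMem hp.zero h1 h2 h3
  have hLD : p (n + 1) ∉ interior p n := fun ⟨i, h1, h2, h3⟩ => hp.ne_of_notMem hp.last h1 h2 h3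
  let S : {x // x ∈ (interior p n)ᶜ} := ⟨p 0, h0D⟩
  let r : V → {x // x ∈ (interior p n)ᶜ} := fun x =>
    if h : x ∈ (interior p n)ᶜ then ⟨x, h⟩ else S
  have hr : ∀ x (h : x ∉ interior p n), r x = ⟨x, h⟩ := fun x h => dif_pos h
  have hr' : ∀ x, x ∈ interior p n → r x = S := fun x h => dif_neg (fun h' => h' h)
  have key1 : ∀ a b, G.Adj a b → a ∈ interior p n →
      (G.induce (interior p n)ᶜ).Reachable (r a) (r b) := by
    rintro a b hab ha
    by_cases hb : b ∈ interior p n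
    · rw [hr' a ha, hr' b hb]
    · rw [hr' a ha, hr b hb]
      obtain ⟨i, h1, h2, rfl⟩ := ha
      obtain ⟨i, rfl⟩ := Nat.exists_eq_add_of_le' h1
      rcases hp.nbr i (by omega) b hab with rfl | rfl
      · obtain rfl : i = 0 := by
          by_contra h0
          exact hb ⟨i, by omega, by omega, rfl⟩
        exact SimpleGraph.Reachable.rfl
      · have hin : i + 1 = n := by
          by_contra h0
          exact hb ⟨i + 2, by omega, by omega, rfl⟩
        refine SimpleGraph.Adj.reachable ?_
        change G.Adj (p 0) (p (i + 2))
        rw [← hin] at hend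
        exact hend
  have key : ∀ a b, G.Adj a b → (G.induce (interior p n)ᶜ).Reachable (r a) (r b) := by
    intro a b hab
    by_cases ha : a ∈ interior p n
    · exact key1 a b hab ha
    by_cases hb : b ∈ interior p n
    · exact (key1 b a hab.symm hb).symm
    · rw [hr a ha, hr b hb]
      exact SimpleGraph.Adj.reachable hab
  have hreach : ∀ a b, G.Reachable a b → (G.induce (interior p n)ᶜ).Reachable (r a) (r b) := by
    rintro a b ⟨W⟩
    induction W with
    | nil => exact SimpleGraph.Reachable.rfl
    | cons hab W ih => exact (key _ _ hab).trans ih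
  have : Nonempty {x // x ∈ (interior p n)ᶜ} := ⟨S⟩
  refine ⟨fun a b => ?_⟩
  have := hreach a.1 b.1 (hG a.1 b.1)
  rwa [hr a.1 a.2, hr b.1 b.2] at this

/-- Attaching an ear with unit red edges along a (multiple) edge preserves multi-cacti. -/
theorem isMultiCactus_of_induce {k : ℕ} (hm : ∀ e, 1 ≤ m e) (hp : PathIn G P (4 * k + 4) p)
    (hend : G.Adj (p 0) (p (4 * k + 5)))
    (hunit : ∀ i ≤ 4 * k + 4, Even i → m s(p i, p (i + 1)) = 1)
    (hg : IsMultiCactus (G.induce (interior p (4 * k + 4))ᶜ)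
      (addParallel m (interior p (4 * k + 4))ᶜ (p 0) (p (4 * k + 5)))) : IsMultiCactus G m := by
  set n := 4 * k + 4 with hn
  set D := interior p n with hD
  obtain ⟨W, H, green, hO, φ, hφ⟩ := hg
  have h0D : p 0 ∉ D := fun ⟨i, h1, h2, h3⟩ => hp.ne_of_notMem hp.zero h1 h2 h3
  have hLD : p (n + 1) ∉ D := fun ⟨i, h1, h2, h3⟩ => hp.ne_of_notMem hp.last h1 h2 h3
  have hiD : ∀ i, i < n → p (i + 1) ∈ D := fun i hi => ⟨i + 1, by omega, by omega, rfl⟩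
  let S : {x // x ∈ Dᶜ} := ⟨p 0, h0D⟩
  let U : {x // x ∈ Dᶜ} := ⟨p (n + 1), hLD⟩
  have hSU : (G.induce Dᶜ).Adj S U := hend
  have hgr : s(φ S, φ U) ∈ green := hφ S U hSU (by
    have : addParallel m Dᶜ (p 0) (p (4 * k + 5)) s(S, U) = m s(p 0, p (4 * k + 5)) + 1 :=
      addParallel_self h0D hLD
    have := hm s(p 0, p (4 * k + 5))
    omega)
  let ψ : W ⊕ Fin n → V := Sum.elim (fun w => (φ.symm w).1) (fun i => p (i.1 + 1))
  have hψl : ∀ w, ψ (Sum.inl w) = (φ.symm w).1 := fun w => rfl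
  have hψr : ∀ i, ψ (Sum.inr i) = p (i.1 + 1) := fun i => rfl
  have hψear : ∀ i, i ≤ n + 1 → ψ (earVert (φ S) (φ U) n i) = p i := by
    intro i hi
    unfold earVert
    split_ifs with h1 h2
    · rw [hψl, RelIso.symm_apply_apply, h1]
    · rw [hψr]
      simp only
      rw [show i - 1 + 1 = i by omega]
    · rw [hψl, RelIso.symm_apply_apply, show i = n + 1 by omega]
  have hinj : Function.Injective ψ := by
    rintro (a | a) (b | b) hab
    · rw [hψl, hψl] at hab
      rw [φ.symm.injective (Subtype.ext hab)]
    · rw [hψl, hψr] at hab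
      exact absurd (hab ▸ hiD b.1 b.2) (φ.symm a).2
    · rw [hψl, hψr] at hab
      exact absurd (hab ▸ hiD a.1 a.2) (φ.symm b).2
    · rw [hψr, hψr] at hab
      have := hp.inj _ _ (by omega) (by omega) (by omega) (by omega) hab
      rw [Fin.ext (show a.1 = b.1 by omega)]
  have hsurj : Function.Surjective ψ := by
    intro x
    by_cases hx : x ∈ D
    · obtain ⟨i, h1, h2, rfl⟩ := hx
      obtain ⟨i, rfl⟩ := Nat.exists_eq_add_of_le' h1
      exact ⟨Sum.inr ⟨i, by omega⟩, rfl⟩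
    · exact ⟨Sum.inl (φ ⟨x, hx⟩), by rw [hψl, RelIso.symm_apply_apply]⟩
  have hrel1 : ∀ (j : Fin n) y, G.Adj (ψ (Sum.inr j)) (ψ y) ↔
      (addPathGraph H (φ S) (φ U) n).Adj (Sum.inr j) y := by
    intro j y
    rw [earVert_inr (φ S) (φ U) j, addPathGraph_adj_earVert (by omega) (by omega),
      hψear _ (by omega), hp.nbr_iff j.2, Nat.add_sub_cancel, ← hψear j.1 (by omega),
      ← hψear (j.1 + 2) (by omega), hinj.eq_iff, hinj.eq_iff]
  have hrel : ∀ x y, G.Adj (ψ x) (ψ y) ↔ (addPathGraph H (φ S) (φ U) n).Adj x y := by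
    rintro (x | x) (y | y)
    · rw [addPathGraph_adj_inl (by omega), ← φ.symm.map_adj_iff]
      rfl
    · rw [SimpleGraph.adj_comm, hrel1, SimpleGraph.adj_comm]
    · exact hrel1 x _
    · exact hrel1 x _
  let Ψ : addPathGraph H (φ S) (φ U) n ≃g G :=
    { toEquiv := Equiv.ofBijective ψ ⟨hinj, hsurj⟩
      map_rel_iff' := fun {x y} => hrel x y }
  refine ⟨_, _, _, hO.addPath (φ S) (φ U) (φ.map_adj_iff.2 hSU) hgr k, Ψ.symm, ?_⟩
  have main1 : ∀ (j : Fin n) y, G.Adj (ψ (Sum.inr j)) (ψ y) → 2 ≤ m s(ψ (Sum.inr j), ψ y) →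
      s(Sum.inr j, y) ∈ Sym2.map Sum.inl '' green ∪ greenPathEdges (φ S) (φ U) n := by
    intro j y hadj h2
    rw [hrel1, earVert_inr (φ S) (φ U) j, addPathGraph_adj_earVert (by omega) (by omega),
      Nat.add_sub_cancel] at hadj
    rw [hψr] at h2
    right
    rw [mem_greenPathEdges]
    rcases hadj with rfl | rfl
    · rw [hψear _ (by omega)] at h2
      refine ⟨j.1, by omega, ?_, ?_⟩
      · by_contra h
        rw [Nat.not_odd_iff_even] at h
        have := hunit j.1 (by omega) h
        rw [Sym2.eq_swap] at this
        omega
      · rw [Sym2.eq_swap, earVert_inr (φ S) (φ U) j]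
    · rw [hψear _ (by omega)] at h2
      refine ⟨j.1 + 1, by omega, ?_, ?_⟩
      · by_contra h
        rw [Nat.not_odd_iff_even] at h
        have := hunit (j.1 + 1) (by omega) h
        rw [show j.1 + 1 + 1 = j.1 + 2 by omega] at *
        omega
      · rw [earVert_inr (φ S) (φ U) j]
  have main : ∀ x y, G.Adj (ψ x) (ψ y) → 2 ≤ m s(ψ x, ψ y) →
      s(x, y) ∈ Sym2.map Sum.inl '' green ∪ greenPathEdges (φ S) (φ U) n := by
    rintro (x | x) (y | y) hadj h2
    · left
      refine ⟨s(x, y), ?_, rfl⟩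
      have := hφ (φ.symm x) (φ.symm y) hadj (h2.trans
        (le_addParallel (D := Dᶜ) (s := p 0) (u := p (4 * k + 5)) s(φ.symm x, φ.symm y)))
      rwa [RelIso.apply_symm_apply, RelIso.apply_symm_apply] at this
    · rw [Sym2.eq_swap]
      exact main1 y _ hadj.symm (by rwa [Sym2.eq_swap])
    · exact main1 x _ hadj h2
    · exact main1 x _ hadj h2
  intro a b hab h2
  have ha : ψ (Ψ.symm a) = a := Ψ.apply_symm_apply a
  have hb : ψ (Ψ.symm b) = b := Ψ.apply_symm_apply b
  refine main _ _ ?_ ?_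
  · rwa [ha, hb]
  · rwa [ha, hb]

/-- The induction hypothesis of the main theorem. -/
def SmallerBadAreCacti (V : Type) [Fintype V] : Prop :=
  ∀ (V' : Type) [Fintype V'] (G' : SimpleGraph V') (m' : Sym2 V' → ℕ),
    Fintype.card V' < Fintype.card V → G'.Connected → (∃ c, IsTwoColoring G' c) →
    (∀ e, 1 ≤ m' e) → ¬ Good G' m' → IsMultiCactus G' m'

theorem isMultiCactus_of_ear [Fintype V] {k : ℕ} (IH : SmallerBadAreCacti V) (hG : G.Connected)
    {c : V → ZMod 2} (hc : IsTwoColoring G c) (hm : ∀ e, 1 ≤ m e) (hbad : ¬ Good G m)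
    (hp : PathIn G P (4 * k + 4) p) (hend : G.Adj (p 0) (p (4 * k + 5)))
    (hunit : ∀ i ≤ 4 * k + 4, Even i → m s(p i, p (i + 1)) = 1) : IsMultiCactus G m := by
  refine isMultiCactus_of_induce hm hp hend hunit (IH _ _ _ ?_ (hp.connected_induce hG hend)
    ⟨fun x => c x.1, fun x y hxy => hc _ _ hxy⟩ (fun e => (hm _).trans (le_addParallel e))
    fun hg => hbad (good_of_good_induce hm hp hend hunit hg))
  refine Fintype.card_subtype_lt (x := p 1) ?_
  exact fun h => h ⟨1, le_rfl, by omega, rfl⟩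

end Ear

end OddCactus

namespace OddCactus

section Parity

variable {V : Type} {G : SimpleGraph V} {m : Sym2 V → ℕ} {c : V → ZMod 2}

/-- The indicator function of a set, with values modulo two. -/
noncomputable def ind (W : Set V) (v : V) : ZMod 2 := if v ∈ W then 1 else 0

theorem ind_of_mem {W : Set V} {v : V} (h : v ∈ W) : ind W v = 1 := if_pos h

theorem ind_of_notMem {W : Set V} {v : V} (h : v ∉ W) : ind W v = 0 := if_neg h

variable [Fintype V]

/-- If degrees have the parity of a proper two-colouring except at `W`, then only edges leaving
`W` may be in conflict. -/
theorem good_of_parity (hc : IsTwoColoring G c) {w : Sym2 V → ℕ} (hw : Admissible G m w)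
    (κ : ZMod 2) (W : Set V) (hψ : ∀ v, (wdeg G w v : ZMod 2) = c v + κ + ind W v)
    (h : ∀ x y, G.Adj x y → x ∈ W → y ∉ W → wdeg G w x = wdeg G w y →
      Cleanable G m x y ∨ Cleanable G m y x) : Good G m := by
  refine good_of_cleanable hw fun x y hxy he => ?_
  have h1 : (wdeg G w x : ZMod 2) = wdeg G w y := by rw [he]
  rw [hψ, hψ, hc x y hxy] at h1
  by_cases hx : x ∈ W <;> by_cases hy : y ∈ W
  · rw [ind_of_mem hx, ind_of_mem hy] at h1
    exfalso; clear hψ; generalize c x = a at h1; revert a κ; decide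
  · exact h x y hxy hx hy he
  · exact (h y x hxy.symm hy hx he.symm).symm
  · rw [ind_of_notMem hx, ind_of_notMem hy] at h1
    exfalso; clear hψ; generalize c x = a at h1; revert a κ; decide

theorem good_of_sum_eq_zero (hG : G.Connected) (hc : IsTwoColoring G c) (hm : ∀ e, 1 ≤ m e)
    (κ : ZMod 2) (W : Set V) (hψ : ∑ v, (c v + κ + ind W v) = 0)
    (h : ∀ w, Admissible G m w → ∀ x y, G.Adj x y → x ∈ W → y ∉ W →
      wdeg G w x = wdeg G w y → Cleanable G m x y ∨ Cleanable G m y x) : Good G m := by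
  obtain ⟨x₀⟩ := hG.nonempty
  obtain ⟨w, hw, -, -, hp⟩ := exists_admissible_of_parity hm le_rfl
    (fun e _ => ⟨le_rfl, by omega⟩ : Admissible G m m) (fun v => c v + κ + ind W v) x₀ hψ
    (fun v hv => absurd (hG x₀ v) hv)
  exact good_of_parity hc hw κ W hp (h w hw)

/-- In a graph without the property, both colour classes have odd size. -/
theorem sum_color_eq_one (hG : G.Connected) (hc : IsTwoColoring G c) (hm : ∀ e, 1 ≤ m e)
    (hbad : ¬ Good G m) (κ : ZMod 2) : ∑ v, (c v + κ) = 1 := by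
  by_contra h
  have h0 : ∑ v, (c v + κ) = 0 := by
    generalize ∑ v, (c v + κ) = a at h; revert a; decide
  refine hbad (good_of_sum_eq_zero hG hc hm κ ∅ ?_ fun w _ x y _ hx => absurd hx (by simp))
  simpa [ind] using h0

theorem sum_ind (W : Set V) : ∑ v, ind W v = (W.ncard : ZMod 2) := by
  simp only [ind]
  rw [Finset.sum_boole, Set.ncard_eq_toFinset_card']
  congr 2
  ext; simp

theorem good_of_odd (hG : G.Connected) (hc : IsTwoColoring G c) (hm : ∀ e, 1 ≤ m e)
    (W : Set V) (hW : Odd W.ncard)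
    (h : ∀ w, Admissible G m w → ∀ x y, G.Adj x y → x ∈ W → y ∉ W →
      wdeg G w x = wdeg G w y → Cleanable G m x y ∨ Cleanable G m y x) : Good G m := by
  by_contra hbad
  refine hbad (good_of_sum_eq_zero hG hc hm 0 W ?_ h)
  rw [Finset.sum_add_distrib, sum_color_eq_one hG hc hm hbad, sum_ind,
    ZMod.natCast_eq_one_iff_odd.2 hW]
  decide

/-- A leaf forces the property, except in a graph with two vertices. -/
theorem eq_or_eq_of_leaf (hG : G.Connected) (hc : IsTwoColoring G c) (hm : ∀ e, 1 ≤ m e)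
    (hbad : ¬ Good G m) {v u : V} (hv : ∀ y, G.Adj v y ↔ y = u) (x : V) : x = v ∨ x = u := by
  by_contra! hx
  have hvu : G.Adj v u := (hv u).2 rfl
  -- `u` has another neighbour
  obtain ⟨t, hut, htv⟩ : ∃ t, G.Adj u t ∧ t ≠ v := by
    by_contra! hcon
    have key : ∀ a b, G.Reachable a b → (a = v ∨ a = u) → (b = v ∨ b = u) := by
      rintro a b ⟨p⟩
      induction p with
      | nil => exact id
      | cons hab p ih =>
        rintro (rfl | rfl)
        · exact ih (Or.inr ((hv _).1 hab))
        · exact ih (Or.inl (hcon _ hab))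
    rcases key v x (hG v x) (Or.inl rfl) with h | h
    · exact hx.1 h
    · exact hx.2 h
  refine hbad (good_of_odd hG hc hm {v} (by simp) ?_)
  rintro w hw a y hay rfl - he
  exfalso
  rw [hv] at hay
  subst hay
  rw [wdeg_singleton hv] at he
  have h1 := add_le_wdeg (w := w) hvu.symm hut htv.symm
  have h2 := (hw s(y, t) hut).1
  have h3 := hm s(y, t)
  rw [Sym2.eq_swap] at he
  omega

end Parity

end OddCactus

namespace OddCactus

section Cycle

variable {V : Type} {G : SimpleGraph V} {m : Sym2 V → ℕ} {c : V → ZMod 2}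

theorem HalfThin.exists_pair {x q : V} (h : HalfThin G m x q) :
    ∃ a b, a ≠ b ∧ ∀ y, G.Adj x y ↔ y = a ∨ y = b := by
  obtain ⟨hxq, a, haq, hxa, -, hnbr⟩ := h
  refine ⟨q, a, haq.symm, fun y => ⟨hnbr y, ?_⟩⟩
  rintro (rfl | rfl)
  · exact hxq
  · exact hxa

theorem HalfThin.unit {x q y : V} (h : HalfThin G m x q) (hxy : G.Adj x y) (hy : y ≠ q) :
    m s(x, y) = 1 := by
  obtain ⟨hxq, a, haq, hxa, h1, hnbr⟩ := h
  rcases hnbr y hxy with rfl | rfl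
  · exact absurd rfl hy
  · exact h1

theorem Thin.of_two_le {x q y : V} (h : Thin G m x q) (hxy : G.Adj x y) (h2 : 2 ≤ m s(x, y)) :
    Thin G m x y := by
  by_cases hy : y = q
  · rwa [hy]
  · have := h.1.unit hxy hy
    omega

theorem PathIn.ncard_image {P : Set V} {n : ℕ} {p : ℕ → V} (h : PathIn G P n p) {a b : ℕ}
    (ha : 1 ≤ a) (hb : b ≤ n) : {x | ∃ i, a ≤ i ∧ i ≤ b ∧ p i = x}.ncard = b + 1 - a := by
  have : {x | ∃ i, a ≤ i ∧ i ≤ b ∧ p i = x} = p '' (Finset.Icc a b : Set ℕ) := by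
    ext x
    simp [and_assoc]
  rw [this, Set.InjOn.ncard_image, Set.ncard_coe_finset, Nat.card_Icc]
  intro i hi j hj hij
  simp only [Finset.coe_Icc, Set.mem_Icc] at hi hj
  exact h.inj i j (by omega) (by omega) (by omega) (by omega) hij

variable [Fintype V]

/-- The case of the main theorem where all vertices are thin, so that the graph is a cycle. -/
theorem isMultiCactus_of_forall_thin (IH : SmallerBadAreCacti V) (hG : G.Connected)
    (hc : IsTwoColoring G c) (hm : ∀ e, 1 ≤ m e) (hbad : ¬ Good G m)
    (hthin : ∀ v, ∃ q, Thin G m v q) : IsMultiCactus G m := by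
  obtain ⟨v, q, hvq, hmvq⟩ : ∃ v q, Thin G m v q ∧
      (2 ≤ m s(v, q) ∨ ∀ a b, G.Adj a b → m s(a, b) = 1) := by
    by_cases h : ∃ a b, G.Adj a b ∧ 2 ≤ m s(a, b)
    · obtain ⟨a, b, hab, h2⟩ := h
      obtain ⟨q, hq⟩ := hthin a
      exact ⟨a, b, hq.of_two_le hab h2, Or.inl h2⟩
    · push Not at h
      obtain ⟨v⟩ := hG.nonempty
      obtain ⟨q, hq⟩ := hthin v
      refine ⟨v, q, hq, Or.inr fun a b hab => ?_⟩
      have := h a b hab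
      have := hm s(a, b)
      omega
  have hvq' := hvq
  obtain ⟨⟨-, x, hxq, hvx, hmx, hv⟩, -⟩ := hvq'
  set P : Set V := {v, q}ᶜ with hP
  have hmemP : ∀ y, y ∉ P ↔ y = v ∨ y = q := fun y => by simp [hP]; tauto
  obtain ⟨n, p, hp, hp0⟩ : ∃ n p, PathIn G P n p ∧ p 0 = v := by
    obtain ⟨n, p, hp, j, hj1, hjn, hjx⟩ := exists_pathIn (P := P) hG
      (fun y _ => by obtain ⟨r, hr⟩ := hthin y; exact hr.1.exists_pair)
      (z := v) (by simp [hP]) (v := x) (by simp [hP, hxq, hvx.ne'])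
    obtain ⟨j, rfl⟩ := Nat.exists_eq_add_of_le' hj1
    have hvP : v ∉ P := by simp [hP]
    rcases hp.nbr j (by omega) v (hjx ▸ hvx.symm) with h | h
    · refine ⟨n, p, hp, ?_⟩
      rcases Nat.eq_zero_or_pos j with rfl | hj
      · exact h.symm
      · exact absurd (h ▸ hp.mem j hj (by omega)) hvP
    · refine ⟨n, _, hp.reverse, ?_⟩
      rcases Nat.lt_or_ge (j + 1) n with h' | h'
      · exact absurd (h ▸ hp.mem (j + 2) (by omega) (by omega)) hvP
      · simp only [Nat.sub_zero]
        rw [h]; congr 1; omega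
  have hp1 := hp.one_le
  have hpL : p (n + 1) = q := by
    rcases (hmemP _).1 hp.last with h | h
    · exfalso
      have hadj := hp.adj n le_rfl
      rw [h] at hadj
      have hne : p n ≠ q := fun h' => hp.ne_of_notMem ((hmemP q).2 (Or.inr rfl)) hp1 le_rfl h'
      have h1 := (hv _ hadj.symm).resolve_left hne
      have hadj1 := hp.adj 0 (by omega)
      rw [hp0] at hadj1
      have h2 := (hv _ hadj1).resolve_left
        (hp.ne_of_notMem ((hmemP q).2 (Or.inr rfl)) le_rfl hp1)
      have := hp.inj n (0 + 1) hp1 le_rfl le_rfl hp1 (h1.trans h2.symm)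
      subst this
      exact hp.ne 0 (by omega) (by rw [hp0]; exact h.symm)
    · exact h
  have hend : G.Adj (p 0) (p (n + 1)) := by rw [hp0, hpL]; exact hvq.adj
  have hp1x : p 1 = x := by
    have hadj1 := hp.adj 0 (by omega)
    rw [hp0] at hadj1
    exact (hv _ hadj1).resolve_left (hp.ne_of_notMem ((hmemP q).2 (Or.inr rfl)) le_rfl hp1)
  have hE0 : m s(p 0, p 1) = 1 := by rw [hp0, hp1x]; exact hmx
  have hEn : m s(p n, p (n + 1)) = 1 := by
    rw [hpL, Sym2.eq_swap]
    have hadj := hp.adj n le_rfl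
    rw [hpL] at hadj
    exact hvq.2.unit hadj.symm (hp.ne_of_notMem ((hmemP v).2 (Or.inl rfl)) hp1 le_rfl)
  have hcov : ∀ y, ∃ i, i < n + 2 ∧ p i = y := by
    have key : ∀ a b, G.Reachable a b → (∃ i, i < n + 2 ∧ p i = a) →
        ∃ i, i < n + 2 ∧ p i = b := by
      rintro a b ⟨W⟩
      induction W with
      | nil => exact id
      | cons hab W ih =>
        rintro ⟨i, hi, rfl⟩
        refine ih ?_
        rcases i with - | i
        · rw [hp0] at hab
          rcases hv _ hab with h | h
          · exact ⟨n + 1, by omega, hpL.trans h.symm⟩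
          · exact ⟨1, by omega, hp1x.trans h.symm⟩
        · rcases Nat.lt_or_ge i n with h' | h'
          · rcases hp.nbr i h' _ hab with h | h
            · exact ⟨i, by omega, h.symm⟩
            · exact ⟨i + 2, by omega, h.symm⟩
          · obtain rfl : i = n := by omega
            obtain ⟨-, -, a, -, hqa, -, hnb⟩ := hvq
            have hadj := hp.adj i le_rfl
            rw [hpL] at hadj hab
            have h1 := (hnb _ hadj.symm).resolve_left
              (hp.ne_of_notMem ((hmemP v).2 (Or.inl rfl)) hp1 le_rfl)
            rcases hnb _ hab with h | h
            · exact ⟨0, by omega, hp0.trans h.symm⟩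
            · exact ⟨i, by omega, h1.trans h.symm⟩
    intro y
    exact key v y (hG v y) ⟨0, by omega, hp0⟩
  have hinj : ∀ i j, i < n + 2 → j < n + 2 → p i = p j → i = j := by
    have key : ∀ i j, i < j → j < n + 2 → p i ≠ p j := by
      intro i j hij hj he
      rcases Nat.eq_zero_or_pos i with rfl | hi
      · rcases Nat.lt_or_ge j (n + 1) with h | h
        · exact hp.ne_of_notMem hp.zero (by omega) (by omega) he.symm
        · obtain rfl : j = n + 1 := by omega
          exact hend.ne he
      · rcases Nat.lt_or_ge j (n + 1) with h | h
        · have := hp.inj i j hi (by omega) (by omega) (by omega) he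
          omega
        · obtain rfl : j = n + 1 := by omega
          exact hp.ne_of_notMem hp.last hi (by omega) he
    intro i j hi hj he
    rcases Nat.lt_trichotomy i j with h | h | h
    · exact absurd he (key i j h hj)
    · exact h
    · exact absurd he.symm (key j i h hi)
  have hsum : ∑ y, c y = ∑ i ∈ Finset.range (n + 2), (c v + i) := by
    symm
    refine Finset.sum_bij (fun i _ => p i) (fun _ _ => Finset.mem_univ _) ?_ ?_ ?_
    · intro i hi j hj he
      rw [Finset.mem_range] at hi hj
      exact hinj i j hi hj he
    · intro y _
      obtain ⟨i, hi, h⟩ := hcov y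
      exact ⟨i, Finset.mem_range.2 hi, h⟩
    · intro i hi
      rw [Finset.mem_range] at hi
      rw [hp.color_eq hc (by omega), hp0]
  have hn4 : n % 4 = 0 := by
    have h0 := sum_color_eq_one hG hc hm hbad 0
    simp only [add_zero] at h0
    have hpar : ((n + 1 : ℕ) : ZMod 2) = 1 := by
      have h1 := hp.color_eq hc (i := n + 1) le_rfl
      rw [hc _ _ hend] at h1
      exact (add_left_cancel h1).symm
    rw [ZMod.natCast_eq_one_iff_odd] at hpar
    by_contra hn
    obtain ⟨k, rfl⟩ : ∃ k, n = 4 * k + 2 := ⟨n / 4, by rcases hpar with ⟨j, hj⟩; omega⟩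
    have hz : ∀ k, ∑ i ∈ Finset.range (4 * k), (c v + i) = 0 := by
      intro k
      induction k with
      | zero => simp
      | succ k ih =>
        rw [show 4 * (k + 1) = 4 * k + 1 + 1 + 1 + 1 by ring, Finset.sum_range_succ,
          Finset.sum_range_succ, Finset.sum_range_succ, Finset.sum_range_succ, ih]
        push_cast
        generalize c v = a
        generalize (k : ZMod 2) = b
        revert a b; decide
    rw [h0, show 4 * k + 2 + 2 = 4 * (k + 1) by ring, hz] at hsum
    exact one_ne_zero hsum
  obtain ⟨k, rfl⟩ : ∃ k, n = 4 * k + 4 := ⟨n / 4 - 1, by omega⟩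
  by_cases hunit : ∀ i ≤ 4 * k + 4, Even i → m s(p i, p (i + 1)) = 1
  · exact isMultiCactus_of_ear IH hG hc hm hbad hp hend hunit
  exfalso
  push Not at hunit
  obtain ⟨i, hi, hev, h1⟩ := hunit
  have hi0 : i ≠ 0 := by rintro rfl; exact h1 hE0
  have hin : i ≠ 4 * k + 4 := by rintro rfl; exact h1 hEn
  have h2 : 2 ≤ m s(p i, p (i + 1)) := by have := hm s(p i, p (i + 1)); omega
  have h2' : 2 ≤ m s(v, q) := hmvq.resolve_right fun h => h1 (h _ _ (hp.adj i hi))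
  have hi2 : 2 ≤ i := by rcases hev with ⟨j, hj⟩; omega
  obtain ⟨i, rfl⟩ := Nat.exists_eq_add_of_le' hi2
  refine hbad (good_of_odd hG hc hm {x | ∃ j, 1 ≤ j ∧ j ≤ i + 1 ∧ p j = x} ?_ ?_)
  · rw [hp.ncard_image le_rfl (by omega)]
    rcases hev with ⟨j, hj⟩
    exact ⟨j - 1, by omega⟩
  rintro w - a y hay ⟨j, hj1, hji, rfl⟩ hy -
  right
  obtain ⟨j, rfl⟩ := Nat.exists_eq_add_of_le' hj1
  rcases hp.nbr j (by omega) y hay with rfl | rfl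
  · obtain rfl : j = 0 := by
      by_contra h
      exact hy ⟨j, by omega, by omega, rfl⟩
    refine ⟨q, ?_, by rwa [hp0], by rwa [hp0]⟩
    exact (hp.ne_of_notMem ((hmemP q).2 (Or.inr rfl)) le_rfl hp1).symm
  · obtain rfl : j = i := by
      by_contra h
      exact hy ⟨j + 2, by omega, by omega, rfl⟩
    obtain ⟨r, hr⟩ := hthin (p (j + 2))
    exact ⟨p (j + 2 + 1), (hp.ne (j + 1) (by omega)).symm,
      hr.of_two_le (hp.adj _ (by omega)) h2, h2⟩

end Cycle

end OddCactus

namespace OddCactus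

/-- A partition of the vertices into a connected part `K`, its neighbourhood `N`, a set `Q` of
vertices adjacent to all of `N`, and a set `P` of thin vertices. -/
structure Frame {V : Type} (G : SimpleGraph V) (m : Sym2 V → ℕ) (K N Q P : Set V) : Prop where
  cover : ∀ x, x ∈ K ∨ x ∈ N ∨ x ∈ Q ∨ x ∈ P
  KN : ∀ x ∈ K, x ∉ N
  KQ : ∀ x ∈ K, x ∉ Q
  KP : ∀ x ∈ K, x ∉ P
  NQ : ∀ x ∈ N, x ∉ Q
  NP : ∀ x ∈ N, x ∉ P
  QP : ∀ x ∈ Q, x ∉ P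
  K_nonempty : K.Nonempty
  N_nonempty : N.Nonempty
  Q_nonempty : Q.Nonempty
  K_reachable : ∀ a ∈ K, ∀ b ∈ K, (onSet G K).Reachable a b
  K_adj : ∀ a ∈ K, ∀ b, G.Adj a b → b ∈ K ∨ b ∈ N
  N_adj_K : ∀ u ∈ N, ∃ k ∈ K, G.Adj u k
  Q_adj_N : ∀ s ∈ Q, ∀ u ∈ N, G.Adj s u
  Q_not_thin : ∀ s ∈ Q, ∀ q, ¬ Thin G m s q
  P_thin : ∀ x ∈ P, ∃ q ∈ P, Thin G m x q

section Extraction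

variable {V : Type} {G : SimpleGraph V} {m : Sym2 V → ℕ} {c : V → ZMod 2}

theorem reachable_onSet_insert {K : Set V} {k u : V} (hk : k ∈ K) (hku : G.Adj k u)
    (hK : ∀ a ∈ K, ∀ b ∈ K, (onSet G K).Reachable a b) :
    ∀ a ∈ insert u K, ∀ b ∈ insert u K, (onSet G (insert u K)).Reachable a b := by
  have hle : onSet G K ≤ onSet G (insert u K) := fun a b h =>
    ⟨h.1, Set.mem_insert_of_mem _ h.2.1, Set.mem_insert_of_mem _ h.2.2⟩
  have key : ∀ a ∈ insert u K, (onSet G (insert u K)).Reachable k a := by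
    rintro a (rfl | ha)
    · exact SimpleGraph.Adj.reachable ⟨hku, Set.mem_insert_of_mem _ hk, Set.mem_insert _ _⟩
    · exact (hK k hk a ha).mono hle
  intro a ha b hb
  exact (key a ha).symm.trans (key b hb)

theorem exists_frame [Finite V] (hG : G.Connected) (hc : IsTwoColoring G c)
    (hdeg : ∀ x y, G.Adj x y → ∃ z, z ≠ y ∧ G.Adj x z) {v₀ : V} (hex : ∃ u, G.Adj v₀ u)
    (hv₀ : ∀ q, ¬ Thin G m v₀ q) : ∃ K N Q P, Frame G m K N Q P := by
  let T : Set (Set V) := {K | K.Nonempty ∧ (∀ a ∈ K, ∀ b ∈ K, (onSet G K).Reachable a b) ∧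
    ∃ v, (∀ q, ¬ Thin G m v q) ∧ v ∉ K ∧ ∀ k ∈ K, ¬ G.Adj v k}
  have hT : T.Nonempty := by
    obtain ⟨u, hu⟩ := hex
    obtain ⟨z, hz, huz⟩ := hdeg u v₀ hu.symm
    refine ⟨{z}, Set.singleton_nonempty z, ?_, v₀, hv₀, by simpa using hz.symm, ?_⟩
    · rintro a rfl b rfl
      exact SimpleGraph.Reachable.rfl
    · rintro k rfl h
      have h1 := hc _ _ hu
      have h2 := hc _ _ huz
      have h3 := hc _ _ h
      rw [h3, h1] at h2
      generalize c v₀ = a at h2; revert a; decide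
  obtain ⟨K, ⟨hKne, hKc, v, hvS, hvK, hvnK⟩, hmax⟩ : ∃ K ∈ T, ∀ L ∈ T, K ⊆ L → L ⊆ K := by
    obtain ⟨K, hK⟩ := (Set.toFinite T).exists_maximal hT
    exact ⟨K, hK.1, fun L hL h => hK.2 hL h⟩
  have hmem : ∀ v : V, (∀ q, ¬ Thin G m v q) → v ∉ K → (∀ k ∈ K, ¬ G.Adj v k) →
      ∀ u, u ∉ K → (∃ k ∈ K, G.Adj k u) → G.Adj v u := by
    intro v hv hvK hvk u hu ⟨k, hk, hku⟩
    by_contra hvu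
    refine hu (hmax (insert u K) ⟨Set.insert_nonempty _ _,
      reachable_onSet_insert hk hku hKc, v, hv, ?_, ?_⟩ (Set.subset_insert _ _)
      (Set.mem_insert _ _))
    · rintro (rfl | h)
      · exact hvk k hk hku.symm
      · exact hvK h
    · rintro k' (rfl | h)
      · exact hvu
      · exact hvk k' h
  let N : Set V := {u | u ∉ K ∧ ∃ k ∈ K, G.Adj k u}
  let Q : Set V := {s | s ∉ K ∧ s ∉ N ∧ ∀ q, ¬ Thin G m s q}
  let P : Set V := {x | x ∉ K ∧ x ∉ N ∧ x ∉ Q}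
  have hnK : ∀ x, x ∉ K → x ∉ N → ∀ k ∈ K, ¬ G.Adj x k := fun x h1 h2 k hk h =>
    h2 ⟨h1, k, hk, h.symm⟩
  have hvQ : v ∈ Q := ⟨hvK, fun ⟨_, k, hk, h⟩ => hvnK k hk h.symm, hvS⟩
  refine ⟨K, N, Q, P, ?_⟩
  constructor
  · intro x
    by_cases h1 : x ∈ K
    · exact Or.inl h1
    by_cases h2 : x ∈ N
    · exact Or.inr (Or.inl h2)
    by_cases h3 : x ∈ Q
    · exact Or.inr (Or.inr (Or.inl h3))
    · exact Or.inr (Or.inr (Or.inr ⟨h1, h2, h3⟩))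
  · exact fun x hx h => h.1 hx
  · exact fun x hx h => h.1 hx
  · exact fun x hx h => h.1 hx
  · exact fun x hx h => h.2.1 hx
  · exact fun x hx h => h.2.1 hx
  · exact fun x hx h => h.2.2 hx
  · exact hKne
  · obtain ⟨k, hk⟩ := hKne
    obtain ⟨W⟩ := hG k v
    clear hKc hmax hmem hvnK hnK hvQ
    induction W with
    | nil => exact absurd hk hvK
    | @cons a b _ hab W ih =>
      by_cases hb : b ∈ K
      · exact ih hvS hvK hb
      · exact ⟨b, hb, a, hk, hab⟩
  · exact ⟨v, hvQ⟩
  · exact hKc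
  · intro a ha b hab
    by_cases hb : b ∈ K
    · exact Or.inl hb
    · exact Or.inr ⟨hb, a, ha, hab⟩
  · rintro u ⟨_, k, hk, h⟩
    exact ⟨k, hk, h.symm⟩
  · rintro s ⟨h1, h2, h3⟩ u ⟨h4, h5⟩
    exact hmem s h3 h1 (hnK s h1 h2) u h4 h5
  · exact fun s hs => hs.2.2
  · rintro x ⟨h1, h2, h3⟩
    obtain ⟨q, hq⟩ : ∃ q, Thin G m x q := by
      by_contra! hcon
      exact h3 ⟨h1, h2, hcon⟩
    refine ⟨q, ⟨fun hqK => hnK x h1 h2 q hqK hq.adj, ?_, fun hqQ => hqQ.2.2 x hq.symm⟩, hq⟩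
    rintro ⟨h4, k, hk, hkq⟩
    have hvq := hmem v hvS hvK hvnK q h4 ⟨k, hk, hkq⟩
    have hkx : k ≠ x := fun h => h1 (h ▸ hk)
    have hvx : v ≠ x := fun h => h3 (h ▸ hvQ)
    obtain ⟨-, -, a, -, -, -, hnb⟩ := hq
    have e1 := (hnb k hkq.symm).resolve_left hkx
    have e2 := (hnb v hvq.symm).resolve_left hvx
    exact hvK (e2.trans e1.symm ▸ hk)

end Extraction

end OddCactus

namespace OddCactus

variable {V : Type} {G : SimpleGraph V} {m : Sym2 V → ℕ} {c : V → ZMod 2} {K N Q P : Set V}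

namespace Frame

theorem color_N (F : Frame G m K N Q P) (hc : IsTwoColoring G c) {s u : V} (hs : s ∈ Q)
    (hu : u ∈ N) : c u = c s + 1 := hc _ _ (F.Q_adj_N s hs u hu)

theorem color_NN (F : Frame G m K N Q P) (hc : IsTwoColoring G c) {u u' : V} (hu : u ∈ N)
    (hu' : u' ∈ N) : c u = c u' := by
  obtain ⟨s, hs⟩ := F.Q_nonempty
  rw [F.color_N hc hs hu, F.color_N hc hs hu']

theorem color_QQ (F : Frame G m K N Q P) (hc : IsTwoColoring G c) {s s' : V} (hs : s ∈ Q)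
    (hs' : s' ∈ Q) : c s = c s' := by
  obtain ⟨u, hu⟩ := F.N_nonempty
  have := F.color_N hc hs hu
  rw [F.color_N hc hs' hu] at this
  exact (add_right_cancel this).symm

theorem not_adj_of_color (hc : IsTwoColoring G c) {a b : V} (h : c a = c b) : ¬ G.Adj a b := by
  intro hab
  rw [hc _ _ hab] at h
  generalize c a = t at h; revert t; decide

theorem P_nbr (F : Frame G m K N Q P) {x y : V} (hx : x ∈ P) (h : G.Adj x y) :
    y ∈ N ∨ y ∈ Q ∨ y ∈ P := by
  rcases F.cover y with hy | hy | hy | hy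
  · rcases F.K_adj y hy x h.symm with h' | h'
    · exact absurd hx (F.KP x h')
    · exact absurd hx (F.NP x h')
  · exact Or.inl hy
  · exact Or.inr (Or.inl hy)
  · exact Or.inr (Or.inr hy)

theorem Q_nbr (F : Frame G m K N Q P) (hc : IsTwoColoring G c) {s y : V} (hs : s ∈ Q)
    (h : G.Adj s y) : y ∈ N ∨ y ∈ P := by
  rcases F.cover y with hy | hy | hy | hy
  · rcases F.K_adj y hy s h.symm with h' | h'
    · exact absurd hs (F.KQ s h')
    · exact absurd hs (F.NQ s h')
  · exact Or.inl hy
  · exact absurd h (not_adj_of_color hc (F.color_QQ hc hs hy))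
  · exact Or.inr hy

/-- The structure of a vertex of `P` with a neighbour outside `P`. -/
theorem exists_partner (F : Frame G m K N Q P) {x y : V} (hx : x ∈ P) (h : G.Adj x y)
    (hy : y ∉ P) : m s(x, y) = 1 ∧ ∃ q ∈ P, q ≠ y ∧ Thin G m x q ∧
      ∀ z, G.Adj x z ↔ z = y ∨ z = q := by
  obtain ⟨q, hq, hxq⟩ := F.P_thin x hx
  have hyq : y ≠ q := fun h => hy (h ▸ hq)
  refine ⟨hxq.1.unit h hyq, q, hq, hyq.symm, hxq, fun z => ⟨fun hz => ?_, ?_⟩⟩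
  · obtain ⟨⟨-, a, -, -, -, hnb⟩, -⟩ := hxq
    rcases hnb z hz with rfl | rfl
    · exact Or.inr rfl
    · exact Or.inl ((hnb y h).resolve_left hyq).symm
  · rintro (rfl | rfl)
    · exact h
    · exact hxq.adj

theorem eq_of_adj (F : Frame G m K N Q P) {x y y' : V} (hx : x ∈ P) (h : G.Adj x y)
    (hy : y ∉ P) (h' : G.Adj x y') (hy' : y' ∉ P) : y = y' := by
  obtain ⟨-, q, hq, -, -, hnb⟩ := F.exists_partner hx h hy
  rcases (hnb y').1 h' with h | h
  · exact h.symm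
  · exact absurd (h ▸ hq) hy'

theorem three_le_wdeg [Fintype V] (F : Frame G m K N Q P) (hm : ∀ e, 1 ≤ m e)
    (hdeg : ∀ x y, G.Adj x y → ∃ z, z ≠ y ∧ G.Adj x z) {x s q : V} (hx : x ∈ P) (hs : s ∈ Q)
    (h : G.Adj x s) (hxq : Thin G m x q) (hqs : q ≠ s) (h1 : m s(x, q) = 1) :
    3 ≤ wdeg G m s := by
  by_contra hlt
  obtain ⟨z, hzx, hsz⟩ := hdeg s x h.symm
  have hle := add_le_wdeg (w := m) h.symm hsz hzx.symm
  have hm1 := hm s(s, x)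
  have hm2 := hm s(s, z)
  refine F.Q_not_thin s hs x (Thin.symm ⟨⟨h, q, hqs, hxq.adj, h1, ?_⟩,
    ⟨h.symm, z, hzx, hsz, by omega, ?_⟩⟩)
  · obtain ⟨-, r, -, -, -, hnb⟩ := F.exists_partner hx h (F.QP s hs)
    intro y hy
    rcases (hnb y).1 hy with h' | h'
    · exact Or.inl h'
    · right
      rcases (hnb q).1 hxq.adj with h2 | h2
      · exact absurd h2 hqs
      · rw [h', h2]
  · intro y hy
    by_contra! hcon
    have := add_add_le_wdeg (w := m) h.symm hsz hy hzx.symm hcon.1.symm hcon.2.symm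
    have := hm s(s, y)
    omega

end Frame

/-- The vertices joined to `x` within `P`. -/
def part (G : SimpleGraph V) (P : Set V) (x : V) : Set V := {y | (onSet G P).Reachable x y}

theorem mem_part_self (x : V) : x ∈ part G P x := SimpleGraph.Reachable.rfl

theorem part_eq_of_mem {x y : V} (h : y ∈ part G P x) : part G P x = part G P y := by
  ext z
  exact ⟨fun hz => SimpleGraph.Reachable.trans (SimpleGraph.Reachable.symm h) hz,
    fun hz => SimpleGraph.Reachable.trans h hz⟩

theorem part_eq_of_adj {x y : V} (hx : x ∈ P) (hy : y ∈ P) (h : G.Adj x y) :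
    part G P x = part G P y := part_eq_of_mem (SimpleGraph.Adj.reachable ⟨h, hx, hy⟩)

theorem part_subset {x : V} (hx : x ∈ P) : part G P x ⊆ P := by
  rintro y ⟨W⟩
  induction W with
  | nil => exact hx
  | cons h W ih => exact ih h.2.2

/-- A set `D` has a subset of odd size such that conflicts on edges inside `P` leaving the subset
are harmless. -/
def Flexible (G : SimpleGraph V) (m : Sym2 V → ℕ) (P D : Set V) : Prop :=
  ∃ W ⊆ D, Odd W.ncard ∧ ∀ a ∈ W, ∀ b ∈ P, b ∉ W → G.Adj a b →
    Cleanable G m a b ∨ Cleanable G m b a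

namespace Frame

theorem zero_mem (F : Frame G m K N Q P) {n : ℕ} {p : ℕ → V} (hp : PathIn G P n p) :
    p 0 ∈ N ∨ p 0 ∈ Q := by
  have h1 := hp.one_le
  rcases F.P_nbr (hp.mem 1 le_rfl h1) (hp.adj 0 (by omega)).symm with h | h | h
  · exact Or.inl h
  · exact Or.inr h
  · exact absurd h hp.zero

theorem last_mem (F : Frame G m K N Q P) {n : ℕ} {p : ℕ → V} (hp : PathIn G P n p) :
    p (n + 1) ∈ N ∨ p (n + 1) ∈ Q := by
  have := F.zero_mem hp.reverse
  simpa using this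

variable [Fintype V]

theorem exists_path (F : Frame G m K N Q P) (hG : G.Connected) {x : V} (hx : x ∈ P) :
    ∃ n p, PathIn G P n p ∧ part G P x = interior p n := by
  obtain ⟨s, hs⟩ := F.Q_nonempty
  obtain ⟨n, p, hp, j, hj, hjn, rfl⟩ := exists_pathIn (P := P) hG
    (fun y hy => by obtain ⟨q, -, hq⟩ := F.P_thin y hy; exact hq.1.exists_pair) (F.QP s hs) hx
  exact ⟨n, p, hp, Set.ext fun y => hp.reachable_iff hj hjn y⟩

theorem exists_path_of_not_flexible (F : Frame G m K N Q P) (IH : SmallerBadAreCacti V)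
    (hG : G.Connected) (hc : IsTwoColoring G c) (hm : ∀ e, 1 ≤ m e) (hbad : ¬ Good G m)
    (hcac : ¬ IsMultiCactus G m) {x : V} (hx : x ∈ P) (hflex : ¬ Flexible G m P (part G P x)) :
    ∃ n p, PathIn G P n p ∧ part G P x = interior p n ∧ p 0 ∈ Q ∧ p (n + 1) ∈ N ∧ n % 4 = 2 := by
  obtain ⟨n, p, hp, hD⟩ := F.exists_path hG hx
  have hint : ∀ {p : ℕ → V}, PathIn G P n p → ∀ a b, G.Adj a b → a ∈ interior p n → b ∈ P →
      b ∈ interior p n := by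
    rintro p hp a b hab ⟨j, hj1, hjn, rfl⟩ hb
    obtain ⟨j, rfl⟩ := Nat.exists_eq_add_of_le' hj1
    rcases hp.nbr j (by omega) b hab with rfl | rfl
    · exact ⟨j, Nat.one_le_iff_ne_zero.2 fun h => hp.zero (h ▸ hb), by omega, rfl⟩
    · exact ⟨j + 2, by omega, Nat.le_of_not_lt fun h => hp.last (by
        rwa [show n + 1 = j + 2 by omega]), rfl⟩
  have hev : Even n := by
    by_contra h
    rw [Nat.not_even_iff_odd] at h
    rw [hD] at hflex
    refine hflex ⟨_, subset_rfl, ?_, fun a ha b hb hbn hab => absurd (hint hp a b hab ha hb) hbn⟩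
    have := hp.ncard_image le_rfl le_rfl
    rw [interior, this]
    exact h
  obtain ⟨p, hp, hD, hQ, hN⟩ : ∃ p, PathIn G P n p ∧ part G P x = interior p n ∧ p 0 ∈ Q ∧
      p (n + 1) ∈ N := by
    have hcol := hp.color_eq hc (i := n + 1) le_rfl
    rw [ZMod.natCast_eq_one_iff_odd.2 hev.add_one] at hcol
    have hne : c (p 0) ≠ c (p (n + 1)) := by
      rw [hcol]
      generalize c (p 0) = t; revert t; decide
    rcases F.zero_mem hp with h0 | h0 <;> rcases F.last_mem hp with h1 | h1
    · exact absurd (F.color_NN hc h0 h1) hne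
    · refine ⟨_, hp.reverse, ?_, by simpa using h1, by simpa using h0⟩
      rw [hD]
      ext y
      constructor
      · rintro ⟨j, hj, hjn, rfl⟩
        exact ⟨n + 1 - j, by omega, by omega, by simp only; congr 1; omega⟩
      · rintro ⟨j, hj, hjn, rfl⟩
        exact ⟨n + 1 - j, by omega, by omega, rfl⟩
    · exact ⟨p, hp, hD, h0, h1⟩
    · exact absurd (F.color_QQ hc h0 h1) hne
  refine ⟨n, p, hp, hD, hQ, hN, ?_⟩
  by_contra hn
  obtain ⟨k, rfl⟩ : ∃ k, n = 4 * k + 4 :=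
    ⟨n / 4 - 1, by have := hp.one_le; rcases hev with ⟨j, hj⟩; omega⟩
  by_cases hunit : ∀ i ≤ 4 * k + 4, Even i → m s(p i, p (i + 1)) = 1
  · exact hcac (isMultiCactus_of_ear IH hG hc hm hbad hp (F.Q_adj_N _ hQ _ hN) hunit)
  push Not at hunit
  obtain ⟨i, hi, hev', h1⟩ := hunit
  have h2 : 2 ≤ m s(p i, p (i + 1)) := by have := hm s(p i, p (i + 1)); omega
  have hi0 : i ≠ 0 := by
    rintro rfl
    have := (F.exists_partner (hp.mem 1 le_rfl (by omega)) (hp.adj 0 (by omega)).symm hp.zero).1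
    rw [Sym2.eq_swap] at this
    exact h1 this
  obtain ⟨r, -, hr⟩ := F.P_thin _ (hp.mem i (by omega) hi)
  rw [hD] at hflex
  refine hflex ⟨{y | ∃ j, i ≤ j ∧ j ≤ 4 * k + 4 ∧ p j = y}, ?_, ?_, ?_⟩
  · rintro y ⟨j, hj, hjn, rfl⟩
    exact ⟨j, by omega, hjn, rfl⟩
  · rw [hp.ncard_image (by omega) le_rfl]
    rcases hev' with ⟨j, hj⟩
    exact ⟨2 * k + 2 - j, by omega⟩
  rintro a ⟨j, hj, hjn, rfl⟩ b hb hbn hab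
  left
  obtain ⟨i, rfl⟩ := Nat.exists_eq_succ_of_ne_zero hi0
  obtain ⟨j, rfl⟩ := Nat.exists_eq_succ_of_ne_zero (show j ≠ 0 by omega)
  rcases hp.nbr j (by omega) b hab with rfl | rfl
  · have hji : j = i := by
      by_contra h
      exact hbn ⟨j, by omega, by omega, rfl⟩
    subst hji
    exact ⟨p (j + 2), (hp.ne j (by omega)).symm, hr.of_two_le (hp.adj _ hi) h2, h2⟩
  · exfalso
    refine hbn ⟨j + 2, by omega, Nat.le_of_not_lt fun h => hp.last ?_, rfl⟩
    rwa [show 4 * k + 4 + 1 = j + 2 by omega]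

end Frame

theorem PathIn.sum_color (hc : IsTwoColoring G c) {n : ℕ} {p : ℕ → V} (hp : PathIn G P n p)
    (hn : n % 4 = 2) (κ : ZMod 2) : ∑ j ∈ Finset.range n, (c (p (j + 1)) + κ) = 1 := by
  have key : ∀ k, 4 * k + 2 ≤ n → ∑ j ∈ Finset.range (4 * k + 2), (c (p (j + 1)) + κ) = 1 := by
    intro k
    induction k with
    | zero =>
      intro h
      rw [Finset.sum_range_succ, Finset.sum_range_one,
        hp.color_eq hc (i := 0 + 1) (by omega), hp.color_eq hc (i := 1 + 1) (by omega)]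
      push_cast
      generalize c (p 0) = a
      revert a κ; decide
    | succ k ih =>
      intro h
      rw [show 4 * (k + 1) + 2 = 4 * k + 2 + 1 + 1 + 1 + 1 by ring, Finset.sum_range_succ,
        Finset.sum_range_succ, Finset.sum_range_succ, Finset.sum_range_succ, ih (by omega),
        hp.color_eq hc (i := 4 * k + 2 + 1) (by omega),
        hp.color_eq hc (i := 4 * k + 2 + 1 + 1) (by omega),
        hp.color_eq hc (i := 4 * k + 2 + 1 + 1 + 1) (by omega),
        hp.color_eq hc (i := 4 * k + 2 + 1 + 1 + 1 + 1) (by omega)]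
      push_cast
      clear ih
      generalize c (p 0) = a
      generalize (k : ZMod 2) = b
      revert a b κ; decide
  have := key (n / 4) (by omega)
  rwa [show 4 * (n / 4) + 2 = n by omega] at this

end OddCactus

namespace OddCactus

variable {V : Type} {G : SimpleGraph V} {m : Sym2 V → ℕ} {c : V → ZMod 2}
  {K N Q P : Set V}

/-- A chosen subset witnessing that `D` is flexible. -/
noncomputable def flexSet (G : SimpleGraph V) (m : Sym2 V → ℕ) (P D : Set V) : Set V :=
  if h : Flexible G m P D then h.choose else ∅

theorem flexSet_subset (D : Set V) : flexSet G m P D ⊆ D := by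
  unfold flexSet
  split_ifs with h
  · exact h.choose_spec.1
  · exact Set.empty_subset _

theorem flexible_of_mem {D : Set V} {x : V} (hx : x ∈ flexSet G m P D) : Flexible G m P D := by
  by_contra h
  rw [flexSet, dif_neg h] at hx
  exact hx

theorem cleanable_of_flexSet {D : Set V} {a b : V} (ha : a ∈ flexSet G m P D) (hb : b ∈ P)
    (hbD : b ∉ flexSet G m P D) (hab : G.Adj a b) : Cleanable G m a b ∨ Cleanable G m b a := by
  have h := flexible_of_mem ha
  rw [flexSet, dif_pos h] at ha hbD
  exact h.choose_spec.2.2 a ha b hb hbD hab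

theorem sum_ind_flexSet [Fintype V] {D : Set V} (h : Flexible G m P D) :
    ∑ v, ind (flexSet G m P D) v = 1 := by
  rw [sum_ind, flexSet, dif_pos h]
  exact ZMod.natCast_eq_one_iff_odd.2 h.choose_spec.2.1

theorem reachable_eq_part {H : SimpleGraph V} {x : V} (hx : x ∈ P) (hPH : onSet G P ≤ H)
    (hHG : H ≤ G) (hout : ∀ y ∈ part G P x, ∀ z, H.Adj y z → z ∈ P) (y : V) :
    H.Reachable x y ↔ y ∈ part G P x := by
  refine ⟨?_, fun h => SimpleGraph.Reachable.mono hPH h⟩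
  rintro ⟨W⟩
  induction W with
  | nil => exact mem_part_self _
  | @cons a b _ hab W ih =>
    have hb := hout a (mem_part_self a) b hab
    have he := part_eq_of_adj hx hb (hHG hab)
    rw [he]
    exact ih hb (fun y hy => hout y (he ▸ hy))

theorem Frame.good_of_flexible [Fintype V] (F : Frame G m K N Q P) (hc : IsTwoColoring G c)
    (hm : ∀ e, 1 ≤ m e) (κ : ZMod 2) {w₀ : Sym2 V → ℕ} (hw₀ : Admissible G m w₀)
    {H : SimpleGraph V} (hHG : H ≤ G) (k₀ : V) {x₀ : V} (hx₀ : x₀ ∈ P)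
    (hflex : Flexible G m P (part G P x₀)) (hK : ∀ v ∈ K, H.Reachable k₀ v)
    (hN : ∀ v ∈ N, H.Reachable k₀ v) (hpart : ∀ y ∈ part G P x₀, H.Reachable k₀ y)
    (hQ : ∀ s ∈ Q, H.Reachable k₀ s ∨
      ((∀ y, ¬ H.Adj s y) ∧ (wdeg G w₀ s : ZMod 2) = c s + κ))
    (hPH : onSet G P ≤ H)
    (hout : ∀ x ∈ P, x ∉ part G P x₀ → ∀ y, H.Adj x y → y ∈ P)
    (hzero : ∀ x ∈ P, ¬ Flexible G m P (part G P x) →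
      ∑ y with y ∈ part G P x, (c y + κ - wdeg G w₀ y) = 0)
    (hend : ∀ w, Admissible G m w → (∀ e, e ∉ H.edgeSet → w e = w₀ e) →
      (∀ e, w e ≤ w₀ e + 1 ∧ w₀ e ≤ w e + 1) →
      (∀ v, v ∉ P → (wdeg G w v : ZMod 2) = c v + κ) →
      ∀ x ∈ P, ∀ y, y ∉ P → ∀ q, G.Adj x y → Flexible G m P (part G P x) → Thin G m x q →
        q ≠ y → m s(x, q) = 1 → w s(x, y) + 3 ≤ wdeg G w y) : Good G m := by
  let a : Set V → ZMod 2 := fun D => ∑ y with y ∈ D, (c y + κ - wdeg G w₀ y)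
  let X : Prop → Set V := fun b => {y | y ∈ P ∧ y ∈ flexSet G m P (part G P y) ∧
    if part G P y = part G P x₀ then b else a (part G P y) ≠ 0}
  have hind : ∀ y, ind (X True) y = ind (X False) y + ind (flexSet G m P (part G P x₀)) y := by
    intro y
    by_cases hy : part G P y = part G P x₀
    · have h1 : y ∉ X False := fun h => by simpa [hy] using h.2.2
      have hyx : y ∈ part G P x₀ := hy ▸ mem_part_self y
      have h2 : y ∈ X True ↔ y ∈ flexSet G m P (part G P x₀) := by
        simp only [X, Set.mem_ofPred_eq, hy, if_true, and_true]
        exact ⟨fun h => h.2, fun h => ⟨part_subset hx₀ hyx, h⟩⟩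
      rw [ind_of_notMem h1, zero_add]
      simp only [ind, h2]
    · have h1 : y ∉ flexSet G m P (part G P x₀) := fun h =>
        hy (part_eq_of_mem (flexSet_subset _ h)).symm
      rw [ind_of_notMem h1, add_zero]
      simp only [ind, X, Set.mem_ofPred_eq, if_neg hy]
  obtain ⟨b, hb⟩ : ∃ b, ∑ v, (c v + κ + ind (X b) v) = 0 := by
    by_contra! hcon
    have h1 := hcon True
    have h2 := hcon False
    simp only [hind] at h1
    rw [Finset.sum_add_distrib] at h1 h2
    rw [Finset.sum_add_distrib (g := ind (flexSet G m P (part G P x₀))), sum_ind_flexSet hflex]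
      at h1
    generalize ∑ v, (c v + κ) = s at h1 h2
    generalize ∑ v, ind (X False) v = t at h1 h2
    revert s t; decide
  have hXP : ∀ y ∈ X b, y ∈ P := fun y hy => hy.1
  obtain ⟨w, hw, hwH, hw1, hwp⟩ := exists_admissible_of_parity hm hHG hw₀
    (fun v => c v + κ + ind (X b) v) k₀ hb (by
      intro v hv
      rcases F.cover v with h | h | h | h
      · exact absurd (hK v h) hv
      · exact absurd (hN v h) hv
      · obtain ⟨h1, h2⟩ := (hQ v h).resolve_left hv
        have : Finset.univ.filter (fun y => H.Reachable v y) = {v} := by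
          ext y
          simp only [Finset.mem_filter, Finset.mem_univ, true_and, Finset.mem_singleton]
          constructor
          · rintro ⟨W⟩
            cases W with
            | nil => rfl
            | cons hab _ => exact absurd hab (h1 _)
          · rintro rfl
            exact SimpleGraph.Reachable.rfl
        rw [this, Finset.sum_singleton, h2, ind_of_notMem fun h' => F.QP v h (hXP v h')]
        simp
      · have hvx : v ∉ part G P x₀ := fun h' => hv (hpart v h')
        have hout' : ∀ y ∈ part G P v, ∀ z, H.Adj y z → z ∈ P := by
          intro y hy z hyz
          refine hout y (part_subset h hy) (fun h' => hvx ?_) z hyz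
          exact SimpleGraph.Reachable.trans h' (SimpleGraph.Reachable.symm hy)
        have hne : part G P v ≠ part G P x₀ := fun h' => hvx (h' ▸ mem_part_self v)
        simp only [reachable_eq_part h hPH hHG hout']
        have hsplit : ∑ y with y ∈ part G P v, (c y + κ + ind (X b) y - wdeg G w₀ y) =
            a (part G P v) + ∑ y with y ∈ part G P v, ind (X b) y := by
          simp only [a]
          rw [← Finset.sum_add_distrib]
          exact Finset.sum_congr rfl fun y _ => by ring
        rw [hsplit]
        have hmem : ∀ y ∈ part G P v, (y ∈ X b ↔ y ∈ flexSet G m P (part G P v) ∧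
            a (part G P v) ≠ 0) := by
          intro y hy
          simp only [X, Set.mem_ofPred_eq, ← part_eq_of_mem hy, if_neg hne]
          exact ⟨fun h => h.2, fun h' => ⟨part_subset h hy, h'⟩⟩
        by_cases ha : a (part G P v) = 0
        · rw [ha, zero_add]
          refine Finset.sum_eq_zero fun y hy => ind_of_notMem fun h' => ?_
          exact ((hmem y (Finset.mem_filter.1 hy).2).1 h').2 ha
        · have hfl : Flexible G m P (part G P v) := by
            by_contra h'
            exact ha (hzero v h h')
          have : ∑ y with y ∈ part G P v, ind (X b) y = 1 := by
            rw [← sum_ind_flexSet hfl, Finset.sum_filter]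
            refine Finset.sum_congr rfl fun y _ => ?_
            split_ifs with h'
            · simp only [ind, hmem y h', ha, ne_eq, not_false_eq_true, and_true]
            · rw [ind_of_notMem fun h'' => h' (flexSet_subset _ h'')]
          rw [this]
          generalize a (part G P v) = s at ha
          revert s; decide)
  refine good_of_parity hc hw κ (X b) hwp fun x y hxy hx hy he => ?_
  by_cases hyP : y ∈ P
  · refine cleanable_of_flexSet hx.2.1 hyP (fun h => hy ?_) hxy
    have hp := part_eq_of_adj hx.1 hyP hxy
    refine ⟨hyP, hp ▸ h, ?_⟩
    have := hx.2.2
    rwa [hp] at this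
  · obtain ⟨h1, q, hqP, hqy, hxq, hnb⟩ := F.exists_partner hx.1 hxy hyP
    left
    refine ⟨q, hqy, hxq, ?_⟩
    by_contra h2
    have hm1 := hm s(x, q)
    have h3 := hend w hw hwH hw1 (fun v hv => by
      rw [hwp, ind_of_notMem fun h => hv (hXP v h), add_zero]) x hx.1 y hyP q hxy
      (flexible_of_mem hx.2.1) hxq hqy (by omega)
    rw [wdeg_pair hqy.symm hnb] at he
    have h4 := (hw s(x, q) hxq.adj).2
    omega

end OddCactus

namespace OddCactus

variable {V : Type} {G : SimpleGraph V} {m : Sym2 V → ℕ} {c : V → ZMod 2} {K N Q P : Set V}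

/-- The edges of `G` inside `K ∪ N`, inside `P`, and those related by `R`. -/
def linkGraph (G : SimpleGraph V) (K N P : Set V) (R : V → V → Prop) : SimpleGraph V where
  Adj a b := G.Adj a b ∧ ((a ∈ K ∪ N ∧ b ∈ K ∪ N) ∨ (a ∈ P ∧ b ∈ P) ∨ R a b ∨ R b a)
  symm := ⟨fun _ _ h => ⟨h.1.symm, by have := h.2; tauto⟩⟩
  loopless := ⟨fun _ h => h.1.ne rfl⟩

theorem linkGraph_le (R : V → V → Prop) : linkGraph G K N P R ≤ G := fun _ _ h => h.1

theorem onSet_le_linkGraph (R : V → V → Prop) : onSet G P ≤ linkGraph G K N P R :=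
  fun _ _ h => ⟨h.1, Or.inr (Or.inl h.2)⟩

theorem Frame.linkGraph_reachable (F : Frame G m K N Q P) (R : V → V → Prop) {k v : V}
    (hk : k ∈ K) (hv : v ∈ K ∪ N) : (linkGraph G K N P R).Reachable k v := by
  have hle : onSet G K ≤ linkGraph G K N P R :=
    fun _ _ h => ⟨h.1, Or.inl ⟨Or.inl h.2.1, Or.inl h.2.2⟩⟩
  rcases hv with hv | hv
  · exact (F.K_reachable k hk v hv).mono hle
  · obtain ⟨k', hk', hadj⟩ := F.N_adj_K v hv
    refine ((F.K_reachable k hk k' hk').mono hle).trans (SimpleGraph.Adj.reachable ?_)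
    exact ⟨hadj.symm, Or.inl ⟨Or.inl hk', Or.inr hv⟩⟩

/-- Edges at `Q` are doubled. -/
noncomputable def doubleAt (m : Sym2 V → ℕ) (Q : Set V) (e : Sym2 V) : ℕ :=
  if ∃ s ∈ Q, s ∈ e then 2 * m e else m e

theorem admissible_doubleAt : Admissible G m (doubleAt m Q) := by
  intro e _
  unfold doubleAt
  split_ifs <;> omega

theorem doubleAt_of_mem {s y : V} (hs : s ∈ Q) : doubleAt m Q s(s, y) = 2 * m s(s, y) :=
  if_pos ⟨s, hs, Sym2.mem_mk_left _ _⟩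

theorem doubleAt_of_notMem {a b : V} (ha : a ∉ Q) (hb : b ∉ Q) :
    doubleAt m Q s(a, b) = m s(a, b) := by
  refine if_neg ?_
  rintro ⟨s, hs, h⟩
  rcases Sym2.mem_iff.1 h with rfl | rfl
  · exact ha hs
  · exact hb hs

variable [Fintype V]

theorem wdeg_doubleAt {s : V} (hs : s ∈ Q) : wdeg G (doubleAt m Q) s = 2 * wdeg G m s := by
  rw [wdeg, wdeg, Finset.mul_sum]
  exact Finset.sum_congr rfl fun y _ => doubleAt_of_mem hs

theorem wdeg_le_add_two {w w' : Sym2 V → ℕ} {s a b : V}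
    (h : ∀ y, G.Adj s y → y ≠ a → y ≠ b → w s(s, y) ≤ w' s(s, y))
    (h1 : ∀ y, w s(s, y) ≤ w' s(s, y) + 1) : wdeg G w s ≤ wdeg G w' s + 2 := by
  rw [wdeg_eq_sum_ite, wdeg_eq_sum_ite]
  calc ∑ u, (if G.Adj s u then w s(s, u) else 0)
      ≤ ∑ u, ((if G.Adj s u then w' s(s, u) else 0) + ((if u = a then 1 else 0) +
          if u = b then 1 else 0)) := by
        refine Finset.sum_le_sum fun u _ => ?_
        have := h1 u
        by_cases hu : G.Adj s u
        · have := h u hu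
          split_ifs <;> first | omega | tauto
        · simp [hu]
    _ = _ := by
        rw [Finset.sum_add_distrib, Finset.sum_add_distrib]
        simp

theorem PathIn.sum_part (hc : IsTwoColoring G c) {n : ℕ} {p : ℕ → V} (hp : PathIn G P n p)
    {x : V} (hx : part G P x = interior p n) (hn : n % 4 = 2) (κ : ZMod 2) (w : Sym2 V → ℕ) :
    ∑ y with y ∈ part G P x, (c y + κ - wdeg G w y) =
      1 - (w s(p 0, p 1) + w s(p n, p (n + 1))) := by
  have h1 := hp.one_le
  have hx1 : part G P x = part G P (p 1) :=
    part_eq_of_mem (hx ▸ ⟨1, le_rfl, h1, rfl⟩)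
  rw [hx1]
  refine Eq.trans (Finset.sum_congr (by ext y; simp only [Finset.mem_filter]; exact Iff.rfl) fun _
      _ => rfl)
    (hp.sum_reachable (fun y => c y + κ - (wdeg G w y : ZMod 2)) le_rfl h1 |>.trans ?_)
  rw [Finset.sum_sub_distrib, hp.sum_color hc hn, hp.sum_wdeg]

namespace Frame

theorem sum_part_doubleAt (F : Frame G m K N Q P) (hc : IsTwoColoring G c) {n : ℕ} {p : ℕ → V}
    (hp : PathIn G P n p) {x : V} (hx : part G P x = interior p n) (hn : n % 4 = 2)
    (h0 : p 0 ∈ Q) (hL : p (n + 1) ∈ N) (κ : ZMod 2) :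
    ∑ y with y ∈ part G P x, (c y + κ - wdeg G (doubleAt m Q) y) = 0 := by
  have h1 := hp.one_le
  rw [hp.sum_part hc hx hn, doubleAt_of_mem h0,
    doubleAt_of_notMem (fun h => F.QP _ h (hp.mem n h1 le_rfl)) (F.NQ _ hL)]
  have := (F.exists_partner (hp.mem n h1 le_rfl) (hp.adj n le_rfl) hp.last).1
  rw [this]
  push_cast
  generalize (m s(p 0, p 1) : ZMod 2) = t
  revert t; decide

theorem not_flexible_of_adj_N (F : Frame G m K N Q P) (IH : SmallerBadAreCacti V)
    (hG : G.Connected) (hc : IsTwoColoring G c) (hm : ∀ e, 1 ≤ m e)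
    (hdeg : ∀ x y, G.Adj x y → ∃ z, z ≠ y ∧ G.Adj x z) (hbad : ¬ Good G m)
    (hcac : ¬ IsMultiCactus G m) {x u : V}
    (hx : x ∈ P) (hu : u ∈ N) (hxu : G.Adj x u) :
    ¬ Flexible G m P (part G P x) := by
  intro hflex
  obtain ⟨s₁, hs₁⟩ := F.Q_nonempty
  obtain ⟨k, hk⟩ := F.K_nonempty
  let R : V → V → Prop := fun a b => a = x ∧ b = u
  have hQH : ∀ s ∈ Q, ∀ y, ¬ (linkGraph G K N P R).Adj s y := by
    rintro s hs y ⟨-, ⟨h | h, -⟩ | ⟨h, -⟩ | ⟨h, -⟩ | ⟨-, h⟩⟩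
    · exact F.KQ s h hs
    · exact F.NQ s h hs
    · exact F.QP s hs h
    · exact F.QP s hs (h ▸ hx)
    · exact F.NQ s (h ▸ hu) hs
  refine hbad (F.good_of_flexible hc hm (c s₁) (admissible_doubleAt (Q := Q)) (linkGraph_le R) k
      hx hflex
    (fun v hv => F.linkGraph_reachable R hk (Or.inl hv))
    (fun v hv => F.linkGraph_reachable R hk (Or.inr hv)) ?_ ?_ (onSet_le_linkGraph R) ?_ ?_ ?_)
  · intro y hy
    have h1 : (linkGraph G K N P R).Adj u x :=
      ⟨hxu.symm, Or.inr (Or.inr (Or.inr ⟨rfl, rfl⟩))⟩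
    exact ((F.linkGraph_reachable R hk (Or.inr hu)).trans h1.reachable).trans
      (SimpleGraph.Reachable.mono (onSet_le_linkGraph R) hy)
  · intro s hs
    refine Or.inr ⟨hQH s hs, ?_⟩
    rw [wdeg_doubleAt hs, F.color_QQ hc hs hs₁]
    push_cast
    generalize c s₁ = a
    generalize (wdeg G m s : ZMod 2) = b
    revert a b; decide
  · rintro y hy hyx z ⟨-, ⟨h | h, -⟩ | ⟨-, h⟩ | ⟨h, -⟩ | ⟨-, h⟩⟩
    · exact absurd hy (F.KP y h)
    · exact absurd hy (F.NP y h)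
    · exact h
    · exact absurd (by rw [h]; exact mem_part_self x) hyx
    · exact absurd hy (F.NP y (h ▸ hu))
  · intro y hy hyf
    obtain ⟨n, p, hp, hpart, h0, hL, hn⟩ :=
      F.exists_path_of_not_flexible IH hG hc hm hbad hcac hy hyf
    exact F.sum_part_doubleAt hc hp hpart hn h0 hL _
  · intro w hw hwH hw1 hwp y hy z hz q hyz _ hyq hqz h1
    have hmyz := (F.exists_partner hy hyz hz).1
    rcases F.P_nbr hy hyz with hzN | hzQ | hzP
    · obtain ⟨k', hk', hzk⟩ := F.N_adj_K z hzN
      have hzs := F.Q_adj_N s₁ hs₁ z hzN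
      have := add_add_le_wdeg (w := w) hyz.symm hzs.symm hzk
        (fun h => F.QP s₁ hs₁ (h ▸ hy)) (fun h => F.KP k' hk' (h ▸ hy))
        (fun h => F.KQ k' hk' (h ▸ hs₁))
      have h2 : w s(z, s₁) = 2 * m s(z, s₁) := by
        rw [hwH _ (fun h => hQH s₁ hs₁ z (SimpleGraph.Adj.symm h)), Sym2.eq_swap,
          doubleAt_of_mem hs₁]
      have h3 := (hw s(z, k') hzk).1
      have h4 := hm s(z, k')
      have h5 := hm s(z, s₁)
      rw [Sym2.eq_swap]
      omega
    · have h3 := F.three_le_wdeg hm hdeg hy hzQ hyz hyq hqz h1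
      have h4 : wdeg G w z = 2 * wdeg G m z := by
        rw [← wdeg_doubleAt hzQ]
        exact wdeg_congr fun t _ => hwH _ (hQH z hzQ t)
      have h5 := (hw s(y, z) hyz).2
      omega
    · exact absurd hzP hz

theorem not_flexible (F : Frame G m K N Q P) (IH : SmallerBadAreCacti V)
    (hG : G.Connected) (hc : IsTwoColoring G c) (hm : ∀ e, 1 ≤ m e)
    (hdeg : ∀ x y, G.Adj x y → ∃ z, z ≠ y ∧ G.Adj x z) (hbad : ¬ Good G m)
    (hcac : ¬ IsMultiCactus G m) {x : V} (hx : x ∈ P) :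
    ¬ Flexible G m P (part G P x) := by
  intro hflex
  obtain ⟨u, hu⟩ := F.N_nonempty
  obtain ⟨k, hk⟩ := F.K_nonempty
  obtain ⟨x, hx, hflex, s, hs, hxs⟩ : ∃ x ∈ P, Flexible G m P (part G P x) ∧
      ∃ s ∈ Q, G.Adj x s := by
    obtain ⟨n, p, hp, hpart⟩ := F.exists_path hG hx
    have h1 := hp.one_le
    have heq : part G P x = part G P (p 1) := part_eq_of_mem (hpart ▸ ⟨1, le_rfl, h1, rfl⟩)
    refine ⟨p 1, hp.mem 1 le_rfl h1, heq ▸ hflex, p 0, ?_, (hp.adj 0 (by omega)).symm⟩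
    refine (F.zero_mem hp).resolve_left fun h => ?_
    exact F.not_flexible_of_adj_N IH hG hc hm hdeg hbad hcac (hp.mem 1 le_rfl h1) h
      (hp.adj 0 (by omega)).symm (heq ▸ hflex)
  let R : V → V → Prop := fun a b => (a ∈ Q ∧ b = u) ∨ (a = x ∧ b = s)
  have hQH : ∀ t ∈ Q, ∀ y, (linkGraph G K N P R).Adj t y → y = u ∨ (y = x ∧ t = s) := by
    rintro t ht y ⟨-, ⟨h | h, -⟩ | ⟨h, -⟩ | (⟨-, h⟩ | ⟨h, -⟩) | ⟨-, h⟩ | ⟨h1, h2⟩⟩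
    · exact absurd ht (F.KQ t h)
    · exact absurd ht (F.NQ t h)
    · exact absurd h (F.QP t ht)
    · exact Or.inl h
    · exact absurd (h ▸ hx) (F.QP t ht)
    · exact absurd ht (F.NQ t (h ▸ hu))
    · exact Or.inr ⟨h1, h2⟩
  have hQr : ∀ t ∈ Q, (linkGraph G K N P R).Reachable k t := fun t ht => by
    have h1 : (linkGraph G K N P R).Adj u t :=
      ⟨(F.Q_adj_N t ht u hu).symm, Or.inr (Or.inr (Or.inr (Or.inl ⟨ht, rfl⟩)))⟩
    exact (F.linkGraph_reachable R hk (Or.inr hu)).trans h1.reachable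
  refine hbad (F.good_of_flexible hc hm (c s + 1) (admissible_doubleAt (Q := Q)) (linkGraph_le R)
      k hx hflex
    (fun v hv => F.linkGraph_reachable R hk (Or.inl hv))
    (fun v hv => F.linkGraph_reachable R hk (Or.inr hv)) ?_ (fun t ht => Or.inl (hQr t ht))
    (onSet_le_linkGraph R) ?_ ?_ ?_)
  · intro y hy
    have h1 : (linkGraph G K N P R).Adj s x :=
      ⟨hxs.symm, Or.inr (Or.inr (Or.inr (Or.inr ⟨rfl, rfl⟩)))⟩
    exact ((hQr s hs).trans h1.reachable).trans
      (SimpleGraph.Reachable.mono (onSet_le_linkGraph R) hy)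
  · rintro y hy hyx z ⟨-, ⟨h | h, -⟩ | ⟨-, h⟩ | (⟨h, -⟩ | ⟨h, -⟩) | ⟨-, h⟩ | ⟨-, h⟩⟩
    · exact absurd hy (F.KP y h)
    · exact absurd hy (F.NP y h)
    · exact h
    · exact absurd hy (F.QP y h)
    · exact absurd (by rw [h]; exact mem_part_self x) hyx
    · exact absurd hy (F.NP y (h ▸ hu))
    · exact absurd hy (F.QP y (h ▸ hs))
  · intro y hy hyf
    obtain ⟨n, p, hp, hpart, h0, hL, hn⟩ :=
      F.exists_path_of_not_flexible IH hG hc hm hbad hcac hy hyf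
    exact F.sum_part_doubleAt hc hp hpart hn h0 hL _
  · intro w hw hwH hw1 hwp y hy z hz q hyz hyf hyq hqz h1
    have hmyz := (F.exists_partner hy hyz hz).1
    rcases F.P_nbr hy hyz with hzN | hzQ | hzP
    · exact absurd hyf (F.not_flexible_of_adj_N IH hG hc hm hdeg hbad hcac hy hzN hyz)
    · have h3 := F.three_le_wdeg hm hdeg hy hzQ hyz hyq hqz h1
      have h4 : 2 * wdeg G m z ≤ wdeg G w z + 2 := by
        rw [← wdeg_doubleAt hzQ]
        refine wdeg_le_add_two (a := u) (b := x) (fun t _ htu htx => ?_) (fun t => (hw1 _).2)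
        rw [hwH]
        intro h
        rcases hQH z hzQ t h with h' | ⟨h', -⟩
        · exact htu h'
        · exact htx h'
      have h5 : Odd (wdeg G w z) := by
        rw [← ZMod.natCast_eq_one_iff_odd, hwp z hz, F.color_QQ hc hzQ hs]
        generalize c s = a; revert a; decide
      have h6 := (hw s(y, z) hyz).2
      rcases h5 with ⟨j, hj⟩
      omega
    · exact absurd hzP hz

end Frame

end OddCactus

namespace OddCactus

variable {V : Type} {G : SimpleGraph V} {m : Sym2 V → ℕ} {c : V → ZMod 2} {K N Q P : Set V}

/-- Every component of `P` is a path from `Q` to `N` whose number of vertices is `2` modulo `4`. -/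
def Bridged (G : SimpleGraph V) (N Q P : Set V) : Prop :=
  ∀ x ∈ P, ∃ n p, PathIn G P n p ∧ part G P x = interior p n ∧ p 0 ∈ Q ∧ p (n + 1) ∈ N ∧ n % 4 = 2

/-- The components of `P` with a neighbour of `s`. -/
def ownSet (G : SimpleGraph V) (P : Set V) (s : V) : Set V :=
  {x | x ∈ P ∧ ∃ a ∈ part G P x, G.Adj s a}

theorem mem_ownSet_of_mem_part {s x y : V} (hx : x ∈ ownSet G P s) (hy : y ∈ part G P x) :
    y ∈ ownSet G P s :=
  ⟨part_subset hx.1 hy, by rw [← part_eq_of_mem hy]; exact hx.2⟩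

theorem PathIn.exit {n : ℕ} {p : ℕ → V} (hp : PathIn G P n p) {i : ℕ} (hi : 1 ≤ i) (hin : i ≤ n)
    {z : V} (hz : z ∉ P) (h : G.Adj (p i) z) : (i = 1 ∧ z = p 0) ∨ (i = n ∧ z = p (n + 1)) := by
  obtain ⟨i, rfl⟩ : ∃ j, i = j + 1 := ⟨i - 1, by omega⟩
  rcases hp.nbr i (by omega) z h with rfl | rfl
  · rcases Nat.eq_zero_or_pos i with rfl | h0
    · exact Or.inl ⟨rfl, rfl⟩
    · exact absurd (hp.mem i h0 (by omega)) hz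
  · by_cases h0 : i + 2 ≤ n
    · exact absurd (hp.mem (i + 2) (by omega) h0) hz
    · obtain rfl : n = i + 1 := by omega
      exact Or.inr ⟨rfl, rfl⟩

/-- The path of a component of `P` attached to `s`. -/
theorem Bridged.exists_path (hB : Bridged G N Q P) (F : Frame G m K N Q P) {s x : V} (hs : s ∈ Q)
    (hx : x ∈ ownSet G P s) : ∃ n p, PathIn G P n p ∧ part G P x = interior p n ∧ p 0 = s ∧
      p (n + 1) ∈ N ∧ n % 4 = 2 := by
  obtain ⟨n, p, hp, hpart, h0, hL, hn⟩ := hB x hx.1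
  obtain ⟨-, a, ha, hsa⟩ := hx
  rw [hpart] at ha
  obtain ⟨i, hi, hin, rfl⟩ := ha
  rcases hp.exit hi hin (F.QP s hs) hsa.symm with ⟨-, rfl⟩ | ⟨-, rfl⟩
  · exact ⟨n, p, hp, hpart, rfl, hL, hn⟩
  · exact absurd hs (F.NQ _ hL)

theorem sum_le_wdeg [Fintype V] {w : Sym2 V → ℕ} {v : V} (S : Finset V) (hS : ∀ y ∈ S, G.Adj v y) :
    ∑ y ∈ S, w s(v, y) ≤ wdeg G w v :=
  Finset.sum_le_sum_of_subset fun y hy => by simp [hS y hy]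

theorem sum_reachable_of_isolated [Fintype V] {H : SimpleGraph V} {v : V} (h : ∀ y, ¬ H.Adj v y)
    (f : V → ZMod 2) : ∑ y with H.Reachable v y, f y = f v := by
  have : Finset.univ.filter (fun y => H.Reachable v y) = {v} := by
    ext y
    simp only [Finset.mem_filter, Finset.mem_univ, true_and, Finset.mem_singleton]
    constructor
    · rintro ⟨W⟩
      cases W with
      | nil => rfl
      | cons hab _ => exact absurd hab (h _)
    · rintro rfl
      exact SimpleGraph.Reachable.rfl
  rw [this, Finset.sum_singleton]

theorem Bridged.sum_ind_ownSet [Fintype V] (hB : Bridged G N Q P) (s : V) :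
    ∑ v, ind (ownSet G P s) v = 0 := by
  rw [← Finset.sum_fiberwise Finset.univ (onSet G P).connectedComponentMk]
  refine Finset.sum_eq_zero fun C _ => ?_
  induction C using SimpleGraph.ConnectedComponent.ind with | _ x => ?_
  have hset : Finset.univ.filter (fun y => (onSet G P).connectedComponentMk y =
      (onSet G P).connectedComponentMk x) = Finset.univ.filter fun y => y ∈ part G P x := by
    ext y
    simp only [Finset.mem_filter, Finset.mem_univ, true_and, SimpleGraph.ConnectedComponent.eq]
    exact ⟨SimpleGraph.Reachable.symm, SimpleGraph.Reachable.symm⟩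
  rw [hset]
  by_cases hx : x ∈ ownSet G P s
  · obtain ⟨n, p, hp, hpart, -, -, hn⟩ := hB x hx.1
    have h1 := hp.one_le
    have hx1 : part G P x = part G P (p 1) :=
      part_eq_of_mem (hpart ▸ ⟨1, le_rfl, h1, rfl⟩)
    have hsum := hp.sum_reachable (fun _ => (1 : ZMod 2)) le_rfl h1
    rw [Finset.sum_const, Finset.sum_const, Finset.card_range, nsmul_one, nsmul_one,
      (ZMod.natCast_eq_zero_iff_even (n := n)).2 (by rw [Nat.even_iff]; omega)] at hsum
    rw [Finset.sum_congr rfl fun y hy => ind_of_mem (mem_ownSet_of_mem_part hx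
      (Finset.mem_filter.1 hy).2), Finset.sum_const, nsmul_one, ← hsum, hx1]
    congr 2
    ext y
    simp only [Finset.mem_filter]
    exact Iff.rfl
  · refine Finset.sum_eq_zero fun y hy => ind_of_notMem fun h => hx ?_
    exact mem_ownSet_of_mem_part h (SimpleGraph.Reachable.symm (Finset.mem_filter.1 hy).2)

/-- A vertex `s₀` of `Q` gets the wrong parity, together with the components of `P` attached
to it. The edges in `K`, in `P`, from `Q \ {s₀}` to `P`, and those given by `R` may be modified. -/
theorem Frame.good_of_center [Fintype V] (F : Frame G m K N Q P) (hG : G.Connected)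
    (hc : IsTwoColoring G c) (hm : ∀ e, 1 ≤ m e) (hbad : ¬ Good G m) (hB : Bridged G N Q P)
    {s₀ : V} (hs₀ : s₀ ∈ Q) {w₀ : Sym2 V → ℕ} (hw₀ : Admissible G m w₀) (R : V → V → Prop)
    (hR : ∀ a b, G.Adj a b → R a b → a ∈ N ∧ (b ∈ K ∨ b ∈ Q ∧ b ≠ s₀))
    (hN : ∀ u ∈ N, (∃ k ∈ K, G.Adj u k ∧ R u k) ∨
      ((∀ y, ¬ R u y) ∧ (wdeg G w₀ u : ZMod 2) = wdeg G w₀ s₀))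
    (hQ : ∀ s ∈ Q, s ≠ s₀ → (∃ u ∈ N, R u s ∧ ∃ k ∈ K, G.Adj u k ∧ R u k) ∨
      ((∀ y, ¬ R y s) ∧ (∀ y ∈ P, ¬ G.Adj s y) ∧ (wdeg G w₀ s : ZMod 2) = wdeg G w₀ s₀ + 1))
    (hown : ∀ a ∈ P, ∀ b ∈ ownSet G P s₀, ∀ u ∈ N, G.Adj s₀ a → G.Adj b u →
      w₀ s(s₀, a) + w₀ s(b, u) = 3)
    (hthree : ∀ b ∈ ownSet G P s₀, ∀ u ∈ N, G.Adj b u → 2 ≤ w₀ s(s₀, u) ∨ ∃ s ∈ Q, s ≠ s₀)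
    (hne : ∀ w, Admissible G m w →
      (∀ u ∈ N, ∀ y, G.Adj u y → ¬ R u y → w s(u, y) = w₀ s(u, y)) →
      (∀ e, w e ≤ w₀ e + 1) → ∀ u ∈ N, wdeg G w u ≠ wdeg G w₀ s₀) : Good G m := by
  obtain ⟨k₀, hk₀⟩ := F.K_nonempty
  let H := linkGraph G K ∅ P (fun a b => R a b ∨ (a ∈ Q ∧ a ≠ s₀ ∧ b ∈ P))
  have hHG : H ≤ G := linkGraph_le _
  have hPH : onSet G P ≤ H := onSet_le_linkGraph _
  have hHN : ∀ u ∈ N, ∀ y, H.Adj u y → R u y := by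
    rintro u hu y ⟨hadj, ⟨h | h, -⟩ | ⟨h, -⟩ | (h | ⟨h, -, -⟩) | (h | ⟨-, -, h⟩)⟩
    · exact absurd hu (F.KN u h)
    · exact absurd h (Set.notMem_empty u)
    · exact absurd h (F.NP u hu)
    · exact h
    · exact absurd h (F.NQ u hu)
    · rcases (hR _ _ hadj.symm h).2 with h' | h'
      · exact absurd hu (F.KN u h')
      · exact absurd h'.1 (F.NQ u hu)
    · exact absurd h (F.NP u hu)
  have hHQ : ∀ s ∈ Q, ∀ y, H.Adj s y → s ≠ s₀ ∧ (R y s ∨ y ∈ P) := by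
    rintro s hs y ⟨hadj, ⟨h | h, -⟩ | ⟨h, -⟩ | (h | ⟨-, h, h'⟩) | (h | ⟨-, -, h⟩)⟩
    · exact absurd hs (F.KQ s h)
    · exact absurd h (Set.notMem_empty s)
    · exact absurd h (F.QP s hs)
    · exact absurd hs (F.NQ s (hR _ _ hadj h).1)
    · exact ⟨h, Or.inr h'⟩
    · refine ⟨?_, Or.inl h⟩
      rcases (hR _ _ hadj.symm h).2 with h' | h'
      · exact absurd hs (F.KQ s h')
      · exact h'.2
    · exact absurd h (F.QP s hs)
  have hHP : ∀ x ∈ ownSet G P s₀, ∀ y, H.Adj x y → y ∈ P := by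
    rintro x hx y ⟨hadj, ⟨h | h, -⟩ | ⟨-, h⟩ | (h | ⟨h, -, -⟩) | (h | ⟨hy, hy', -⟩)⟩
    · exact absurd hx.1 (F.KP x h)
    · exact absurd h (Set.notMem_empty x)
    · exact h
    · exact absurd hx.1 (F.NP x (hR _ _ hadj h).1)
    · exact absurd hx.1 (F.QP x h)
    · rcases (hR _ _ hadj.symm h).2 with h' | h'
      · exact absurd hx.1 (F.KP x h')
      · exact absurd hx.1 (F.QP x h'.1)
    · obtain ⟨n, p, hp, hpart, h0, hL, -⟩ := hB.exists_path F hs₀ hx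
      obtain ⟨i, hi, hin, rfl⟩ : x ∈ interior p n := hpart ▸ mem_part_self x
      rcases hp.exit hi hin (F.QP y hy) hadj with ⟨-, h⟩ | ⟨-, h⟩
      · exact absurd (h.trans h0) hy'
      · exact absurd hy (F.NQ y (h ▸ hL))
  have hKr : ∀ k ∈ K, H.Reachable k₀ k := fun k hk =>
    (F.K_reachable k₀ hk₀ k hk).mono fun _ _ (h : G.Adj _ _ ∧ _ ∧ _) =>
      ⟨h.1, Or.inl ⟨Or.inl h.2.1, Or.inl h.2.2⟩⟩
  have hNr : ∀ u ∈ N, (∃ k ∈ K, G.Adj u k ∧ R u k) → H.Reachable k₀ u := by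
    rintro u - ⟨k, hk, hadj, h⟩
    exact (hKr k hk).trans (SimpleGraph.Adj.reachable
      ⟨hadj.symm, Or.inr (Or.inr (Or.inr (Or.inl h)))⟩)
  have hQr : ∀ s ∈ Q, (∃ u ∈ N, R u s ∧ ∃ k ∈ K, G.Adj u k ∧ R u k) → H.Reachable k₀ s := by
    rintro s hs ⟨u, hu, h, hk⟩
    exact (hNr u hu hk).trans (SimpleGraph.Adj.reachable
      ⟨(F.Q_adj_N s hs u hu).symm, Or.inr (Or.inr (Or.inl (Or.inl h)))⟩)
  let κ : ZMod 2 := wdeg G w₀ s₀ + 1 + c s₀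
  let W : Set V := insert s₀ (ownSet G P s₀)
  have hs₀own : s₀ ∉ ownSet G P s₀ := fun h => F.QP s₀ hs₀ h.1
  have hindW : ∀ v, ind W v = (if v = s₀ then 1 else 0) + ind (ownSet G P s₀) v := by
    intro v
    by_cases h : v = s₀
    · subst h
      rw [ind_of_mem (Set.mem_insert _ _), if_pos rfl, ind_of_notMem hs₀own, add_zero]
    · rw [if_neg h, zero_add]
      simp only [ind, W, Set.mem_insert_iff, h, false_or]
  have hNW : ∀ u ∈ N, u ∉ W := by
    rintro u hu (rfl | h)
    · exact F.NQ u hu hs₀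
    · exact F.NP u hu h.1
  have hsum : ∑ v, (c v + κ + ind W v) = 0 := by
    rw [Finset.sum_add_distrib, sum_color_eq_one hG hc hm hbad]
    simp only [hindW]
    rw [Finset.sum_add_distrib, hB.sum_ind_ownSet]
    simp
    decide
  obtain ⟨w, hw, hwH, hw1, hwp⟩ := exists_admissible_of_parity hm hHG hw₀
    (fun v => c v + κ + ind W v) k₀ hsum (by
      intro v hv
      rcases F.cover v with h | h | h | h
      · exact absurd (hKr v h) hv
      · obtain ⟨h1, h2⟩ := (hN v h).resolve_left fun h' => hv (hNr v h h')
        rw [sum_reachable_of_isolated fun y hy => h1 y (hHN v h y hy), h2,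
          ind_of_notMem (hNW v h), F.color_N hc hs₀ h]
        simp only [κ]
        generalize (wdeg G w₀ s₀ : ZMod 2) = t
        generalize c s₀ = a
        revert t a; decide
      · by_cases hvs : v = s₀
        · subst hvs
          rw [sum_reachable_of_isolated fun y hy => (hHQ v h y hy).1 rfl,
            ind_of_mem (Set.mem_insert _ _)]
          simp only [κ]
          generalize (wdeg G w₀ v : ZMod 2) = t
          generalize c v = a
          revert t a; decide
        · obtain ⟨h1, h2, h3⟩ := (hQ v h hvs).resolve_left fun h' => hv (hQr v h h')
          rw [sum_reachable_of_isolated fun y hy => ((hHQ v h y hy).2.elim (h1 y)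
            fun hy' => h2 y hy' hy.1), h3, hindW, if_neg hvs,
            ind_of_notMem fun h' => F.QP v h h'.1, F.color_QQ hc h hs₀]
          simp only [κ]
          generalize (wdeg G w₀ s₀ : ZMod 2) = t
          generalize c s₀ = a
          revert t a; decide
      · by_cases hvo : v ∈ ownSet G P s₀
        · simp only [reachable_eq_part h hPH hHG fun y hy => hHP y (mem_ownSet_of_mem_part hvo hy)]
          obtain ⟨n, p, hp, hpart, h0, hL, hn⟩ := hB.exists_path F hs₀ hvo
          have h1 := hp.one_le
          have hsp := hp.sum_part hc hpart hn (κ + 1) w₀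
          have hn1 : p n ∈ part G P v := hpart ▸ ⟨n, h1, le_rfl, rfl⟩
          have h3 := hown (p 1) (hp.mem 1 le_rfl h1) (p n) (mem_ownSet_of_mem_part hvo hn1) _ hL
            (h0 ▸ hp.adj 0 (by omega)) (hp.adj n le_rfl)
          rw [h0, ← Nat.cast_add, h3] at hsp
          refine Eq.trans (Finset.sum_congr rfl fun y hy => ?_) (hsp.trans (by decide))
          rw [ind_of_mem (Set.mem_insert_of_mem _
            (mem_ownSet_of_mem_part hvo (Finset.mem_filter.1 hy).2))]
          ring
        · exfalso
          obtain ⟨n, p, hp, hpart, h0, hL, hn⟩ := hB v h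
          have h1 := hp.one_le
          have hv1 : p 1 ∈ part G P v := hpart ▸ ⟨1, le_rfl, h1, rfl⟩
          have hne0 : p 0 ≠ s₀ := fun h' => hvo ⟨h, p 1, hv1, h' ▸ hp.adj 0 (by omega)⟩
          have hP1 := hp.mem 1 le_rfl h1
          have hr := (hQ _ h0 hne0).resolve_right fun h' => h'.2.1 _ hP1 (hp.adj 0 (by omega))
          have hadj : H.Adj (p 0) (p 1) :=
            ⟨hp.adj 0 (by omega), Or.inr (Or.inr (Or.inl (Or.inr ⟨h0, hne0, hP1⟩)))⟩
          exact hv (((hQr _ h0 hr).trans hadj.reachable).trans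
            (SimpleGraph.Reachable.mono hPH (SimpleGraph.Reachable.symm hv1))))
  have hws₀ : wdeg G w s₀ = wdeg G w₀ s₀ :=
    wdeg_congr fun y _ => hwH _ fun h => (hHQ s₀ hs₀ y h).1 rfl
  refine good_of_parity hc hw κ W hwp fun x y hxy hx hy he => ?_
  rcases hx with rfl | hx
  · exfalso
    rcases F.Q_nbr hc hs₀ hxy with hyN | hyP
    · refine hne w hw (fun u hu y _ hRy => hwH _ fun h => hRy (hHN u hu y h))
        (fun e => (hw1 e).1) y hyN (he.symm.trans hws₀)
    · exact hy (Or.inr ⟨hyP, y, mem_part_self y, hxy⟩)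
  · have hyP : y ∉ P := fun hyP => hy (Or.inr (mem_ownSet_of_mem_part hx
      (SimpleGraph.Adj.reachable ⟨hxy, hx.1, hyP⟩)))
    have hyN : y ∈ N := by
      obtain ⟨n, p, hp, hpart, h0, hL, -⟩ := hB.exists_path F hs₀ hx
      obtain ⟨i, hi, hin, rfl⟩ : x ∈ interior p n := hpart ▸ mem_part_self x
      rcases hp.exit hi hin hyP hxy with ⟨-, h⟩ | ⟨-, h⟩
      · exact absurd (Or.inl (h.trans h0)) hy
      · exact h ▸ hL
    obtain ⟨h1, q, hqP, hqy, hxq, hnb⟩ := F.exists_partner hx.1 hxy hyP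
    left
    refine ⟨q, hqy, hxq, ?_⟩
    by_contra h2
    have h3 := (hw s(x, q) hxq.adj).2
    rw [wdeg_pair hqy.symm hnb] at he
    obtain ⟨k, hk, hyk⟩ := F.N_adj_K y hyN
    have hys := (F.Q_adj_N s₀ hs₀ y hyN).symm
    have hxs₀ : x ≠ s₀ := fun h => hs₀own (h ▸ hx)
    have hxk : x ≠ k := fun h => F.KP k hk (h ▸ hx.1)
    have hsk : s₀ ≠ k := fun h => F.KQ k hk (h ▸ hs₀)
    have h4 := add_add_le_wdeg (w := w) hxy.symm hys hyk hxs₀ hxk hsk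
    have h5 := (hw s(y, k) hyk).1
    have h6 := hm s(y, k)
    have h7 := (hw s(y, s₀) hys).1
    have h8 := hm s(y, s₀)
    have h9 : w s(y, s₀) = w₀ s(y, s₀) :=
      hwH _ fun h => (hHQ s₀ hs₀ y (SimpleGraph.Adj.symm h)).1 rfl
    have h10 : w s(y, x) = w s(x, y) := by rw [Sym2.eq_swap]
    rcases hthree x hx y hyN hxy with h | ⟨s, hs, hss₀⟩
    · rw [Sym2.eq_swap] at h
      omega
    · have hys' := (F.Q_adj_N s hs y hyN).symm
      have hxs : x ≠ s := fun h => F.QP s hs (h ▸ hx.1)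
      have hks : k ≠ s := fun h => F.KQ k hk (h ▸ hs)
      have h11 := sum_le_wdeg (G := G) (w := w) (v := y) {x, s₀, k, s} (by
        simp only [Finset.mem_insert, Finset.mem_singleton]
        rintro t (rfl | rfl | rfl | rfl) <;> first | assumption | exact hxy.symm)
      rw [Finset.sum_insert (by simp [hxs₀, hxk, hxs]), Finset.sum_insert (by
        simp [hsk, hss₀.symm]), Finset.sum_pair hks] at h11
      have h12 := (hw s(y, s) hys').1
      have h13 := hm s(y, s)
      omega

end OddCactus

namespace OddCactus

variable {V : Type} {G : SimpleGraph V} {m : Sym2 V → ℕ} {c : V → ZMod 2} {K N Q P : Set V}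

/-- A weighting with prescribed values at the edges between `N` and its complement, and at the
edges outside `N`. -/
theorem exists_weighting (N : Set V) (g : V → V → ℕ) (h : Sym2 V → ℕ) :
    ∃ w : Sym2 V → ℕ, (∀ u ∈ N, ∀ y, y ∉ N → w s(u, y) = g u y) ∧
      ∀ x, x ∉ N → ∀ y, y ∉ N → w s(x, y) = h s(x, y) := by
  refine ⟨Sym2.lift ⟨fun x y => if x ∈ N then (if y ∈ N then 0 else g x y) else
    if y ∈ N then g y x else h s(x, y), fun x y => ?_⟩, fun u hu y hy => ?_, fun x hx y hy => ?_⟩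
  · dsimp only
    rw [Sym2.eq_swap]
    split_ifs <;> rfl
  · simp [hu, hy]
  · simp [hx, hy]

theorem exists_distribution (S : Finset V) (μ : V → ℕ) {T : ℕ} (h1 : ∑ y ∈ S, μ y ≤ T)
    (h2 : T ≤ 2 * ∑ y ∈ S, μ y) :
    ∃ f : V → ℕ, (∀ y, μ y ≤ f y ∧ f y ≤ 2 * μ y) ∧ ∑ y ∈ S, f y = T := by
  induction T, h1 using Nat.le_induction with
  | base => exact ⟨μ, fun y => ⟨le_rfl, by omega⟩, rfl⟩
  | succ T _ ih =>
    obtain ⟨f, hf, hfT⟩ := ih (by omega)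
    have hlt : ∑ y ∈ S, f y < ∑ y ∈ S, 2 * μ y := by
      rw [← Finset.mul_sum]
      omega
    obtain ⟨y, hy, hfy⟩ := Finset.exists_lt_of_sum_lt hlt
    refine ⟨Function.update f y (f y + 1), fun x => ?_, ?_⟩
    · by_cases hx : x = y
      · subst hx
        rw [Function.update_self]
        have := hf x
        omega
      · rw [Function.update_of_ne hx]
        exact hf x
    · rw [Finset.sum_update_of_mem hy, ← hfT, Finset.sum_eq_add_sum_sdiff_singleton_of_mem hy f]
      omega

variable [Fintype V]

/-- The number of neighbours of `u` in the components attached to `s`. -/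
noncomputable def ownDeg (G : SimpleGraph V) (P : Set V) (s u : V) : ℕ :=
  (Finset.univ.filter fun y => G.Adj u y ∧ y ∈ ownSet G P s).card

/-- The part of the degree of `u` not coming from `s` and the components attached to `s`. -/
noncomputable def restDeg (G : SimpleGraph V) (P : Set V) (s : V) (w : Sym2 V → ℕ) (u : V) : ℕ :=
  ∑ y with G.Adj u y ∧ y ≠ s ∧ y ∉ ownSet G P s, w s(u, y)

theorem wdeg_eq_restDeg {s u : V} (hs : s ∉ P) (hus : G.Adj u s) {w : Sym2 V → ℕ} {ε : ℕ}
    (hw : ∀ y ∈ ownSet G P s, G.Adj u y → w s(u, y) = ε) :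
    wdeg G w u = w s(u, s) + ε * ownDeg G P s u + restDeg G P s w u := by
  have hso : s ∉ ownSet G P s := fun h => hs h.1
  have h1 : ε * ownDeg G P s u =
      ∑ y with G.Adj u y ∧ y ∈ ownSet G P s, w s(u, y) := by
    rw [ownDeg, mul_comm, ← smul_eq_mul, ← Finset.sum_const]
    refine Finset.sum_congr rfl fun y hy => ?_
    rw [Finset.mem_filter] at hy
    exact (hw y hy.2.2 hy.2.1).symm
  have h2 : w s(u, s) = ∑ y, if y = s then w s(u, y) else 0 := by simp
  rw [h1, h2, restDeg, wdeg_eq_sum_ite, Finset.sum_filter, Finset.sum_filter,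
    ← Finset.sum_add_distrib, ← Finset.sum_add_distrib]
  refine Finset.sum_congr rfl fun y _ => ?_
  by_cases hy : y = s
  · subst hy
    simp [hus, hso]
  · by_cases hyo : y ∈ ownSet G P s <;> simp [hy, hyo]

namespace Frame

theorem sum_ownDeg (F : Frame G m K N Q P) (hB : Bridged G N Q P) {s : V} (hs : s ∈ Q) :
    ∑ u with u ∈ N, ownDeg G P s u = (Finset.univ.filter fun a => a ∈ P ∧ G.Adj s a).card := by
  let B : V → Finset V := fun u => Finset.univ.filter fun y => G.Adj u y ∧ y ∈ ownSet G P s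
  have h1 : ∑ u with u ∈ N, ownDeg G P s u =
      ((Finset.univ.filter fun u => u ∈ N).biUnion B).card := by
    rw [Finset.card_biUnion]
    · rfl
    · intro u hu u' hu' hne
      rw [Finset.mem_coe, Finset.mem_filter] at hu hu'
      rw [Function.onFun, Finset.disjoint_left]
      intro y hy hy'
      simp only [B, Finset.mem_filter] at hy hy'
      exact hne (F.eq_of_adj hy.2.2.1 hy.2.1.symm (F.NP u hu.2) hy'.2.1.symm (F.NP u' hu'.2))
  have hmem : ∀ b, b ∈ (Finset.univ.filter fun u => u ∈ N).biUnion B ↔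
      b ∈ ownSet G P s ∧ ∃ u ∈ N, G.Adj b u := by
    intro b
    simp only [B, Finset.mem_biUnion, Finset.mem_filter, Finset.mem_univ, true_and]
    constructor
    · rintro ⟨u, hu, h, hb⟩
      exact ⟨hb, u, hu, h.symm⟩
    · rintro ⟨hb, u, hu, h⟩
      exact ⟨u, hu, h.symm, hb⟩
  have key : ∀ x ∈ ownSet G P s, ∃ a b, a ∈ part G P x ∧ b ∈ part G P x ∧ G.Adj s a ∧
      (∃ u ∈ N, G.Adj b u) ∧ (∀ a' ∈ part G P x, G.Adj s a' → a' = a) ∧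
      ∀ b' ∈ part G P x, ∀ u ∈ N, G.Adj b' u → b' = b := by
    intro x hx
    obtain ⟨n, p, hp, hpart, rfl, hL, -⟩ := hB.exists_path F hs hx
    have h1 := hp.one_le
    rw [hpart]
    refine ⟨p 1, p n, ⟨1, le_rfl, h1, rfl⟩, ⟨n, h1, le_rfl, rfl⟩, hp.adj 0 (by omega),
      ⟨_, hL, hp.adj n le_rfl⟩, ?_, ?_⟩
    · rintro _ ⟨i, hi, hin, rfl⟩ h
      rcases hp.exit hi hin (F.QP _ hs) h.symm with ⟨rfl, -⟩ | ⟨-, h⟩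
      · rfl
      · exact absurd (h ▸ hs) (F.NQ _ hL)
    · rintro _ ⟨i, hi, hin, rfl⟩ u hu h
      rcases hp.exit hi hin (F.NP _ hu) h with ⟨-, h⟩ | ⟨rfl, -⟩
      · exact absurd hs (F.NQ _ (h ▸ hu))
      · rfl
  rw [h1]
  refine le_antisymm
    (Finset.card_le_card_of_forall_subsingleton (fun b a => a ∈ part G P b) ?_ ?_)
    (Finset.card_le_card_of_forall_subsingleton (fun a b => b ∈ part G P a) ?_ ?_)
  · intro b hb
    obtain ⟨hb, -⟩ := (hmem b).1 hb
    obtain ⟨a, -, ha, -, hsa, -⟩ := key b hb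
    exact ⟨a, by simpa using ⟨part_subset hb.1 ha, hsa⟩, ha⟩
  · rintro a ha b ⟨hb, hab⟩ b' ⟨hb', hab'⟩
    obtain ⟨hb, u, hu, hbu⟩ := (hmem b).1 hb
    obtain ⟨hb', u', hu', hbu'⟩ := (hmem b').1 hb'
    obtain ⟨-, b'', -, -, -, -, -, h⟩ := key b hb
    have he := (part_eq_of_mem hab).trans (part_eq_of_mem hab').symm
    rw [h b (mem_part_self b) u hu hbu, h b' (he ▸ mem_part_self b') u' hu' hbu']
  · intro a ha
    simp only [Finset.mem_filter, Finset.mem_univ, true_and] at ha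
    have hao : a ∈ ownSet G P s := ⟨ha.1, a, mem_part_self a, ha.2⟩
    obtain ⟨-, b, -, hb, -, hbu, -⟩ := key a hao
    exact ⟨b, (hmem b).2 ⟨mem_ownSet_of_mem_part hao hb, hbu⟩, hb⟩
  · rintro b hb a ⟨ha, hab⟩ a' ⟨ha', hab'⟩
    simp only [Finset.mem_filter, Finset.mem_univ, true_and] at ha ha'
    obtain ⟨a'', -, -, -, -, -, h, -⟩ := key a ⟨ha.1, a, mem_part_self a, ha.2⟩
    have he := (part_eq_of_mem hab).trans (part_eq_of_mem hab').symm
    rw [h a (mem_part_self a) ha.2, h a' (he ▸ mem_part_self a') ha'.2]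

theorem wdeg_center (F : Frame G m K N Q P) (hc : IsTwoColoring G c) (hB : Bridged G N Q P)
    {s : V} (hs : s ∈ Q) {w : Sym2 V → ℕ} {ε : ℕ}
    (hw : ∀ a ∈ P, G.Adj s a → w s(s, a) = ε) :
    wdeg G w s = ∑ u with u ∈ N, (w s(s, u) + ε * ownDeg G P s u) := by
  rw [Finset.sum_add_distrib, ← Finset.mul_sum, F.sum_ownDeg hB hs, mul_comm, ← smul_eq_mul,
    ← Finset.sum_const, wdeg]
  have h : Finset.univ.filter (fun y => G.Adj s y) = Finset.univ.filter (fun u => u ∈ N) ∪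
      Finset.univ.filter (fun a => a ∈ P ∧ G.Adj s a) := by
    ext y
    simp only [Finset.mem_union, Finset.mem_filter, Finset.mem_univ, true_and]
    constructor
    · intro hy
      exact (F.Q_nbr hc hs hy).imp_right fun h => ⟨h, hy⟩
    · rintro (hy | hy)
      · exact F.Q_adj_N s hs y hy
      · exact hy.2
  rw [h, Finset.sum_union]
  · congr 1
    refine Finset.sum_congr rfl fun a ha => ?_
    rw [Finset.mem_filter] at ha
    exact hw a ha.2.1 ha.2.2
  · rw [Finset.disjoint_left]
    intro y hy hy'
    rw [Finset.mem_filter] at hy hy'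
    exact F.NP y hy.2 hy'.2.1

end Frame

end OddCactus

namespace OddCactus

variable {V : Type} [Fintype V] {G : SimpleGraph V} {m : Sym2 V → ℕ} {c : V → ZMod 2}
  {K N Q P : Set V}

theorem restDeg_congr {s u : V} {w w' : Sym2 V → ℕ}
    (h : ∀ y, G.Adj u y → y ≠ s → y ∉ ownSet G P s → w s(u, y) = w' s(u, y)) :
    restDeg G P s w u = restDeg G P s w' u := by
  refine Finset.sum_congr rfl fun y hy => ?_
  obtain ⟨-, h1, h2, h3⟩ := Finset.mem_filter.1 hy
  exact h y h1 h2 h3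

theorem restDeg_le {s u : V} {w w' : Sym2 V → ℕ} {B : Finset V}
    (h : ∀ y, G.Adj u y → y ≠ s → y ∉ ownSet G P s →
      w s(u, y) ≤ w' s(u, y) + if y ∈ B then 1 else 0) :
    restDeg G P s w u ≤ restDeg G P s w' u + B.card := by
  have hB : ∑ y with G.Adj u y ∧ y ≠ s ∧ y ∉ ownSet G P s, (if y ∈ B then 1 else 0) ≤ B.card := by
    rw [← Finset.sum_filter, Finset.sum_const, smul_eq_mul, mul_one]
    exact Finset.card_le_card fun y hy => (Finset.mem_filter.1 hy).2
  refine le_trans ?_ (Nat.add_le_add_left hB _)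
  rw [restDeg, restDeg, ← Finset.sum_add_distrib]
  refine Finset.sum_le_sum fun y hy => ?_
  obtain ⟨-, h1, h2, h3⟩ := Finset.mem_filter.1 hy
  exact h y h1 h2 h3

/-- Weights `a` on the edges from `s` to `N`, total weights `T` on the other edges at `N`, and
weights `ε` and `3 - ε` on the end edges of the components attached to `s`. -/
theorem Frame.good_of_weights (F : Frame G m K N Q P) (hG : G.Connected)
    (hc : IsTwoColoring G c) (hm : ∀ e, 1 ≤ m e) (hbad : ¬ Good G m) (hB : Bridged G N Q P)
    {s : V} (hs : s ∈ Q) (L : Set V) (hLQ : (∃ t ∈ Q, t ≠ s) → ∃ u ∈ N, u ∈ L)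
    (a T : V → ℕ) {ε ε' z : ℕ} (hε : 1 ≤ ε) (hε' : 1 ≤ ε') (hεε' : ε + ε' = 3)
    (ha : ∀ u ∈ N, m s(s, u) ≤ a u ∧ a u ≤ 2 * m s(s, u))
    (hz : z = ∑ u with u ∈ N, (a u + ε * ownDeg G P s u))
    (hT : ∀ u ∈ N, u ∉ L → restDeg G P s m u ≤ T u ∧ T u ≤ 2 * restDeg G P s m u ∧
      (a u + ε' * ownDeg G P s u + T u) % 2 = z % 2 ∧ a u + ε' * ownDeg G P s u + T u ≠ z)
    (hL : ∀ u ∈ N, u ∈ L → ∀ t, restDeg G P s m u ≤ t →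
      t ≤ restDeg G P s m u + (Finset.univ.filter fun t => t ∈ Q).card →
      a u + ε' * ownDeg G P s u + t ≠ z)
    (hthree : (∀ u ∈ N, ownDeg G P s u ≠ 0 → 2 ≤ a u) ∨ ∃ t ∈ Q, t ≠ s) : Good G m := by
  have hsN : s ∉ N := fun h => F.NQ s h hs
  have hso : s ∉ ownSet G P s := fun h => F.QP s hs h.1
  have hdist : ∀ u, ∃ f : V → ℕ, (∀ y, m s(u, y) ≤ f y ∧ f y ≤ 2 * m s(u, y)) ∧
      (u ∈ N → u ∉ L → ∑ y with G.Adj u y ∧ y ≠ s ∧ y ∉ ownSet G P s, f y = T u) ∧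
      (u ∈ L → ∀ y, f y = m s(u, y)) := by
    intro u
    by_cases hu : u ∈ N ∧ u ∉ L
    · obtain ⟨h1, h2, -⟩ := hT u hu.1 hu.2
      obtain ⟨f, hf, hfT⟩ := exists_distribution _ (fun y => m s(u, y)) h1 h2
      exact ⟨f, hf, fun _ _ => hfT, fun h => absurd h hu.2⟩
    · exact ⟨fun y => m s(u, y), fun y => ⟨le_rfl, Nat.le_mul_of_pos_left _ two_pos⟩,
        fun h1 h2 => absurd ⟨h1, h2⟩ hu,
        fun _ _ => rfl⟩
  choose f hf hfT hfL using hdist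
  obtain ⟨w₀, hwN, hwO⟩ := exists_weighting N
    (fun u y => if y = s then a u else if y ∈ ownSet G P s then ε' else f u y)
    (fun e => if ∃ x ∈ P, e = s(s, x) then ε else m e)
  have hmo : ∀ x ∈ P, ∀ y, y ∉ P → G.Adj x y → m s(x, y) = 1 := fun x hx y hy h =>
    (F.exists_partner hx h hy).1
  have hNN : ∀ u ∈ N, ∀ y, G.Adj u y → y ∉ N := fun u hu y h hy =>
    not_adj_of_color hc (F.color_NN hc hu hy) h
  have hadmN : ∀ u ∈ N, ∀ y, G.Adj u y → m s(u, y) ≤ w₀ s(u, y) ∧ w₀ s(u, y) ≤ 2 * m s(u, y) := by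
    intro u hu y h
    rw [hwN u hu y (hNN u hu y h)]
    split_ifs with h1 h2
    · subst h1
      rw [Sym2.eq_swap]
      exact ha u hu
    · have := hmo y h2.1 u (F.NP u hu) h.symm
      rw [Sym2.eq_swap] at this
      omega
    · exact hf u y
  have hw₀ : Admissible G m w₀ := by
    intro e
    induction e using Sym2.ind with | _ x y => ?_
    intro h
    rw [SimpleGraph.mem_edgeSet] at h
    by_cases hx : x ∈ N
    · exact hadmN x hx y h
    · by_cases hy : y ∈ N
      · rw [Sym2.eq_swap]
        exact hadmN y hy x h.symm
      · rw [hwO x hx y hy]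
        split_ifs with h1
        · obtain ⟨p, hp, he⟩ := h1
          have h2 : G.Adj s p := by
            rw [← SimpleGraph.mem_edgeSet, ← he]
            exact h
          have := hmo p hp s (F.QP s hs) h2.symm
          rw [he]
          rw [Sym2.eq_swap] at this
          omega
        · omega
  have hsN₀ : ∀ u ∈ N, w₀ s(u, s) = a u := fun u hu => by rw [hwN u hu s hsN, if_pos rfl]
  have hown₀ : ∀ u ∈ N, ∀ y ∈ ownSet G P s, w₀ s(u, y) = ε' := fun u hu y hy => by
    rw [hwN u hu y fun h => F.NP y h hy.1, if_neg (fun h : y = s => hso (h ▸ hy)), if_pos hy]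
  have hrest₀ : ∀ u ∈ N, restDeg G P s w₀ u =
      ∑ y with G.Adj u y ∧ y ≠ s ∧ y ∉ ownSet G P s, f u y := by
    intro u hu
    refine Finset.sum_congr rfl fun y hy => ?_
    obtain ⟨-, h1, h2, h3⟩ := Finset.mem_filter.1 hy
    rw [hwN u hu y (hNN u hu y h1), if_neg h2, if_neg h3]
  have hsP₀ : ∀ x ∈ P, w₀ s(s, x) = ε := fun x hx => by
    rw [hwO s hsN x fun h => F.NP x h hx, if_pos ⟨x, hx, rfl⟩]
  have hz₀ : wdeg G w₀ s = z := by
    rw [F.wdeg_center hc hB hs fun x hx _ => hsP₀ x hx, hz]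
    refine Finset.sum_congr rfl fun u hu => ?_
    rw [Sym2.eq_swap, hsN₀ u (Finset.mem_filter.1 hu).2]
  choose! k hkK hk using F.N_adj_K
  let R : V → V → Prop := fun u y => u ∈ N ∧ u ∈ L ∧ (y = k u ∨ (y ∈ Q ∧ y ≠ s))
  have hRk : ∀ u ∈ N, u ∈ L → ∃ y ∈ K, G.Adj u y ∧ R u y := fun u hu huL =>
    ⟨k u, hkK u hu, hk u hu, hu, huL, Or.inl rfl⟩
  refine F.good_of_center hG hc hm hbad hB hs hw₀ R ?_ ?_ ?_ ?_ ?_ ?_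
  · rintro u y - ⟨hu, -, rfl | hy⟩
    · exact ⟨hu, Or.inl (hkK u hu)⟩
    · exact ⟨hu, Or.inr hy⟩
  · intro u hu
    by_cases huL : u ∈ L
    · exact Or.inl (hRk u hu huL)
    · refine Or.inr ⟨fun y h => huL h.2.1, ?_⟩
      rw [wdeg_eq_restDeg (F.QP s hs) (F.Q_adj_N s hs u hu).symm fun y hy _ => hown₀ u hu y hy,
        hsN₀ u hu, hrest₀ u hu, hfT u hu huL, hz₀, ZMod.natCast_eq_natCast_iff]
      exact (hT u hu huL).2.2.1
  · intro t ht hts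
    obtain ⟨u, hu, huL⟩ := hLQ ⟨t, ht, hts⟩
    exact Or.inl ⟨u, hu, ⟨hu, huL, Or.inr ⟨ht, hts⟩⟩, hRk u hu huL⟩
  · intro x hx b hb u hu _ _
    rw [hsP₀ x hx, Sym2.eq_swap, hown₀ u hu b hb, hεε']
  · intro b hb u hu hbu
    refine hthree.imp_left fun h => ?_
    rw [Sym2.eq_swap, hsN₀ u hu]
    refine h u hu (Finset.card_ne_zero_of_mem (a := b) ?_)
    simpa using ⟨hbu.symm, hb⟩
  · intro w hw hwR hw1 u hu
    have hRs : ¬ R u s := by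
      rintro ⟨-, -, h | h⟩
      · exact F.KQ s (h ▸ hkK u hu) hs
      · exact h.2 rfl
    have hus := (F.Q_adj_N s hs u hu).symm
    rw [wdeg_eq_restDeg (F.QP s hs) hus (ε := ε') fun y hy huy => ?_, hwR u hu s hus hRs,
      hsN₀ u hu, hz₀]
    · by_cases huL : u ∈ L
      · refine hL u hu huL _ ?_ ?_
        · refine Finset.sum_le_sum fun y hy => (hw _ ?_).1
          exact (Finset.mem_filter.1 hy).2.1
        · have hcard : (insert (k u) ((Finset.univ.filter fun t => t ∈ Q).erase s)).card ≤
              (Finset.univ.filter fun t => t ∈ Q).card := by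
            refine (Finset.card_insert_le _ _).trans ?_
            rw [Finset.card_erase_add_one (by simpa using hs)]
          refine (restDeg_le (B := insert (k u) ((Finset.univ.filter fun t => t ∈ Q).erase s))
            fun y h1 h2 h3 => ?_).trans (Nat.add_le_add_left hcard _)
          have h4 : w₀ s(u, y) = m s(u, y) := by
            rw [hwN u hu y (hNN u hu y h1), if_neg h2, if_neg h3, hfL u huL]
          rw [← h4]
          split_ifs with h5
          · exact hw1 _
          · refine (hwR u hu y h1 fun h => h5 ?_).le
            rcases h.2.2 with h | h
            · exact Finset.mem_insert.2 (Or.inl h)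
            · simpa using Or.inr ⟨h.2, h.1⟩
      · rw [restDeg_congr fun y h1 _ _ => hwR u hu y h1 fun h => huL h.2.1, hrest₀ u hu,
          hfT u hu huL]
        exact (hT u hu huL).2.2.2
    · rw [hwR u hu y huy, hown₀ u hu y hy]
      rintro ⟨-, -, rfl | h⟩
      · exact F.KP _ (hkK u hu) hy.1
      · exact F.QP y h.1 hy.1

end OddCactus

namespace OddCactus

variable {V : Type} {G : SimpleGraph V} {m : Sym2 V → ℕ} {c : V → ZMod 2} {K N Q P : Set V}

theorem exists_eq_insert_of_sum_eq_add_one {S : Finset V} {f : V → ℕ} (hf : ∀ x ∈ S, 1 ≤ f x)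
    {u : V} (hu : u ∈ S) (h : ∑ x ∈ S, f x = f u + 1) :
    ∃ u' ∈ S, u' ≠ u ∧ f u' = 1 ∧ ∀ x ∈ S, x = u ∨ x = u' := by
  rw [← Finset.add_sum_erase S f hu, Nat.add_left_cancel_iff] at h
  have hcard : (S.erase u).card ≤ ∑ x ∈ S.erase u, f x := by
    rw [Finset.card_eq_sum_ones]
    exact Finset.sum_le_sum fun x hx => hf x (Finset.mem_of_mem_erase hx)
  have hne : (S.erase u).Nonempty := by
    rw [Finset.nonempty_iff_ne_empty]
    intro h0
    simp [h0] at h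
  obtain ⟨u', hu'⟩ := Finset.card_eq_one.1 (le_antisymm (h ▸ hcard) hne.card_pos)
  have hmem : u' ∈ S.erase u := hu' ▸ Finset.mem_singleton_self u'
  rw [hu', Finset.sum_singleton] at h
  refine ⟨u', Finset.mem_of_mem_erase hmem, Finset.ne_of_mem_erase hmem, h, fun x hx => ?_⟩
  by_cases hxu : x = u
  · exact Or.inl hxu
  · exact Or.inr (Finset.mem_singleton.1 (hu' ▸ Finset.mem_erase.2 ⟨hxu, hx⟩))

variable [Fintype V] {s : V}

namespace Frame

theorem wdeg_eq_sum (F : Frame G m K N Q P) (hc : IsTwoColoring G c) (hB : Bridged G N Q P)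
    (hs : s ∈ Q) : wdeg G m s = ∑ u with u ∈ N, (m s(s, u) + ownDeg G P s u) := by
  rw [F.wdeg_center (w := m) (ε := 1) hc hB hs fun a ha h => ?_]
  · simp
  · rw [Sym2.eq_swap]
    exact (F.exists_partner ha h.symm (F.QP s hs)).1

theorem add_add_add_le_wdeg (F : Frame G m K N Q P) (hc : IsTwoColoring G c)
    (hB : Bridged G N Q P) (hs : s ∈ Q) {u u' : V} (hu : u ∈ N) (hu' : u' ∈ N) (hne : u ≠ u') :
    (m s(s, u) + ownDeg G P s u) + (m s(s, u') + ownDeg G P s u') ≤ wdeg G m s := by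
  rw [F.wdeg_eq_sum hc hB hs, ← Finset.sum_pair (f := fun x => m s(s, x) + ownDeg G P s x) hne]
  exact Finset.sum_le_sum_of_subset (by simp [Finset.insert_subset_iff, hu, hu'])

theorem exists_other (F : Frame G m K N Q P) (hc : IsTwoColoring G c) (hm : ∀ e, 1 ≤ m e)
    (hB : Bridged G N Q P) (hs : s ∈ Q) {u : V} (hu : u ∈ N)
    (h : wdeg G m s = m s(s, u) + ownDeg G P s u + 1) :
    ∃ u' ∈ N, u' ≠ u ∧ m s(s, u') = 1 ∧ ownDeg G P s u' = 0 ∧ ∀ x ∈ N, x = u ∨ x = u' := by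
  rw [F.wdeg_eq_sum hc hB hs] at h
  obtain ⟨u', hu', hne, h1, hN⟩ := exists_eq_insert_of_sum_eq_add_one
    (fun x _ => (hm s(s, x)).trans (Nat.le_add_right _ _)) (by simpa using hu) h
  have := hm s(s, u')
  exact ⟨u', by simpa using hu', hne, by omega, by omega, fun x hx => hN x (by simpa using hx)⟩

theorem card_le_restDeg (F : Frame G m K N Q P) (hm : ∀ e, 1 ≤ m e) (hs : s ∈ Q) {u : V}
    (hu : u ∈ N) : (Finset.univ.filter fun t => t ∈ Q).card ≤ restDeg G P s m u := by
  obtain ⟨k, hk, huk⟩ := F.N_adj_K u hu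
  have hcard : (Finset.univ.filter fun t => t ∈ Q).card =
      (insert k ((Finset.univ.filter fun t => t ∈ Q).erase s)).card := by
    rw [Finset.card_insert_of_notMem (by simp [F.KQ k hk]),
      Finset.card_erase_add_one (by simpa using hs)]
  rw [hcard, restDeg, Finset.card_eq_sum_ones]
  refine (Finset.sum_le_sum fun y _ => hm s(u, y)).trans (Finset.sum_le_sum_of_subset ?_)
  intro y hy
  rw [Finset.mem_filter]
  rcases Finset.mem_insert.1 hy with rfl | hy
  · exact ⟨Finset.mem_univ _, huk, fun h : y = s => F.KQ y hk (h ▸ hs), fun h => F.KP y hk h.1⟩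
  · have hyQ : y ∈ Q := by simpa using Finset.mem_of_mem_erase hy
    exact ⟨Finset.mem_univ _, (F.Q_adj_N y hyQ u hu).symm, Finset.ne_of_mem_erase hy,
      fun h => F.QP y hyQ h.1⟩

theorem not_restDeg_eq_one (F : Frame G m K N Q P) (hc : IsTwoColoring G c)
    (hm : ∀ e, 1 ≤ m e) (hB : Bridged G N Q P) (hs : s ∈ Q) {u : V} (hu : u ∈ N) :
    ¬ (restDeg G P s m u = 1 ∧ ownDeg G P s u = 0 ∧ wdeg G m s = m s(s, u) + 1) := by
  rintro ⟨hr, hj, hD⟩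
  obtain ⟨u', hu', hne, h1, hj', hN⟩ := F.exists_other hc hm hB hs hu (by omega)
  have hsu := F.Q_adj_N s hs
  have hP : ∀ a ∈ P, ¬ G.Adj s a := by
    have h0 : ∑ u with u ∈ N, ownDeg G P s u = 0 := by
      refine Finset.sum_eq_zero fun x hx => ?_
      rcases hN x (by simpa using hx) with rfl | rfl <;> assumption
    rw [F.sum_ownDeg hB hs, Finset.card_eq_zero, Finset.filter_eq_empty_iff] at h0
    exact fun a ha h => h0 (Finset.mem_univ a) ⟨ha, h⟩
  refine F.Q_not_thin s hs u ⟨⟨hsu u hu, u', hne, hsu u' hu', h1, fun y hy => ?_⟩, ?_⟩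
  · exact (F.Q_nbr hc hs hy).elim (hN y) fun h => absurd hy (hP y h)
  · rw [restDeg] at hr
    rw [ownDeg, Finset.card_eq_zero, Finset.filter_eq_empty_iff] at hj
    set S := Finset.univ.filter fun y => G.Adj u y ∧ y ≠ s ∧ y ∉ ownSet G P s with hS
    have hcard : S.card ≤ 1 := by
      rw [← hr, Finset.card_eq_sum_ones]
      exact Finset.sum_le_sum fun y _ => hm _
    have hne' : S.Nonempty := by
      rw [Finset.nonempty_iff_ne_empty]
      intro h0
      simp [h0] at hr
    obtain ⟨y, hy⟩ := Finset.card_eq_one.1 (le_antisymm hcard hne'.card_pos)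
    have hyS : y ∈ S := hy ▸ Finset.mem_singleton_self y
    obtain ⟨-, h2, h3, -⟩ := Finset.mem_filter.1 hyS
    rw [hy, Finset.sum_singleton] at hr
    refine ⟨(hsu u hu).symm, y, h3, h2, hr, fun z hz => ?_⟩
    by_cases hzs : z = s
    · exact Or.inl hzs
    · refine Or.inr (Finset.mem_singleton.1 (hy ▸ Finset.mem_filter.2
        ⟨Finset.mem_univ z, hz, hzs, fun h => hj (Finset.mem_univ z) ⟨hz, h⟩⟩))

theorem good_of_rigid (F : Frame G m K N Q P) (hG : G.Connected)
    (hc : IsTwoColoring G c) (hm : ∀ e, 1 ≤ m e) (hbad : ¬ Good G m) (hB : Bridged G N Q P)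
    (hs : s ∈ Q) {u u' : V} (hu : u ∈ N) (hu' : u' ∈ N) (hne : u' ≠ u)
    (hr : restDeg G P s m u = 2) (hj : ownDeg G P s u = 1) (h1 : m s(s, u') = 1)
    (hj' : ownDeg G P s u' = 0) (hN : ∀ x ∈ N, x = u ∨ x = u')
    (h : (∀ t ∈ Q, t = s) ∨ restDeg G P s m u' + (Finset.univ.filter fun t => t ∈ Q).card <
      2 * m s(s, u) + 2) : Good G m := by
  have hM := hm s(s, u)
  have hq : 1 ≤ (Finset.univ.filter fun t => t ∈ Q).card :=
    Finset.card_pos.2 ⟨s, by simpa using hs⟩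
  have hr' := F.card_le_restDeg hm hs hu'
  obtain ⟨T, hT1, hT2, hT3, hT4⟩ : ∃ T, restDeg G P s m u' ≤ T ∧
      T ≤ 2 * restDeg G P s m u' ∧ T % 2 = 0 ∧ T ≠ 2 * m s(s, u) + 2 := by
    by_contra! hcon
    have h0 := hcon (restDeg G P s m u')
    have h1 := hcon (restDeg G P s m u' + 1)
    have h2 := hcon (restDeg G P s m u' + 2)
    have h3 := hcon (restDeg G P s m u' + 3)
    omega
  refine F.good_of_weights hG hc hm hbad hB hs (if ∀ t ∈ Q, t = s then ∅ else {u'}) ?_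
    (fun x => if x = u then 2 * m s(s, u) else 1) (fun x => if x = u then 4 else T)
    (ε := 2) (ε' := 1) (z := 2 * m s(s, u) + 3) (by norm_num) le_rfl rfl ?_ ?_ ?_ ?_ ?_
  · rintro ⟨t, ht, hts⟩
    exact ⟨u', hu', by rw [if_neg fun h => hts (h t ht)]; rfl⟩
  · intro x hx
    rcases hN x hx with rfl | rfl
    · simp only [if_true]; omega
    · simp only [if_neg hne]; omega
  · have hpair : (Finset.univ.filter fun x => x ∈ N) = {u, u'} := by
      ext x
      simp only [Finset.mem_filter, Finset.mem_univ, true_and, Finset.mem_insert,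
        Finset.mem_singleton]
      exact ⟨hN x, by rintro (rfl | rfl) <;> assumption⟩
    rw [hpair, Finset.sum_pair hne.symm]
    simp only [if_true, if_neg hne]
    omega
  · intro x hx _
    rcases hN x hx with rfl | rfl
    · simp only [if_true]; omega
    · simp only [if_neg hne]; omega
  · intro x hx hxL t ht1 ht2
    split_ifs at hxL with hQ
    · exact absurd hxL (Set.notMem_empty x)
    · obtain rfl : x = u' := hxL
      have := h.resolve_left hQ
      simp only [if_neg hne]
      omega
  · left
    intro x hx hxj
    rcases hN x hx with rfl | rfl
    · simp only [if_true]; omega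
    · exact absurd hj' hxj

end Frame

end OddCactus

namespace OddCactus

variable {V : Type} {G : SimpleGraph V} {m : Sym2 V → ℕ} {c : V → ZMod 2} {K N Q P : Set V}
  [Fintype V] {s : V}

namespace Frame

theorem exists_target (F : Frame G m K N Q P) (hc : IsTwoColoring G c)
    (hm : ∀ e, 1 ≤ m e) (hB : Bridged G N Q P) (hs : s ∈ Q) {u u' : V} (hu : u ∈ N)
    (hu' : u' ∈ N) (hne : u ≠ u')
    (h : ¬ (restDeg G P s m u = 2 ∧ ownDeg G P s u = 1 ∧ wdeg G m s = m s(s, u) + 2)) :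
    ∃ T, restDeg G P s m u ≤ T ∧ T ≤ 2 * restDeg G P s m u ∧ T % 2 = ownDeg G P s u % 2 ∧
      2 * m s(s, u) + ownDeg G P s u + T ≠ 2 * wdeg G m s := by
  have h1 := F.not_restDeg_eq_one hc hm hB hs hu
  have h2 := F.add_add_add_le_wdeg (m := m) hc hB hs hu hu' hne
  have h3 := hm s(s, u')
  have h4 := F.card_le_restDeg hm hs hu
  have h5 : 1 ≤ (Finset.univ.filter fun t => t ∈ Q).card :=
    Finset.card_pos.2 ⟨s, by simpa using hs⟩
  by_contra! hcon
  have h6 := hcon (restDeg G P s m u)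
  have h7 := hcon (restDeg G P s m u + 1)
  have h8 := hcon (restDeg G P s m u + 2)
  have h9 := hcon (restDeg G P s m u + 3)
  omega

/-- All edges at `s` are given twice their minimum weight. -/
theorem good_of_double (F : Frame G m K N Q P) (hG : G.Connected)
    (hc : IsTwoColoring G c) (hm : ∀ e, 1 ≤ m e) (hbad : ¬ Good G m) (hB : Bridged G N Q P)
    (hs : s ∈ Q) (L : Set V) (hLQ : (∃ t ∈ Q, t ≠ s) → ∃ u ∈ N, u ∈ L)
    (h : ∀ u ∈ N, u ∉ L → ∃ T, restDeg G P s m u ≤ T ∧ T ≤ 2 * restDeg G P s m u ∧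
      T % 2 = ownDeg G P s u % 2 ∧ 2 * m s(s, u) + ownDeg G P s u + T ≠ 2 * wdeg G m s)
    (hL : ∀ u ∈ N, u ∈ L → 2 * m s(s, u) + ownDeg G P s u + (restDeg G P s m u +
      (Finset.univ.filter fun t => t ∈ Q).card) < 2 * wdeg G m s) : Good G m := by
  choose! T hT using h
  refine F.good_of_weights hG hc hm hbad hB hs L hLQ (fun u => 2 * m s(s, u)) T (ε := 2)
    (ε' := 1) (z := 2 * wdeg G m s) (by norm_num) le_rfl rfl (fun u _ => by omega) ?_ ?_ ?_ ?_
  · rw [F.wdeg_eq_sum hc hB hs, Finset.mul_sum]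
    exact Finset.sum_congr rfl fun u _ => mul_add _ _ _
  · intro u hu huL
    have := hT u hu huL
    omega
  · intro u hu huL t _ ht
    have := hL u hu huL
    omega
  · left
    intro u _ _
    have := hm s(s, u)
    omega

theorem good_of_unique (F : Frame G m K N Q P) (hG : G.Connected)
    (hc : IsTwoColoring G c) (hm : ∀ e, 1 ≤ m e) (hbad : ¬ Good G m) (hB : Bridged G N Q P)
    (hs : s ∈ Q) (hQ : ∀ t ∈ Q, t = s) : Good G m := by
  obtain ⟨u₀, hu₀⟩ := F.N_nonempty
  have hne : ¬ ∃ t ∈ Q, t ≠ s := fun ⟨t, ht, hts⟩ => hts (hQ t ht)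
  by_cases hN : ∀ u ∈ N, u = u₀
  · have hr := (F.card_le_restDeg hm hs hu₀).trans' (Finset.card_pos.2 ⟨s, by simpa using hs⟩)
    refine F.good_of_weights hG hc hm hbad hB hs ∅ (fun h => absurd h hne)
      (fun u => 2 * m s(s, u)) (fun u => restDeg G P s m u +
        (restDeg G P s m u + ownDeg G P s u) % 2) (ε := 1) (ε' := 2)
      (z := 2 * m s(s, u₀) + ownDeg G P s u₀) le_rfl (by norm_num) rfl (fun u _ => by omega)
      ?_ ?_ (fun u _ h => absurd h (Set.notMem_empty u)) ?_
    · have : (Finset.univ.filter fun u => u ∈ N) = {u₀} := by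
        ext x
        simp only [Finset.mem_filter, Finset.mem_univ, true_and, Finset.mem_singleton]
        exact ⟨hN x, by rintro rfl; exact hu₀⟩
      rw [this, Finset.sum_singleton, one_mul]
    · intro u hu _
      obtain rfl := hN u hu
      omega
    · left
      intro u _ _
      have := hm s(s, u)
      omega
  · push Not at hN
    obtain ⟨u₁, hu₁, hne₁⟩ := hN
    by_cases hd : ∃ u ∈ N, restDeg G P s m u = 2 ∧ ownDeg G P s u = 1 ∧
        wdeg G m s = m s(s, u) + 2
    · obtain ⟨u, hu, hr, hj, hD⟩ := hd
      obtain ⟨u', hu', hne', h1, hj', hN⟩ := F.exists_other hc hm hB hs hu (by omega)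
      exact F.good_of_rigid hG hc hm hbad hB hs hu hu' hne' hr hj h1 hj' hN (Or.inl hQ)
    · push Not at hd
      refine F.good_of_double hG hc hm hbad hB hs ∅ (fun h => absurd h hne) (fun u hu _ => ?_)
        fun u _ h => absurd h (Set.notMem_empty u)
      obtain ⟨u', hu', hne'⟩ : ∃ u' ∈ N, u ≠ u' := by
        by_cases h : u = u₀
        · exact ⟨u₁, hu₁, fun h' => hne₁ (h' ▸ h)⟩
        · exact ⟨u₀, hu₀, h⟩
      exact F.exists_target hc hm hB hs hu hu' hne' fun h => hd u hu h.1 h.2.1 h.2.2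

theorem good_or_uniform (F : Frame G m K N Q P) (hG : G.Connected)
    (hc : IsTwoColoring G c) (hm : ∀ e, 1 ≤ m e) (hbad : ¬ Good G m) (hB : Bridged G N Q P)
    (hs : s ∈ Q) (hQ : ∃ t ∈ Q, t ≠ s) : Good G m ∨ ∀ u ∈ N, ownDeg G P s u = 0 ∧
      restDeg G P s m u = (Finset.univ.filter fun t => t ∈ Q).card ∧
      wdeg G m s = m s(s, u) + (Finset.univ.filter fun t => t ∈ Q).card := by
  have hq2 : 2 ≤ (Finset.univ.filter fun t => t ∈ Q).card := by
    obtain ⟨t, ht, hts⟩ := hQ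
    exact Finset.one_lt_card.2 ⟨t, by simpa using ht, s, by simpa using hs, hts⟩
  have hr := fun u hu => F.card_le_restDeg (s := s) (u := u) hm hs hu
  set q := (Finset.univ.filter fun t => t ∈ Q).card with hq
  by_cases hA : ∃ u ∈ N, 2 * m s(s, u) + ownDeg G P s u + (restDeg G P s m u + q) < 2 * wdeg G m s
  · left
    obtain ⟨u₀, hu₀, hlt⟩ := hA
    by_cases hd : ∃ u ∈ N, restDeg G P s m u = 2 ∧ ownDeg G P s u = 1 ∧
        wdeg G m s = m s(s, u) + 2
    · obtain ⟨u, hu, hr, hj, hD⟩ := hd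
      obtain ⟨u', hu', hne', h1, hj', hN⟩ := F.exists_other hc hm hB hs hu (by omega)
      refine F.good_of_rigid hG hc hm hbad hB hs hu hu' hne' hr hj h1 hj' hN (Or.inr ?_)
      rcases hN u₀ hu₀ with rfl | rfl <;> omega
    · push Not at hd
      refine F.good_of_double hG hc hm hbad hB hs {u₀} (fun _ => ⟨u₀, hu₀, rfl⟩)
        (fun u hu huL => ?_) ?_
      · exact F.exists_target hc hm hB hs hu hu₀ huL fun h => hd u hu h.1 h.2.1 h.2.2
      · rintro u - rfl
        exact hlt
  · push Not at hA
    by_cases hC : ∃ u ∈ N, wdeg G m s < m s(s, u) + 2 * ownDeg G P s u + restDeg G P s m u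
    · left
      obtain ⟨u₀, hu₀, hlt⟩ := hC
      have hT : ∀ u ∈ N, u ≠ u₀ → ∃ T, restDeg G P s m u ≤ T ∧ T ≤ 2 * restDeg G P s m u ∧
          (m s(s, u) + 2 * ownDeg G P s u + T) % 2 = wdeg G m s % 2 ∧
          m s(s, u) + 2 * ownDeg G P s u + T ≠ wdeg G m s := by
        intro u hu hne
        have h1 := F.add_add_add_le_wdeg (m := m) hc hB hs hu hu₀ hne
        have h2 := hr u hu
        have h3 := hA u hu
        by_contra! hcon
        have h6 := hcon (restDeg G P s m u)
        have h7 := hcon (restDeg G P s m u + 1)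
        have h8 := hcon (restDeg G P s m u + 2)
        have h9 := hcon (restDeg G P s m u + 3)
        omega
      choose! T hT using hT
      refine F.good_of_weights hG hc hm hbad hB hs {u₀} (fun _ => ⟨u₀, hu₀, rfl⟩)
        (fun u => m s(s, u)) T (ε := 1) (ε' := 2) (z := wdeg G m s) le_rfl (by norm_num) rfl
        (fun u _ => by omega) ?_ ?_ ?_ (Or.inr hQ)
      · simp only [one_mul]
        exact F.wdeg_eq_sum hc hB hs
      · exact fun u hu huL => hT u hu huL
      · rintro u - rfl t ht _
        omega
    · push Not at hC
      right
      intro u hu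
      have := hA u hu
      have := hC u hu
      have := hr u hu
      omega

end Frame

end OddCactus

namespace OddCactus

variable {V : Type} {G : SimpleGraph V} {m : Sym2 V → ℕ} {c : V → ZMod 2} {K N Q P : Set V}
  [Fintype V] {s : V}

namespace Frame

theorem good_of_switch (F : Frame G m K N Q P) (hG : G.Connected)
    (hc : IsTwoColoring G c) (hm : ∀ e, 1 ≤ m e) (hbad : ¬ Good G m) (hP : P = ∅)
    (hs : s ∈ Q) (B : V → Finset V) (hBK : ∀ u ∈ N, ∃ k ∈ K, G.Adj u k ∧ k ∈ B u)
    (hBQ : ∀ u ∈ N, ∀ y ∈ B u, y ∈ K ∨ (y ∈ Q ∧ y ≠ s))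
    (hcard : ∀ u ∈ N, 2 * m s(s, u) + restDeg G P s m u + (B u).card < 2 * wdeg G m s)
    (hQ : ∀ t ∈ Q, t ≠ s → (∃ u ∈ N, t ∈ B u) ∨
      ((∀ u ∈ N, t ∉ B u) ∧ wdeg G m t % 2 = 1)) : Good G m := by
  subst hP
  have hB : Bridged G N Q ∅ := fun x hx => absurd hx (Set.notMem_empty x)
  have hown : ∀ b, b ∉ ownSet G ∅ s := fun b hb => hb.1
  have hsB : ∀ u ∈ N, s ∉ B u := fun u hu h =>
    (hBQ u hu s h).elim (fun h => F.KQ s h hs) fun h => h.2 rfl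
  have hw₀ : ∀ x, x ≠ s → ∀ y, y ≠ s → doubleAt m {s} s(x, y) = m s(x, y) :=
    fun x hx y hy => doubleAt_of_notMem hx hy
  have hz : wdeg G (doubleAt m {s}) s = 2 * wdeg G m s := wdeg_doubleAt rfl
  refine F.good_of_center hG hc hm hbad hB hs (admissible_doubleAt (Q := {s}))
    (fun u y => u ∈ N ∧ y ∈ B u) ?_ ?_ ?_ (fun a ha => absurd ha (Set.notMem_empty a))
    (fun b hb => absurd hb (hown b)) ?_
  · rintro u y - ⟨hu, hy⟩
    exact ⟨hu, hBQ u hu y hy⟩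
  · intro u hu
    obtain ⟨k, hk, huk, hkB⟩ := hBK u hu
    exact Or.inl ⟨k, hk, huk, hu, hkB⟩
  · intro t ht hts
    refine (hQ t ht hts).imp ?_ ?_
    · rintro ⟨u, hu, htu⟩
      obtain ⟨k, hk, huk, hkB⟩ := hBK u hu
      exact ⟨u, hu, ⟨hu, htu⟩, k, hk, huk, hu, hkB⟩
    · rintro ⟨h1, h2⟩
      refine ⟨fun y h => h1 y h.1 h.2, fun y hy => absurd hy (Set.notMem_empty y), ?_⟩
      have ht₀ : wdeg G (doubleAt m {s}) t = wdeg G m t := wdeg_congr fun y hy =>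
        hw₀ t hts y fun h => not_adj_of_color hc (F.color_QQ hc ht hs) (h ▸ hy)
      rw [hz, ht₀, ← Nat.cast_add_one, ZMod.natCast_eq_natCast_iff, Nat.ModEq]
      omega
  · intro w hw hwR hw1 u hu
    have hus := (F.Q_adj_N s hs u hu).symm
    have hne : u ≠ s := fun h => F.NQ u hu (h ▸ hs)
    have h1 : restDeg G ∅ s w u ≤ restDeg G ∅ s m u + (B u).card := by
      refine restDeg_le fun y hy hys _ => ?_
      rw [← hw₀ u hne y hys]
      split_ifs with h
      · exact hw1 _
      · exact (hwR u hu y hy fun h' => h h'.2).le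
    have h2 := hcard u hu
    have h3 : ownDeg G ∅ s u = 0 := by simp [ownDeg, hown]
    rw [hz, wdeg_eq_restDeg (ε := 1) (Set.notMem_empty s) hus fun y hy _ => absurd hy (hown y),
      hwR u hu s hus fun h => hsB u hu h.2, Sym2.eq_swap, doubleAt_of_mem (Set.mem_singleton s)]
    omega

theorem good_of_uniform (F : Frame G m K N Q P) (hG : G.Connected)
    (hc : IsTwoColoring G c) (hm : ∀ e, 1 ≤ m e) (hbad : ¬ Good G m) (hB : Bridged G N Q P)
    (hs : s ∈ Q) (hQ : ∃ t ∈ Q, t ≠ s) (h : ∀ s ∈ Q, ∀ u ∈ N, ownDeg G P s u = 0 ∧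
      restDeg G P s m u = (Finset.univ.filter fun t => t ∈ Q).card ∧
      wdeg G m s = m s(s, u) + (Finset.univ.filter fun t => t ∈ Q).card) : Good G m := by
  have hP : P = ∅ := by
    refine Set.eq_empty_of_forall_notMem fun x hx => ?_
    obtain ⟨n, p, hp, hpart, h0, hL, -⟩ := hB x hx
    have h1 := hp.one_le
    have h2 := (h _ h0 _ hL).1
    rw [ownDeg, Finset.card_eq_zero, Finset.filter_eq_empty_iff] at h2
    refine h2 (Finset.mem_univ (p n)) ⟨(hp.adj n le_rfl).symm, ?_⟩
    refine mem_ownSet_of_mem_part (x := x) ⟨hx, p 1, ?_, hp.adj 0 (by omega)⟩ ?_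
    · rw [hpart]
      exact ⟨1, le_rfl, h1, rfl⟩
    · rw [hpart]
      exact ⟨n, h1, le_rfl, rfl⟩
  choose! k hkK hk using F.N_adj_K
  set S := Finset.univ.filter fun t => t ∈ Q with hS
  have hmem : ∀ t, t ∈ S ↔ t ∈ Q := fun t => by simp [hS]
  obtain ⟨u₀, hu₀⟩ := F.N_nonempty
  obtain ⟨t, ht, hts⟩ := hQ
  have hq2 : 1 < S.card := Finset.one_lt_card.2 ⟨t, (hmem t).2 ht, s, (hmem s).2 hs, hts⟩
  by_cases hq : ∃ t' ∈ Q, t' ≠ s ∧ t' ≠ t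
  · obtain ⟨t', ht', hts', htt'⟩ := hq
    obtain ⟨u₁, hu₁, hne⟩ : ∃ u ∈ N, u ≠ u₀ := by
      by_contra! hN
      have h1 := F.wdeg_eq_sum (m := m) hc hB hs
      have h2 : (Finset.univ.filter fun u => u ∈ N) = {u₀} := by
        ext x
        simp only [Finset.mem_filter, Finset.mem_univ, true_and, Finset.mem_singleton]
        exact ⟨hN x, by rintro rfl; exact hu₀⟩
      rw [h2, Finset.sum_singleton] at h1
      have := h s hs u₀ hu₀
      omega
    refine F.good_of_switch hG hc hm hbad hP hs
      (fun u => insert (k u) ((S.erase s).erase (if u = u₀ then t else t')))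
      (fun u hu => ⟨k u, hkK u hu, hk u hu, Finset.mem_insert_self _ _⟩) ?_ ?_ ?_
    · intro u hu y hy
      rcases Finset.mem_insert.1 hy with rfl | hy
      · exact Or.inl (hkK u hu)
      · have hy' := Finset.mem_of_mem_erase hy
        exact Or.inr ⟨(hmem y).1 (Finset.mem_of_mem_erase hy'), Finset.ne_of_mem_erase hy'⟩
    · intro u hu
      have h1 := Finset.card_insert_le (k u) ((S.erase s).erase (if u = u₀ then t else t'))
      have h2 : ((S.erase s).erase (if u = u₀ then t else t')).card + 1 = (S.erase s).card := by
        refine Finset.card_erase_add_one ?_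
        split_ifs <;> simp [*]
      have h3 := Finset.card_erase_add_one ((hmem s).2 hs)
      have := h s hs u hu
      omega
    · intro x hx hxs
      left
      by_cases hxt : x = t
      · refine ⟨u₁, hu₁, Finset.mem_insert_of_mem ?_⟩
        rw [if_neg hne, hxt]
        simp [hmem, ht, hts, htt'.symm]
      · refine ⟨u₀, hu₀, Finset.mem_insert_of_mem ?_⟩
        rw [if_pos rfl]
        simp [hmem, hx, hxs, hxt]
  · push Not at hq
    have hcard : S.card = 2 := by
      refine le_antisymm ?_ hq2
      have : S ⊆ {s, t} := fun x hx => by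
        by_cases hxs : x = s
        · simp [hxs]
        · simp [hq x ((hmem x).1 hx) hxs]
      exact (Finset.card_le_card this).trans Finset.card_le_two
    rw [hcard] at h
    refine F.good_of_switch hG hc hm hbad hP hs (fun u => {k u})
      (fun u hu => ⟨k u, hkK u hu, hk u hu, Finset.mem_singleton_self _⟩) ?_ ?_ ?_
    · intro u hu y hy
      rw [Finset.mem_singleton.1 hy]
      exact Or.inl (hkK u hu)
    · intro u hu
      have := h s hs u hu
      rw [Finset.card_singleton]
      omega
    · intro x hx hxs
      refine Or.inr ⟨fun u hu hxu => F.KQ x (Finset.mem_singleton.1 hxu ▸ hkK u hu) hx, ?_⟩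
      have hkx : k u₀ ≠ x := fun h => F.KQ x (h ▸ hkK u₀ hu₀) hx
      have h1 : m s(u₀, k u₀) + m s(u₀, x) ≤ restDeg G P s m u₀ := by
        rw [restDeg, ← Finset.sum_pair (f := fun y => m s(u₀, y)) hkx]
        refine Finset.sum_le_sum_of_subset ?_
        rw [Finset.insert_subset_iff, Finset.singleton_subset_iff, Finset.mem_filter,
          Finset.mem_filter]
        refine ⟨⟨Finset.mem_univ _, hk u₀ hu₀, fun h => F.KQ s (h ▸ hkK u₀ hu₀) hs,
          fun h => F.KP _ (hkK u₀ hu₀) h.1⟩, Finset.mem_univ _, (F.Q_adj_N x hx u₀ hu₀).symm,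
          hxs, fun h => F.QP x hx h.1⟩
      have h2 := (h s hs u₀ hu₀).2.1
      have h3 := (h x hx u₀ hu₀).2.2
      have h4 := hm s(u₀, k u₀)
      have h5 := hm s(u₀, x)
      rw [Sym2.eq_swap] at h3
      omega

theorem good_of_bridged (F : Frame G m K N Q P) (hG : G.Connected)
    (hc : IsTwoColoring G c) (hm : ∀ e, 1 ≤ m e) (hB : Bridged G N Q P) : Good G m := by
  by_contra hbad
  obtain ⟨s, hs⟩ := F.Q_nonempty
  by_cases hQ : ∀ t ∈ Q, t = s
  · exact hbad (F.good_of_unique hG hc hm hbad hB hs hQ)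
  · push Not at hQ
    refine hbad (F.good_of_uniform hG hc hm hbad hB hs hQ fun s' hs' =>
      (F.good_or_uniform hG hc hm hbad hB hs' ?_).resolve_left hbad)
    by_cases h : s' = s
    · exact h ▸ hQ
    · exact ⟨s, hs, Ne.symm h⟩

end Frame

end OddCactus

namespace OddCactus

variable {V : Type} {G : SimpleGraph V} {m : Sym2 V → ℕ} {c : V → ZMod 2}

theorem isMultiCactus_of_forall_eq_or_eq {x y : V} (hxy : G.Adj x y)
    (h : ∀ z, z = x ∨ z = y) : IsMultiCactus G m := by
  have hyx : y ≠ x := hxy.ne'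
  let φ : V ≃ Fin 2 :=
    { toFun := fun z => if z = x then 0 else 1
      invFun := fun i => if i = 0 then x else y
      left_inv := fun z => by rcases h z with rfl | rfl <;> simp [hyx]
      right_inv := fun i => by fin_cases i <;> simp [hyx] }
  have hadj : ∀ a b, G.Adj a b ↔ a ≠ b := by
    intro a b
    refine ⟨fun h => h.ne, fun hab => ?_⟩
    rcases h a with rfl | rfl <;> rcases h b with rfl | rfl
    · exact absurd rfl hab
    · exact hxy
    · exact hxy.symm
    · exact absurd rfl hab
  refine ⟨Fin 2, ⊤, _, OMC.k2, ⟨φ, ?_⟩, ?_⟩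
  · intro a b
    rw [SimpleGraph.top_adj, hadj, φ.injective.ne_iff]
  · intro a b hab _
    rw [SimpleGraph.mem_edgeSet, SimpleGraph.top_adj]
    exact φ.injective.ne hab.ne

theorem isMultiCactus_of_smaller [Fintype V] (IH : SmallerBadAreCacti V) (hG : G.Connected)
    (hc : IsTwoColoring G c) (hm : ∀ e, 1 ≤ m e) (hbad : ¬ Good G m) : IsMultiCactus G m := by
  by_cases hthin : ∀ v, ∃ q, Thin G m v q
  · exact isMultiCactus_of_forall_thin IH hG hc hm hbad hthin
  push Not at hthin
  obtain ⟨v₀, hv₀⟩ := hthin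
  by_cases hleaf : ∃ x y, G.Adj x y ∧ ∀ z, z ≠ y → ¬ G.Adj x z
  · obtain ⟨x, y, hxy, h⟩ := hleaf
    refine isMultiCactus_of_forall_eq_or_eq hxy (eq_or_eq_of_leaf hG hc hm hbad fun z => ⟨?_, ?_⟩)
    · exact fun hz => by_contra fun hzy => h z hzy hz
    · rintro rfl
      exact hxy
  push Not at hleaf
  obtain ⟨a, b, hab⟩ : ∃ a b, G.Adj a b := by
    by_contra! hcon
    exact hbad ⟨m, fun e _ => ⟨le_rfl, Nat.le_mul_of_pos_left _ two_pos⟩,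
      fun u v h => absurd h (hcon u v)⟩
  have hex : ∃ u, G.Adj v₀ u := by
    obtain ⟨W⟩ := hG.preconnected v₀ a
    cases W with
    | nil => exact ⟨b, hab⟩
    | cons h _ => exact ⟨_, h⟩
  obtain ⟨K, N, Q, P, F⟩ := exists_frame hG hc hleaf hex hv₀
  by_contra hcac
  exact hbad (F.good_of_bridged hG hc hm fun x hx =>
    F.exists_path_of_not_flexible IH hG hc hm hbad hcac hx
      (F.not_flexible IH hG hc hm hleaf hbad hcac hx))

theorem isMultiCactus_of_not_good [Fintype V] (hG : G.Connected) (hc : IsTwoColoring G c)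
    (hm : ∀ e, 1 ≤ m e) (hbad : ¬ Good G m) : IsMultiCactus G m := by
  suffices H : ∀ n, ∀ (V : Type) [Fintype V] (G : SimpleGraph V) (m : Sym2 V → ℕ),
      Fintype.card V = n → G.Connected → (∃ c, IsTwoColoring G c) → (∀ e, 1 ≤ m e) →
      ¬ Good G m → IsMultiCactus G m from H _ V G m rfl hG ⟨c, hc⟩ hm hbad
  intro n
  induction n using Nat.strong_induction_on with
  | _ n ih =>
    rintro V _ G m rfl hG ⟨c, hc⟩ hm hbad
    exact isMultiCactus_of_smaller (fun V' _ G' m' hlt => ih _ hlt V' G' m' rfl) hG hc hm hbad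

theorem hasABProperty_iff_good [Fintype V] : HasABProperty G 1 2 ↔ Good G fun _ => 1 := by
  constructor
  · rintro ⟨w, hw, h⟩
    refine ⟨fun e => (w e).toNat, fun e he => ?_, fun u v huv heq => h huv ?_⟩
    · rcases hw e he with h | h <;> simp [h]
    · have key : ∀ x, wdegZ G w x = wdeg G (fun e => (w e).toNat) x := by
        intro x
        rw [wdegZ, wdeg, Nat.cast_sum]
        refine Finset.sum_congr rfl fun y hy => ?_
        rcases hw s(x, y) (Finset.mem_filter.1 hy).2 with h | h <;> simp [h]
      rw [key, key, heq]
  · rintro ⟨w, hw, h⟩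
    refine ⟨fun e => w e, fun e he => ?_, fun u v huv heq => h huv ?_⟩
    · obtain ⟨h1, h2⟩ := hw e he
      dsimp only at h1 h2 ⊢
      omega
    · rw [wdegZ, wdegZ, ← Nat.cast_sum, ← Nat.cast_sum, Nat.cast_inj] at heq
      exact heq

theorem exists_isTwoColoring (h : G.Colorable 2) : ∃ c, IsTwoColoring G c := by
  obtain ⟨C⟩ := h
  have key : ∀ a b : ZMod 2, a ≠ b → b = a + 1 := by decide
  exact ⟨fun v => (C v : Fin 2), fun u v huv => key _ _ (C.valid huv)⟩

end OddCactus

/-- A finite connected simple bipartite graph fails to have the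
`{1,2}`-property if and only if it is a simple odd multi-cactus. -/
theorem statement8 {V : Type} [Fintype V] (G : SimpleGraph V) (hconn : G.Connected)
    (hbip : G.Colorable 2) :
    ¬ HasABProperty G 1 2 ↔ IsSimpleOddMultiCactus G := by
  refine ⟨fun h => ?_, OddCactus.not_hasABProperty_of_cactus⟩
  obtain ⟨c, hc⟩ := OddCactus.exists_isTwoColoring hbip
  obtain ⟨W, H, green, hH, φ, -⟩ := OddCactus.isMultiCactus_of_not_good (m := fun _ => 1) hconn hc
    (fun _ => le_rfl) (mt OddCactus.hasABProperty_iff_good.2 h)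
  exact ⟨W, H, green, hH, ⟨φ⟩⟩
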